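/- Let H be a nearest-neighbor one-dimensional SFT presented by a finite directed graph G = (A, E) in which every vertex has at least one outgoing and one incoming edge, and suppose G does not satisfy condition D. Then there exists a one-dimensional SFT V ⊆ A^ℤ such that the combined subshift X_{H,V} is nonempty and h(X_{H,V}) is not a computable real number. -/

import Mathlib

open Filter

/-- Shift on one-dimensional configurations: `(shift1 p x) k = x (k - p)`. -/
def shift1 {A : Type*} (p : ℤ) (x : ℤ → A) : ℤ → A := fun k => x (k - p)

/-- Shift on two-dimensional configurations: `(shift2 v x) k = x (k - v)`. -/
def shift2 {A : Type*} (v : ℤ × ℤ) (x : ℤ × ℤ → A) : ℤ × ℤ → A := fun k => x (k - v)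

/-- The finite word `w` occurs in the bi-infinite sequence `x`. -/
def occursIn1 {A : Type*} (w : List A) (x : ℤ → A) : Prop :=
  ∃ i : ℤ, ∀ (n : ℕ) (h : n < w.length), x (i + n) = w.get ⟨n, h⟩

/-- The one-dimensional SFT avoiding the finite set `F` of forbidden words. -/
def SFT1 {A : Type*} (F : Finset (List A)) : Set (ℤ → A) :=
  {x | ∀ w ∈ F, ¬ occursIn1 w x}

/-- `H` is a one-dimensional subshift of finite type. -/
def IsSFT1 {A : Type*} (H : Set (ℤ → A)) : Prop :=
  ∃ F : Finset (List A), H = SFT1 F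

/-- A finite two-dimensional pattern: a finite support together with values. -/
structure Pattern2 (A : Type*) where
  support : Finset (ℤ × ℤ)
  val : ℤ × ℤ → A

/-- The pattern `p` occurs in the configuration `x`. -/
def Pattern2.OccursIn {A : Type*} (p : Pattern2 A) (x : ℤ × ℤ → A) : Prop :=
  ∃ v : ℤ × ℤ, ∀ u ∈ p.support, x (u + v) = p.val u

/-- The two-dimensional SFT avoiding the finite set `F` of forbidden patterns. -/
def SFT2 {A : Type*} (F : Finset (Pattern2 A)) : Set (ℤ × ℤ → A) :=
  {x | ∀ p ∈ F, ¬ p.OccursIn x}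

/-- The SFT `X_F` with added horizontal constraints from `H`: every row lies in `H`
and no pattern of `F` occurs. -/
def XHF {A : Type*} (H : Set (ℤ → A)) (F : Finset (Pattern2 A)) : Set (ℤ × ℤ → A) :=
  {x | (∀ j : ℤ, (fun k => x (k, j)) ∈ H) ∧ ∀ p ∈ F, ¬ p.OccursIn x}

/-- The combined subshift: rows in `H`, columns in `V`. -/
def XHV {A : Type*} (H V : Set (ℤ → A)) : Set (ℤ × ℤ → A) :=
  {x | (∀ j : ℤ, (fun k => x (k, j)) ∈ H) ∧ ∀ i : ℤ, (fun l => x (i, l)) ∈ V}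

/-- Number of restrictions of elements of `X` to `[0,m) × [0,n)`. -/
noncomputable def patCount2 {A : Type*} (X : Set (ℤ × ℤ → A)) (m n : ℕ) : ℕ :=
  Set.ncard {p : Fin m → Fin n → A |
    ∃ x ∈ X, ∀ (i : Fin m) (j : Fin n), x ((i : ℤ), (j : ℤ)) = p i j}

/-- Topological entropy of a two-dimensional subshift. -/
noncomputable def entropy2 {A : Type*} (X : Set (ℤ × ℤ → A)) : ℝ :=
  ⨅ n : ℕ, Real.logb 2 (patCount2 X (n + 1) (n + 1)) / ((n : ℝ) + 1) ^ 2

/-- The word `w` belongs to the language of `H`. -/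
def wordIn {A : Type*} (H : Set (ℤ → A)) (w : List A) : Prop :=
  ∃ x ∈ H, occursIn1 w x

/-- Number of length-`n` words in the language of `H`. -/
noncomputable def wordCount {A : Type*} (H : Set (ℤ → A)) (n : ℕ) : ℕ :=
  Set.ncard {w : List A | w.length = n ∧ wordIn H w}

/-- Topological entropy of a one-dimensional subshift. -/
noncomputable def entropy1 {A : Type*} (H : Set (ℤ → A)) : ℝ :=
  ⨅ n : ℕ, Real.logb 2 (wordCount H (n + 1)) / ((n : ℝ) + 1)

/-- `X` is a two-dimensional subshift (closed and shift-invariant). -/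
def IsSubshift2 {A : Type*} [TopologicalSpace A] (X : Set (ℤ × ℤ → A)) : Prop :=
  IsClosed X ∧ ∀ (v : ℤ × ℤ) (x : ℤ × ℤ → A), x ∈ X → shift2 v x ∈ X

/-- `X` is an `(m,n)`-th root of `Y`. -/
def IsRoot {A B : Type*} [TopologicalSpace A] [TopologicalSpace B]
    (X : Set (ℤ × ℤ → A)) (Y : Set (ℤ × ℤ → B)) (m n : ℕ) : Prop :=
  ∃ Z : Set (ℤ × ℤ → A), Z ⊆ X ∧ IsClopen {x : X | (x : ℤ × ℤ → A) ∈ Z} ∧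
    shift2 ((m : ℤ), 0) '' Z = Z ∧ shift2 (0, (n : ℤ)) '' Z = Z ∧
    (∃ φ : Z ≃ₜ Y,
      ∀ (x : Z) (k₁ k₂ : ℤ)
        (hx : shift2 (k₁ * (m : ℤ), k₂ * (n : ℤ)) (x : ℤ × ℤ → A) ∈ Z),
        (φ ⟨shift2 (k₁ * (m : ℤ), k₂ * (n : ℤ)) (x : ℤ × ℤ → A), hx⟩ : ℤ × ℤ → B) =
          shift2 (k₁, k₂) (φ x : ℤ × ℤ → B)) ∧
    (∀ i j : ℕ, i < m → j < n → shift2 ((i : ℤ), (j : ℤ)) '' Z ⊆ X) ∧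
    ∀ x ∈ X, ∃! q : Fin m × Fin n, x ∈ shift2 ((q.1 : ℤ), (q.2 : ℤ)) '' Z

/-- The vertex shift (nearest-neighbor SFT) of a directed graph on `A`. -/
def vertexShift {A : Type*} (E : A → A → Prop) : Set (ℤ → A) :=
  {x | ∀ i : ℤ, E (x i) (x (i + 1))}

/-- Strongly connected component: a maximal nonempty set whose vertices are pairwise
joined by nonempty directed paths. -/
def IsSCC {A : Type*} (E : A → A → Prop) (S : Set A) : Prop :=
  S.Nonempty ∧ (∀ a ∈ S, ∀ b ∈ S, Relation.TransGen E a b) ∧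
    ∀ T : Set A, S ⊆ T → (∀ a ∈ T, ∀ b ∈ T, Relation.TransGen E a b) → T = S

def ReflexiveType {A : Type*} (E : A → A → Prop) (S : Set A) : Prop :=
  ∀ v ∈ S, E v v

def SymmetricType {A : Type*} (E : A → A → Prop) (S : Set A) : Prop :=
  ∀ v ∈ S, ∀ w ∈ S, v ≠ w → E v w → E w v

def StateSplitType {A : Type*} (E : A → A → Prop) (S : Set A) : Prop :=
  ∃ p : ℕ, 0 < p ∧ ∃ f : A → ZMod p,
    (∀ i : ZMod p, ∃ v ∈ S, f v = i) ∧
    ∀ v ∈ S, ∀ w ∈ S, (E v w ↔ f w = f v + 1)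

/-- Condition D: all SCCs share one of the three types. -/
def ConditionD {A : Type*} (E : A → A → Prop) : Prop :=
  (∀ S : Set A, IsSCC E S → ReflexiveType E S) ∨
  (∀ S : Set A, IsSCC E S → SymmetricType E S) ∨
  (∀ S : Set A, IsSCC E S → StateSplitType E S)

/-- A real is Π₁-computable (right-recursively enumerable). -/
def Pi1Computable (x : ℝ) : Prop :=
  ∃ f : ℕ → ℚ, Computable f ∧ Antitone f ∧
    Tendsto (fun n => (f n : ℝ)) atTop (nhds x)

/-- A computable real number. -/
def IsComputableReal (x : ℝ) : Prop :=
  ∃ f : ℕ → ℚ, Computable f ∧ ∀ n : ℕ, |(f n : ℝ) - x| ≤ (2 : ℝ) ^ (-(n : ℤ))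

/-- `w` is a finite concatenation of copies of `w₁` and `w₂`. -/
def IsConcat {A : Type*} (w₁ w₂ w : List A) : Prop :=
  ∃ L : List (List A), (∀ v ∈ L, v = w₁ ∨ v = w₂) ∧ w = L.flatten

/-- Transitivity of a one-dimensional subshift. -/
def Transitive1 {A : Type*} (H : Set (ℤ → A)) : Prop :=
  ∀ u w : List A, wordIn H u → wordIn H w → ∃ v : List A, wordIn H (u ++ v ++ w)

/-- The subshift of elements of `H` avoiding the word `u`. -/
def avoidWord {A : Type*} (H : Set (ℤ → A)) (u : List A) : Set (ℤ → A) :=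
  {x ∈ H | ¬ occursIn1 u x}

/-- Parity of a phase in `ℤ/4`. -/
def oddPhase (k : ZMod 4) : Prop := k = 1 ∨ k = 3

/-- The hierarchical set of columns (rows) of level at least `m`, read off from the parity
labels `p` and the side labels `s`. -/
def inLev (p s : ℤ → Bool) : ℕ → ℤ → Prop
  | 0, _ => True
  | 1, x => p x = false
  | (m + 2), x => inLev p s (m + 1) x ∧ s (x + 2 ^ m) = false

/-- The local rules of the hierarchical skeleton. -/
structure Skel (px sx py sy : ℤ → Bool) (c : ℤ → ℤ → Ordering) (k k' : ℤ → ℤ → ZMod 4) :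
    Prop where
  px_alt : ∀ x, px (x + 1) = !px x
  py_alt : ∀ y, py (y + 1) = !py y
  c_oo : ∀ x y, px x = true → py y = true → c x y = .eq
  c_eo : ∀ x y, px x = false → py y = true → c x y = .gt
  c_oe : ∀ x y, px x = true → py y = false → c x y = .lt
  k_eq : ∀ x y, c x y = .eq → k x y = if sx x then 2 else 0
  k_eq' : ∀ x y, c x y = .eq → k (x + 1) y = k x y + 1
  k_gt : ∀ x y, c x y = .gt → oddPhase (k x y)
  k_gt' : ∀ x y, c x y = .gt → k (x + 1) y = k x y + 1
  k_lt' : ∀ x y, c x y = .lt → k (x + 1) y = k x y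
  l_eq : ∀ x y, c x y = .eq → k' x y = if sy y then 2 else 0
  l_eq' : ∀ x y, c x y = .eq → k' x (y + 1) = k' x y + 1
  l_lt : ∀ x y, c x y = .lt → oddPhase (k' x y)
  l_lt' : ∀ x y, c x y = .lt → k' x (y + 1) = k' x y + 1
  l_gt' : ∀ x y, c x y = .gt → k' x (y + 1) = k' x y
  centre : ∀ x y, c x y = .gt → k x y = 1 → (oddPhase (k' x y) ↔ sy y = true)
  centre' : ∀ x y, c x y = .lt → k' x y = 1 → (oddPhase (k x y) ↔ sx x = true)

theorem Skel.swap {px sx py sy : ℤ → Bool} {c : ℤ → ℤ → Ordering} {k k' : ℤ → ℤ → ZMod 4}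
    (h : Skel px sx py sy c k k') :
    Skel py sy px sx (fun x y => (c y x).swap) (fun x y => k' y x) (fun x y => k y x) where
  px_alt := h.py_alt
  py_alt := h.px_alt
  c_oo x y h1 h2 := by simp [h.c_oo y x h2 h1]
  c_eo x y h1 h2 := by simp [h.c_oe y x h2 h1]
  c_oe x y h1 h2 := by simp [h.c_eo y x h2 h1]
  k_eq x y h1 := h.l_eq y x (by simpa using h1)
  k_eq' x y h1 := h.l_eq' y x (by simpa using h1)
  k_gt x y h1 := h.l_lt y x (by simpa using h1)
  k_gt' x y h1 := h.l_lt' y x (by simpa using h1)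
  k_lt' x y h1 := h.l_gt' y x (by simpa using h1)
  l_eq x y h1 := h.k_eq y x (by simpa using h1)
  l_eq' x y h1 := h.k_eq' y x (by simpa using h1)
  l_lt x y h1 := h.k_gt y x (by simpa using h1)
  l_lt' x y h1 := h.k_gt' y x (by simpa using h1)
  l_gt' x y h1 := h.k_lt' y x (by simpa using h1)
  centre x y h1 := h.centre' y x (by simpa using h1)
  centre' x y h1 := h.centre y x (by simpa using h1)

/-- A property holding exactly on a residue class modulo `q`. -/
def IsClass (q : ℤ) (P : ℤ → Prop) : Prop := ∃ a, ∀ x, P x ↔ q ∣ x - a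

theorem IsClass.add {q : ℤ} {P : ℤ → Prop} (h : IsClass q P) {x : ℤ} (hx : P x) (z : ℤ) :
    P (x + z) ↔ q ∣ z := by
  obtain ⟨a, ha⟩ := h
  rw [ha] at hx ⊢
  rw [show x + z - a = (x - a) + z by ring]
  exact (Int.dvd_add_right hx)

theorem IsClass.sub {q : ℤ} {P : ℤ → Prop} (h : IsClass q P) {x : ℤ} (hx : P x) (z : ℤ) :
    P (x - z) ↔ q ∣ z := by
  rw [sub_eq_add_neg, h.add hx]; simp

theorem IsClass.half {q : ℤ} {P Q : ℤ → Prop} (h : IsClass q P)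
    (hQ : ∀ x, P x → (Q (x + q) ↔ ¬ Q x)) : IsClass (2 * q) (fun x => P x ∧ Q x) := by
  have hP : ∃ a, P a ∧ Q a := by
    obtain ⟨a, ha⟩ := id h
    have h1 : P a := (ha a).2 (by simp)
    by_cases hq : Q a
    · exact ⟨a, h1, hq⟩
    · exact ⟨a + q, (h.add h1 q).2 dvd_rfl, (hQ a h1).2 hq⟩
  obtain ⟨a, ha, hqa⟩ := hP
  have key : ∀ n : ℤ, P (a + q * n) ∧ (Q (a + q * n) ↔ Even n) := by
    intro n
    have hp : ∀ n : ℤ, P (a + q * n) := fun n => (h.add ha _).2 (dvd_mul_right _ _)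
    refine ⟨hp n, ?_⟩
    induction n using Int.induction_on with
    | zero => simpa using hqa
    | succ i ih =>
      rw [show a + q * ((i : ℤ) + 1) = (a + q * i) + q by ring, hQ _ (hp _), ih]
      simp
    | pred i ih =>
      have := hQ _ (hp (-(i : ℤ) - 1))
      rw [show a + q * (-(i : ℤ) - 1) + q = a + q * (-(i : ℤ)) by ring, ih] at this
      rw [Int.even_sub_one]; tauto
  refine ⟨a, fun x => ⟨fun ⟨h1, h2⟩ => ?_, fun hx => ?_⟩⟩
  · have : q ∣ x - a := by
      have := (h.add ha (x - a)).1 (by simpa using h1)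
      exact this
    obtain ⟨n, hn⟩ := this
    have hx : x = a + q * n := by linarith
    rw [hx] at h2
    obtain ⟨r, hr⟩ := (key n).2.1 h2
    exact ⟨r, by rw [hn, hr]; ring⟩
  · obtain ⟨n, hn⟩ := hx
    have hx : x = a + q * (n + n) := by linarith
    rw [hx]
    exact ⟨(key _).1, (key _).2.2 ⟨n, rfl⟩⟩

theorem IsClass.exists {q : ℤ} {P : ℤ → Prop} (h : IsClass q P) : ∃ a, P a := by
  obtain ⟨a, ha⟩ := h
  exact ⟨a, (ha a).2 (by simp)⟩

theorem inLev_succ {p s : ℤ → Bool} {m : ℕ} {x : ℤ} (h : inLev p s (m + 1) x) :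
    inLev p s m x := by
  cases m with
  | zero => trivial
  | succ m => exact h.1

theorem inLev_mono {p s : ℤ → Bool} {m n : ℕ} (hmn : m ≤ n) {x : ℤ} (h : inLev p s n x) :
    inLev p s m x := by
  induction n, hmn using Nat.le_induction with
  | base => exact h
  | succ n _ ih => exact ih (inLev_succ h)

/-- `x` has level exactly `m`. -/
def isLev (p s : ℤ → Bool) (m : ℕ) (x : ℤ) : Prop := inLev p s m x ∧ ¬ inLev p s (m + 1) x

theorem exists_isLev_lt {p s : ℤ → Bool} {m : ℕ} {x : ℤ} (h : ¬ inLev p s m x) :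
    ∃ l < m, isLev p s l x := by
  induction m with
  | zero => exact absurd trivial h
  | succ m ih =>
    by_cases h' : inLev p s m x
    · exact ⟨m, by omega, h', h⟩
    · obtain ⟨l, hl, h2⟩ := ih h'
      exact ⟨l, by omega, h2⟩

/-- Constancy along a run. -/
theorem const_run {α : Type*} {f : ℤ → α} {x : ℤ} {n : ℤ} (hn : 0 ≤ n)
    (h : ∀ z, x ≤ z → z < x + n → f (z + 1) = f z) : f (x + n) = f x := by
  have : ∀ i : ℕ, (i : ℤ) ≤ n → f (x + i) = f x := by
    intro i
    induction i with
    | zero => simp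
    | succ i ih =>
      intro hi
      push_cast at hi
      rw [show x + ((i + 1 : ℕ) : ℤ) = (x + i) + 1 by push_cast; ring,
        h _ (by omega) (by omega), ih (by omega)]
  obtain ⟨i, rfl⟩ := Int.eq_ofNat_of_zero_le hn
  exact this i le_rfl

variable {px sx py sy : ℤ → Bool} {c : ℤ → ℤ → Ordering} {k k' : ℤ → ℤ → ZMod 4}

/-- The comparison symbol at crossings involving level `m`. -/
def CmpAt (px sx py sy : ℤ → Bool) (c : ℤ → ℤ → Ordering) (m : ℕ) : Prop :=
  (∀ x y, isLev px sx m x → isLev py sy m y → c x y = .eq) ∧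
  (∀ x y, inLev px sx (m + 1) x → isLev py sy m y → c x y = .gt) ∧
  (∀ x y, isLev px sx m x → inLev py sy (m + 1) y → c x y = .lt)

theorem CmpAt.swap {m : ℕ} (h : CmpAt px sx py sy c m) :
    CmpAt py sy px sx (fun x y => (c y x).swap) m :=
  ⟨fun x y h1 h2 => by simp [h.1 y x h2 h1], fun x y h1 h2 => by simp [h.2.2 y x h2 h1],
    fun x y h1 h2 => by simp [h.2.1 y x h2 h1]⟩

theorem isLev_add {m : ℕ} (hm : IsClass (2 ^ m) (inLev px sx m))
    (hm1 : IsClass (2 ^ (m + 1)) (inLev px sx (m + 1))) {x : ℤ} (hx : inLev px sx (m + 1) x) :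
    isLev px sx m (x + 2 ^ m) := by
  refine ⟨(hm.add (inLev_succ hx) _).2 dvd_rfl, fun h => ?_⟩
  have := (hm1.add hx _).1 h
  have h2 := Int.le_of_dvd (by positivity) this
  rw [pow_succ] at h2
  have : (0 : ℤ) < 2 ^ m := by positivity
  omega

theorem isLev_sub {m : ℕ} (hm : IsClass (2 ^ m) (inLev px sx m))
    (hm1 : IsClass (2 ^ (m + 1)) (inLev px sx (m + 1))) {x : ℤ} (hx : inLev px sx (m + 1) x) :
    isLev px sx m (x - 2 ^ m) := by
  have h : inLev px sx (m + 1) (x - 2 ^ (m + 1)) := (hm1.sub hx _).2 dvd_rfl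
  have := isLev_add hm hm1 h
  rwa [pow_succ, show x - 2 ^ m * 2 + 2 ^ m = x - 2 ^ m by ring] at this

theorem inLev_of_isLev {m : ℕ} (hm : IsClass (2 ^ m) (inLev px sx m))
    (hm1 : IsClass (2 ^ (m + 1)) (inLev px sx (m + 1))) {x : ℤ} (hx : isLev px sx m x) :
    inLev px sx (m + 1) (x - 2 ^ m) := by
  obtain ⟨b, hb⟩ := hm1.exists
  have h1 := (hm.add (inLev_succ hb) (x - b)).1 (by simpa using hx.1)
  obtain ⟨n, hn⟩ := h1
  have h2 : ¬ (2 : ℤ) ^ (m + 1) ∣ x - b := fun h => hx.2 (by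
    have := (hm1.add hb (x - b)).2 h; simpa using this)
  rw [show x - 2 ^ m = b + (x - b - 2 ^ m) by ring, hm1.add hb, hn]
  rcases Int.even_or_odd' n with ⟨r, rfl | rfl⟩
  · exact absurd ⟨r, by rw [hn, pow_succ]; ring⟩ h2
  · exact ⟨r, by rw [pow_succ]; ring⟩

theorem not_inLev_between {m : ℕ} (hm : IsClass (2 ^ m) (inLev px sx m)) {x z : ℤ}
    (hx : inLev px sx m x) (h1 : x < z) (h2 : z < x + 2 ^ m) : ¬ inLev px sx m z := by
  intro h
  have := (hm.add hx (z - x)).1 (by simpa using h)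
  have := Int.le_of_dvd (by omega) this
  omega

/-- The invariant of the inductive determination of the hierarchy. -/
structure SkelInv (px sx py sy : ℤ → Bool) (c : ℤ → ℤ → Ordering) (m : ℕ) : Prop where
  clx : ∀ l ≤ m + 1, IsClass (2 ^ l) (inLev px sx l)
  cly : ∀ l ≤ m + 1, IsClass (2 ^ l) (inLev py sy l)
  cmp : ∀ l ≤ m, CmpAt px sx py sy c l

theorem SkelInv.swap {m : ℕ} (h : SkelInv px sx py sy c m) :
    SkelInv py sy px sx (fun x y => (c y x).swap) m :=
  ⟨h.cly, h.clx, fun l hl => (h.cmp l hl).swap⟩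

/-- Along a row of level `m`, columns outside level `m` are crossed with `lt`. -/
theorem SkelInv.row_lt {m : ℕ} (h : SkelInv px sx py sy c m) {l : ℕ} (hl : l ≤ m + 1) {x y : ℤ}
    (hy : inLev py sy l y) (hx : ¬ inLev px sx l x) : c x y = .lt := by
  obtain ⟨i, hi, h2⟩ := exists_isLev_lt hx
  exact (h.cmp i (by omega)).2.2 x y h2 (inLev_mono (by omega) hy)

theorem SkelInv.phase (hs : Skel px sx py sy c k k') {m : ℕ} (h : SkelInv px sx py sy c m)
    {x y : ℤ} (hy : isLev py sy m y) (hx : inLev px sx (m + 1) x) :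
    k (x + 2 ^ m) y = k x y + 1 ∧ k (x + 2 ^ m + 2 ^ m) y = k x y + 2 ∧
      k (x + 1) y = k x y + 1 ∧ oddPhase (k x y) ∧
      (sx (x + 2 ^ m) = false ↔ k x y = 3) := by
  have hpos : (0 : ℤ) < 2 ^ m := by positivity
  have run : ∀ z, inLev px sx m z → k (z + 2 ^ m) y = k (z + 1) y := by
    intro z hz
    have := const_run (f := fun z => k z y) (x := z + 1) (n := 2 ^ m - 1) (by omega) (fun w h1 h2 =>
      hs.k_lt' w y (h.row_lt (l := m) (by omega) hy.1
        (not_inLev_between (h.clx m (by omega)) hz (by omega) (by omega))))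
    simpa using this
  have c1 := (h.cmp m le_rfl).2.1 x y hx hy
  have hl := isLev_add (h.clx m (by omega)) (h.clx (m + 1) le_rfl) hx
  have c2 := (h.cmp m le_rfl).1 _ y hl hy
  have e1 := run x (inLev_succ hx)
  have e2 := run _ hl.1
  have e3 := hs.k_gt x y c1
  have e4 := hs.k_gt' x y c1
  have e5 := hs.k_eq _ y c2
  have e6 := hs.k_eq' _ y c2
  refine ⟨e1.trans e4, ?_, e4, e3, ?_⟩
  · rw [e2, e6, e1, e4]; ring
  · rw [e1, e4] at e5
    revert e5 e3
    generalize k x y = q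
    unfold oddPhase
    cases sx (x + 2 ^ m) <;> revert q <;> decide

theorem SkelInv.half (hs : Skel px sx py sy c k k') {m : ℕ} (h : SkelInv px sx py sy c m) {x : ℤ}
    (hx : inLev px sx (m + 1) x) :
    (sx (x + 2 ^ (m + 1) + 2 ^ m) = !sx (x + 2 ^ m)) := by
  obtain ⟨b, hb⟩ := (h.cly (m + 1) le_rfl).exists
  have hy := isLev_add (h.cly m (by omega)) (h.cly (m + 1) le_rfl) hb
  obtain ⟨-, h1, -, ho, h2⟩ := h.phase hs hy hx
  have hx' : inLev px sx (m + 1) (x + 2 ^ (m + 1)) :=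
    ((h.clx (m + 1) le_rfl).add hx _).2 dvd_rfl
  obtain ⟨-, -, -, -, h4⟩ := h.phase hs hy hx'
  rw [show x + 2 ^ m + 2 ^ m = x + 2 ^ (m + 1) by rw [pow_succ]; ring] at h1
  rw [h1] at h4
  have : (k x (b + 2 ^ m) + 2 = 3 ↔ ¬ k x (b + 2 ^ m) = 3) := by
    revert ho
    generalize k x (b + 2 ^ m) = q
    unfold oddPhase
    revert q; decide
  rw [this, ← h2] at h4
  revert h4
  cases sx (x + 2 ^ m) <;> cases sx (x + 2 ^ (m + 1) + 2 ^ m) <;> simp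

theorem SkelInv.clx_succ (hs : Skel px sx py sy c k k') {m : ℕ} (h : SkelInv px sx py sy c m) :
    IsClass (2 ^ (m + 2)) (inLev px sx (m + 2)) := by
  have := (h.clx (m + 1) le_rfl).half (Q := fun x => sx (x + 2 ^ m) = false) (fun x hx => by
    show sx (x + 2 ^ (m + 1) + 2 ^ m) = false ↔ _
    rw [h.half hs hx]; cases sx (x + 2 ^ m) <;> simp)
  rw [show (2 : ℤ) ^ (m + 2) = 2 * 2 ^ (m + 1) by rw [pow_succ]; ring]
  exact this

theorem SkelInv.cmp_col (hs : Skel px sx py sy c k k') {m : ℕ} (h : SkelInv px sx py sy c m)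
    {x y : ℤ} (hx : isLev px sx (m + 1) x) (hy : inLev py sy (m + 1) y) :
    (¬ inLev py sy (m + 2) y → c x y = .eq) ∧ (inLev py sy (m + 2) y → c x y = .lt) := by
  have hpos : (0 : ℤ) < 2 ^ m := by positivity
  have hsx : sx (x + 2 ^ m) = true := by
    by_contra h'
    exact hx.2 ⟨hx.1, by simpa using h'⟩
  have centre : ∀ z, isLev py sy m z → (oddPhase (k' x z) ↔ sy z = true) := by
    intro z hz
    refine hs.centre x z ((h.cmp m le_rfl).2.1 x z hx.1 hz) ?_
    obtain ⟨-, -, -, ho, h2⟩ := h.phase hs hz hx.1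
    rcases ho with h3 | h3
    · exact h3
    · rw [h2.2 h3] at hsx; simp at hsx
  have run : ∀ z, inLev py sy m z → k' x (z + 2 ^ m) = k' x (z + 1) := by
    intro z hz
    have := const_run (f := fun z => k' x z) (x := z + 1) (n := 2 ^ m - 1) (by omega)
      (fun w h1 h2 => hs.l_gt' x w (by
        have hb : ¬ inLev py sy m w :=
          not_inLev_between (h.cly m (by omega)) hz (by omega) (by omega)
        have := h.swap.row_lt (l := m) (by omega) (inLev_succ hx.1) hb
        simpa using this))
    simpa using this
  have hu := isLev_add (h.cly m (by omega)) (h.cly (m + 1) le_rfl) hy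
  have hd := isLev_sub (h.cly m (by omega)) (h.cly (m + 1) le_rfl) hy
  have gd := (h.cmp m le_rfl).2.1 x _ hx.1 hd
  have r1 := run _ hd.1
  rw [hs.l_gt' x _ gd, sub_add_cancel] at r1
  have r2 := run _ (inLev_succ hy)
  have c1 := centre _ hd
  have c2 := centre _ hu
  rw [← r1] at c1
  rw [r2] at c2
  have alt := h.swap.half hs.swap (x := y - 2 ^ (m + 1))
    (((h.cly (m + 1) le_rfl).sub hy _).2 dvd_rfl)
  rw [show y - 2 ^ (m + 1) + 2 ^ (m + 1) + 2 ^ m = y + 2 ^ m by ring,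
    show y - 2 ^ (m + 1) + 2 ^ m = y - 2 ^ m by rw [pow_succ]; ring] at alt
  have i1 := hs.l_eq x y
  have i2 := hs.l_eq' x y
  have i3 := hs.l_lt x y
  have i4 := hs.l_lt' x y
  have i5 := hs.l_gt' x y
  have hlev : inLev py sy (m + 2) y ↔ sy (y + 2 ^ m) = false := ⟨fun h => h.2, fun h => ⟨hy, h⟩⟩
  rw [hlev]
  revert i1 i2 i3 i4 i5 c1 c2 alt
  generalize c x y = o
  generalize k' x y = q
  generalize k' x (y + 1) = q'
  generalize sy (y + 2 ^ m) = b
  generalize sy (y - 2 ^ m) = b'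
  generalize sy y = b''
  unfold oddPhase
  clear * -
  revert o q q' b b' b''
  decide

theorem SkelInv.step (hs : Skel px sx py sy c k k') {m : ℕ} (h : SkelInv px sx py sy c m) :
    SkelInv px sx py sy c (m + 1) where
  clx l hl := by
    rcases Nat.lt_or_ge (m + 1) l with h1 | h1
    · obtain rfl : l = m + 2 := by omega
      exact h.clx_succ hs
    · exact h.clx l h1
  cly l hl := by
    rcases Nat.lt_or_ge (m + 1) l with h1 | h1
    · obtain rfl : l = m + 2 := by omega
      exact h.swap.clx_succ hs.swap
    · exact h.cly l h1
  cmp l hl := by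
    rcases Nat.lt_or_ge m l with h1 | h1
    · obtain rfl : l = m + 1 := by omega
      refine ⟨fun x y hx hy => (h.cmp_col hs hx hy.1).1 hy.2, fun x y hx hy => ?_,
        fun x y hx hy => (h.cmp_col hs hx (inLev_succ hy)).2 hy⟩
      have := (h.swap.cmp_col hs.swap hy (inLev_succ hx)).2 hx
      simpa using this
    · exact h.cmp l h1

theorem Skel.class_one {p s : ℤ → Bool} (hp : ∀ x, p (x + 1) = !p x) (l : ℕ) (hl : l ≤ 1) :
    IsClass (2 ^ l) (inLev p s l) := by
  interval_cases l
  · exact ⟨0, fun x => by simp [inLev]⟩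
  · have h0 : IsClass 1 (fun _ : ℤ => True) := ⟨0, by simp⟩
    have := h0.half (Q := fun x => p x = false) (fun x _ => by rw [hp]; cases p x <;> simp)
    simpa [inLev] using this

theorem Skel.inv (hs : Skel px sx py sy c k k') (m : ℕ) : SkelInv px sx py sy c m := by
  induction m with
  | zero =>
    refine ⟨Skel.class_one hs.px_alt, Skel.class_one hs.py_alt, fun l hl => ?_⟩
    obtain rfl : l = 0 := by omega
    have e : ∀ {p s : ℤ → Bool} {x}, isLev p s 0 x ↔ p x = true := by
      intro p s x; simp [isLev, inLev]
    refine ⟨fun x y h1 h2 => hs.c_oo x y (e.1 h1) (e.1 h2),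
      fun x y h1 h2 => hs.c_eo x y h1 (e.1 h2), fun x y h1 h2 => hs.c_oe x y (e.1 h1) h2⟩
  | succ m ih => exact ih.step hs

theorem Skel.clx (hs : Skel px sx py sy c k k') (m : ℕ) : IsClass (2 ^ m) (inLev px sx m) :=
  (hs.inv m).clx m (by omega)

theorem Skel.cly (hs : Skel px sx py sy c k k') (m : ℕ) : IsClass (2 ^ m) (inLev py sy m) :=
  (hs.inv m).cly m (by omega)

/-- Elementary operations on a counter. -/
inductive CounterOp (R : Type) where
  | hold | inc | dec
  | copy (s : R)

/-- A counter machine acting on all its counters simultaneously. -/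
structure CMachine (Q R : Type) where
  init : Q
  op : Q → R → CounterOp R
  chk : Q → Bool
  next : Q → (R → Bool) → Q
  r₀ : R

/-- New value of a counter. -/
def CounterOp.val {R : Type} (c : R → ℕ) (r : R) : CounterOp R → ℕ
  | .hold => c r
  | .inc => c r + 1
  | .dec => c r - 1
  | .copy s => c s

/-- New value of a bit of the unary representation, from the old bits to the left, at the same
place, and to the right. -/
def CounterOp.bit {R : Type} (p u n : R → Bool) (r : R) : CounterOp R → Bool
  | .hold => u r
  | .inc => p r
  | .dec => n r
  | .copy s => u s

namespace CMachine

variable {Q R : Type} (M : CMachine Q R)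

/-- The run of the machine from zero counters. -/
def run : ℕ → Q × (R → ℕ)
  | 0 => (M.init, fun _ => 0)
  | j + 1 => (M.next (run j).1 (fun r => decide ((run j).2 r = 0)),
      fun r => (M.op (run j).1 r).val (run j).2 r)

/-- The unary digit `l` of counter `r` before step `j`. -/
def digit (j l : ℕ) (r : R) : Bool := decide (l < (M.run j).2 r)

theorem run_le (h : ∀ r, M.op M.init r = .hold) (j : ℕ) (r : R) : (M.run (j + 1)).2 r ≤ j := by
  induction j generalizing r with
  | zero => simp [run, h, CounterOp.val]
  | succ j ih =>
    rw [run]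
    show (M.op (M.run (j + 1)).1 r).val (M.run (j + 1)).2 r ≤ j + 1
    rcases M.op (M.run (j + 1)).1 r with _ | _ | _ | s
    · exact (ih r).trans (by omega)
    · exact Nat.succ_le_succ (ih r)
    · exact (Nat.sub_le _ _).trans ((ih r).trans (by omega))
    · exact (ih s).trans (by omega)

theorem run_le' (h : ∀ r, M.op M.init r = .hold) (j : ℕ) (r : R) : (M.run j).2 r ≤ j := by
  cases j with
  | zero => simp [run]
  | succ j => exact (M.run_le h j r).trans (by omega)

theorem digit_succ (j l : ℕ) (r : R) :
    M.digit (j + 1) l r = (M.op (M.run j).1 r).bit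
      (fun r => if l = 0 then true else M.digit j (l - 1) r) (M.digit j l)
      (M.digit j (l + 1)) r := by
  unfold digit
  rw [run]
  show decide (l < (M.op (M.run j).1 r).val (M.run j).2 r) = _
  rcases M.op (M.run j).1 r with _ | _ | _ | s <;> simp only [CounterOp.val, CounterOp.bit]
  · rfl
  · split_ifs with h
    · simp [h]
    · exact decide_eq_decide.2 (by omega)
  · exact decide_eq_decide.2 (by omega)
  · rfl

/-- The numbers on which the machine performs a check. -/
def Checked (n : ℕ) : Prop := ∃ j, M.chk (M.run j).1 = true ∧ (M.run j).2 M.r₀ = n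

end CMachine

/-- The fields of a hierarchical configuration. -/
structure HConf (Q R : Type) where
  px : ℤ → Bool
  sx : ℤ → Bool
  py : ℤ → Bool
  sy : ℤ → Bool
  Lx : ℤ → Q × (R → Bool) × Bool
  Ly : ℤ → Q × (R → Bool) × Bool
  c : ℤ → ℤ → Ordering
  k : ℤ → ℤ → ZMod 4
  k' : ℤ → ℤ → ZMod 4
  tau : ℤ → ℤ → Bool
  gam : ℤ → ℤ → Bool
  P : ℤ → ℤ → R → Bool
  rho : ℤ → ℤ → Bool
  N : ℤ → ℤ → R → Bool
  G : ℤ → ℤ → Bool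
  mu : ℤ → ℤ → Bool
  D : ℤ → ℤ → R → Bool

namespace HConf

variable {Q R : Type} (M : CMachine Q R) (t : HConf Q R)

/-- Cells at which the machine acts. -/
def act (x y : ℤ) : Bool := t.c x y == .lt && t.rho (x + 1) y && t.mu x y

/-- The deterministic signalling rules. -/
structure Signals : Prop where
  skel : Skel t.px t.sx t.py t.sy t.c t.k t.k'
  tau : ∀ x y, t.tau (x + 1) y = (t.c x y == .eq)
  gam : ∀ x y, t.gam (x + 1) y = if t.c x y = .eq then t.G x y else t.gam x y
  G : ∀ x y, t.G x (y + 1) = if t.c x y = .gt ∧ t.k x y = 1 ∧ t.sy y = false then t.gam x y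
    else if t.px x = true ∧ t.c x y = .lt then t.tau x y else t.G x y
  rho : ∀ x y, t.rho x y = if t.c x y = .eq then t.G x y
    else if t.c x y = .lt then t.rho (x + 1) y else false
  mu : ∀ x y, t.mu x (y + 1) = if t.c x y = .eq ∧ t.G x y = true then !t.sx x && !t.sy y
    else if t.c x y = .lt ∧ t.rho (x + 1) y = true ∧ t.k x y = 2 then false else t.mu x y
  N : ∀ x y, t.N x y = if t.act x y = true then t.D x y
    else if t.c x y = .lt then t.N (x + 1) y else fun _ => false
  P : ∀ x y, t.P (x + 1) y = if t.act x y = true then t.D x y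
    else if t.c x y = .gt then fun _ => true else t.P x y
  D : ∀ x y, t.D x (y + 1) = if t.act x y = true then
      fun r => (M.op (t.Ly y).1 r).bit (t.P x y) (t.D x y) (t.N (x + 1) y) r
    else if t.c x y = .eq ∧ t.G x y = true then
      fun r => (M.op (t.Ly y).1 r).bit (t.P x y) (fun _ => false) (fun _ => false) r
    else t.D x y

/-- The rules of the labels and the tests performed by the machine. -/
structure Checks : Prop where
  lab_eq : ∀ x y, t.c x y = .eq → t.Lx x = t.Ly y
  lab_zero : ∀ y, t.py y = true → (t.Ly y).1 = M.init ∧ ∀ r, (t.Ly y).2.1 r = true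
  lab_next : ∀ x y, t.c x y = .gt → t.k x y = 1 →
    (t.Lx x).1 = M.next (t.Ly y).1 (t.Ly y).2.1
  zero : ∀ x y, t.act x y = true → t.px x = true → ∀ r, (t.Ly y).2.1 r = !t.D x y r
  chk : ∀ x y, t.act x y = true → M.chk (t.Ly y).1 = true → t.P x y M.r₀ = true →
    t.D x y M.r₀ = false → (t.Lx x).2.2 = false

variable {M t}

/-- Columns and rows of level at least `m`. -/
abbrev X (t : HConf Q R) (m : ℕ) (x : ℤ) : Prop := inLev t.px t.sx m x
abbrev Y (t : HConf Q R) (m : ℕ) (y : ℤ) : Prop := inLev t.py t.sy m y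
abbrev isX (t : HConf Q R) (m : ℕ) (x : ℤ) : Prop := isLev t.px t.sx m x
abbrev isY (t : HConf Q R) (m : ℕ) (y : ℤ) : Prop := isLev t.py t.sy m y

namespace Signals

theorem sx_false {l : ℕ} {x : ℤ} (hx : t.X (l + 2) x) : t.sx (x + 2 ^ l) = false := hx.2

theorem sy_false {l : ℕ} {x : ℤ} (hx : t.Y (l + 2) x) : t.sy (x + 2 ^ l) = false := hx.2

theorem sx_true {l : ℕ} {x : ℤ} (hx : t.isX (l + 1) x) : t.sx (x + 2 ^ l) = true := by
  by_contra h'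
  exact hx.2 ⟨hx.1, by simpa using h'⟩

section skeleton

theorem c_eq (h : Skel t.px t.sx t.py t.sy t.c t.k t.k')
    {l : ℕ} {x y : ℤ} (hx : t.isX l x) (hy : t.isY l y) : t.c x y = .eq :=
  ((h.inv l).cmp l le_rfl).1 x y hx hy

theorem c_gt (h : Skel t.px t.sx t.py t.sy t.c t.k t.k')
    {l : ℕ} {x y : ℤ} (hx : t.X (l + 1) x) (hy : t.isY l y) : t.c x y = .gt :=
  ((h.inv l).cmp l le_rfl).2.1 x y hx hy

theorem c_lt (h : Skel t.px t.sx t.py t.sy t.c t.k t.k')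
    {l : ℕ} {x y : ℤ} (hx : t.isX l x) (hy : t.Y (l + 1) y) : t.c x y = .lt :=
  ((h.inv l).cmp l le_rfl).2.2 x y hx hy

theorem c_lt' (h : Skel t.px t.sx t.py t.sy t.c t.k t.k')
    {l : ℕ} {x y : ℤ} (hx : ¬ t.X l x) (hy : t.Y l y) : t.c x y = .lt := by
  obtain ⟨i, hi, h2⟩ := exists_isLev_lt hx
  exact c_lt h h2 (inLev_mono (by omega) hy)

theorem c_gt' (h : Skel t.px t.sx t.py t.sy t.c t.k t.k')
    {l : ℕ} {x y : ℤ} (hx : t.X l x) (hy : ¬ t.Y l y) : t.c x y = .gt := by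
  obtain ⟨i, hi, h2⟩ := exists_isLev_lt hy
  exact c_gt h (inLev_mono (by omega) hx) h2

theorem isY_of_eq (h : Skel t.px t.sx t.py t.sy t.c t.k t.k')
    {l : ℕ} {x y : ℤ} (hx : t.isX l x) (hc : t.c x y = .eq) : t.isY l y := by
  refine ⟨?_, fun h' => ?_⟩
  · by_contra h'
    rw [c_gt' h hx.1 h'] at hc; simp at hc
  · rw [c_lt h hx h'] at hc; simp at hc

theorem isX_add (h : Skel t.px t.sx t.py t.sy t.c t.k t.k')
    {l : ℕ} {x : ℤ} (hx : t.X (l + 1) x) : t.isX l (x + 2 ^ l) :=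
  isLev_add (h.clx l) (h.clx (l + 1)) hx

theorem isY_add (h : Skel t.px t.sx t.py t.sy t.c t.k t.k')
    {l : ℕ} {x : ℤ} (hx : t.Y (l + 1) x) : t.isY l (x + 2 ^ l) :=
  isLev_add (h.cly l) (h.cly (l + 1)) hx

theorem isY_sub (h : Skel t.px t.sx t.py t.sy t.c t.k t.k')
    {l : ℕ} {x : ℤ} (hx : t.Y (l + 1) x) : t.isY l (x - 2 ^ l) :=
  isLev_sub (h.cly l) (h.cly (l + 1)) hx

theorem not_X (h : Skel t.px t.sx t.py t.sy t.c t.k t.k')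
    {l : ℕ} {x z : ℤ} (hx : t.X l x) (h1 : x < z) (h2 : z < x + 2 ^ l) : ¬ t.X l z :=
  not_inLev_between (h.clx l) hx h1 h2

theorem not_Y (h : Skel t.px t.sx t.py t.sy t.c t.k t.k')
    {l : ℕ} {x z : ℤ} (hx : t.Y l x) (h1 : x < z) (h2 : z < x + 2 ^ l) : ¬ t.Y l z :=
  not_inLev_between (h.cly l) hx h1 h2

/-- Along a row of level `l`, a quantity that is constant across `lt` crossings. -/
theorem row_const (h : Skel t.px t.sx t.py t.sy t.c t.k t.k')
    {α : Type*} {f : ℤ → α} {l : ℕ} {x z y : ℤ} (hx : t.X l x) (hy : t.Y l y)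
    (hf : ∀ z, t.c z y = .lt → f (z + 1) = f z) (h1 : x < z) (h2 : z ≤ x + 2 ^ l) :
    f z = f (x + 1) := by
  have := const_run (f := f) (x := x + 1) (n := z - (x + 1)) (by omega) (fun w h3 h4 =>
    hf w (c_lt' h (not_X h hx (by omega) (by omega)) hy))
  simpa using this

theorem k_three (h : Skel t.px t.sx t.py t.sy t.c t.k t.k')
    {l : ℕ} {x y : ℤ} (hx : t.X (l + 2) x) (hy : t.isY l y) : t.k x y = 3 :=
  ((h.inv l).phase h hy hx.1).2.2.2.2.1 hx.2

theorem k_one (h : Skel t.px t.sx t.py t.sy t.c t.k t.k')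
    {l : ℕ} {x y : ℤ} (hx : t.isX (l + 1) x) (hy : t.isY l y) : t.k x y = 1 := by
  obtain ⟨-, -, -, ho, h2⟩ := (h.inv l).phase h hy hx.1
  rcases ho with h3 | h3
  · exact h3
  · exact absurd ⟨hx.1, h2.2 h3⟩ hx.2

theorem k_row (h : Skel t.px t.sx t.py t.sy t.c t.k t.k')
    {l : ℕ} {x z y : ℤ} (hx : t.X (l + 1) x) (hy : t.isY l y) (h1 : x < z)
    (h2 : z ≤ x + 2 ^ l) : t.k z y = t.k x y + 1 := by
  rw [row_const h (f := fun z => t.k z y) (inLev_succ hx) hy.1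
    (fun z hz => h.k_lt' z y hz) h1 h2, h.k_gt' _ _ (c_gt h hx hy)]

end skeleton

theorem G_eq (h : t.Signals M) {l : ℕ} {x y : ℤ} (hx : t.X (l + 1) x) (hy : t.Y (l + 1) y) :
    t.G (x + 2 ^ l) (y + 2 ^ l) = (t.c x y == .eq) := by
  have hs := h.skel
  induction l with
  | zero =>
    have hx1 := isX_add hs hx
    have hc : t.c (x + 1) y = .lt := c_lt hs hx1 hy
    have hp : t.px (x + 1) = true := by rw [hs.px_alt, show t.px x = false from hx]; rfl
    rw [pow_zero, h.G, if_neg (by simp [hc]), if_pos ⟨hp, hc⟩, h.tau]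
  | succ l ih =>
    have hx1 := isX_add hs hx
    have hx0 := isX_add hs (inLev_succ hx)
    have hy0 := isY_add hs (inLev_succ hy)
    have hpow : (2 : ℤ) ^ (l + 1) = 2 ^ l + 2 ^ l := by rw [pow_succ]; ring
    have hpos : (0 : ℤ) < 2 ^ l := by positivity
    have hgt := c_gt hs hx1.1 hy0
    have e1 : t.G (x + 2 ^ (l + 1)) (y + 2 ^ (l + 1)) =
        t.G (x + 2 ^ (l + 1)) (y + 2 ^ l + 1) := by
      have := const_run (f := fun z => t.G (x + 2 ^ (l + 1)) z) (x := y + 2 ^ l + 1)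
        (n := 2 ^ l - 1) (by omega) (fun w h3 h4 => by
          have hw : ¬ t.Y l w := not_Y hs hy0.1 (by omega) (by omega)
          obtain ⟨i, hi, hw⟩ := exists_isLev_lt hw
          have hg := c_gt hs (inLev_mono (by omega) hx1.1) hw
          have hk := k_three hs (inLev_mono (by omega) hx1.1) hw
          show t.G _ (w + 1) = _
          rw [h.G, if_neg (by rw [hk]; exact fun h3 => absurd h3.2.1 (by decide)), if_neg (by simp [hg])])
      rw [← this]; congr 1; rw [hpow]; ring
    rw [e1, h.G, if_pos ⟨hgt, k_one hs hx1 hy0, sy_false hy⟩,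
      row_const hs (f := fun z => t.gam z (y + 2 ^ l)) (z := x + 2 ^ (l + 1)) hx0.1 hy0.1
        (fun z hz => by show t.gam _ _ = _; rw [h.gam, if_neg (by simp [hz])]) (by omega) (by omega)]
    show t.gam (x + 2 ^ l + 1) (y + 2 ^ l) = _
    rw [h.gam, if_pos (c_eq hs hx0 hy0), ih (inLev_succ hx) (inLev_succ hy)]

/-- The signal `rho` left of a crossing of equal levels. -/
theorem rho_eq (h : t.Signals M) {l : ℕ} {x y z : ℤ} (hx : t.X (l + 1) x) (hy : t.Y (l + 1) y)
    (h1 : x < z) (h2 : z ≤ x + 2 ^ l) : t.rho z (y + 2 ^ l) = (t.c x y == .eq) := by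
  have hs := h.skel
  have hpos : (0 : ℤ) < 2 ^ l := by positivity
  have hf : ∀ z, t.c z (y + 2 ^ l) = .lt → t.rho (z + 1) (y + 2 ^ l) = t.rho z (y + 2 ^ l) :=
    fun z hz => by rw [h.rho z, if_neg (by simp [hz]), if_pos hz]
  have hy0 := isY_add hs hy
  rw [row_const hs (f := fun z => t.rho z (y + 2 ^ l)) (inLev_succ hx) hy0.1 hf h1 h2]
  have := row_const hs (f := fun z => t.rho z (y + 2 ^ l)) (z := x + 2 ^ l)
    (inLev_succ hx) hy0.1 hf (by omega) le_rfl
  rw [← this]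
  show t.rho _ _ = _
  rw [h.rho, if_pos (c_eq hs (isX_add hs hx) hy0), h.G_eq hx hy]

/-- Columns whose corner has level `m` are dormant when entering a row of larger level. -/
theorem mu_false (h : t.Signals M)
    {i m : ℕ} {x y : ℤ} (hi : i < m) (hx : t.isX m x) (hy : t.Y (m + 1) y) :
    t.mu (x + 2 ^ i) y = false := by
  have hs := h.skel
  obtain ⟨m, rfl⟩ : ∃ n, m = n + 1 := ⟨m - 1, by omega⟩
  have hxi : t.X (i + 1) x := inLev_mono (by omega) hx.1
  have hX := isX_add hs hxi
  have hpow : (2 : ℤ) ^ (m + 1) = 2 ^ m + 2 ^ m := by rw [pow_succ]; ring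
  have hpos : (0 : ℤ) < 2 ^ m := by positivity
  have hposi : (0 : ℤ) < 2 ^ i := by positivity
  have hy0 := isY_sub hs hy
  have hy1 := isY_add hs hy0.1
  rw [show y - 2 ^ (m + 1) + 2 ^ m = y - 2 ^ m by rw [hpow]; ring] at hy1
  have hc0 := c_eq hs hx hy0
  have start : t.mu (x + 2 ^ i) (y - 2 ^ m + 1) = false := by
    rcases Nat.lt_or_ge i m with him | him
    · have hlt := c_lt hs hX (inLev_mono (by omega) hy1.1)
      have him' : (2 : ℤ) ^ i < 2 ^ m := pow_lt_pow_right₀ (by norm_num) him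
      have hr := h.rho_eq (z := x + 2 ^ i + 1) hx.1 hy0.1 (by omega) (by omega)
      rw [show y - 2 ^ (m + 1) + 2 ^ m = y - 2 ^ m by rw [hpow]; ring, hc0] at hr
      have hk := k_row hs (z := x + 2 ^ i) hx.1 hy1 (by omega) (by omega)
      rw [k_one hs hx hy1] at hk
      rw [h.mu, if_neg (by simp [hlt]), if_pos ⟨hlt, by simpa using hr, hk⟩]
    · obtain rfl : i = m := by omega
      have hg := h.G_eq hx.1 hy0.1
      rw [show y - 2 ^ (i + 1) + 2 ^ i = y - 2 ^ i by rw [hpow]; ring, hc0] at hg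
      rw [h.mu, if_pos ⟨c_eq hs hX hy1, by simpa using hg⟩, sx_true hx]
      rfl
  have run : ∀ n : ℕ, (n : ℤ) ≤ 2 ^ m - 1 → t.mu (x + 2 ^ i) (y - 2 ^ m + 1 + n) = false := by
    intro n
    induction n with
    | zero => intro _; simpa using start
    | succ n ih =>
      intro hn
      push_cast at hn
      have ih := ih (by omega)
      set z := y - 2 ^ m + 1 + (n : ℤ) with hz
      rw [show y - 2 ^ m + 1 + ((n + 1 : ℕ) : ℤ) = z + 1 by push_cast; omega, h.mu]
      have hng : ¬ (t.c (x + 2 ^ i) z = .eq ∧ t.G (x + 2 ^ i) z = true) := by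
        rintro ⟨hc, hg⟩
        have hzi := isY_of_eq hs hX hc
        have hz' := inLev_of_isLev (hs.cly i) (hs.cly (i + 1)) hzi
        have hlow : y - 2 ^ m ≤ z - 2 ^ i := by
          by_contra hlt
          exact not_Y hs (inLev_succ hz') (z := y - 2 ^ m) (by omega) (by omega)
            (inLev_mono (by omega) hy1.1)
        have hnot : ¬ t.Y (m + 1) (z - 2 ^ i) := by
          rcases eq_or_lt_of_le hlow with h' | h'
          · rw [← h']; exact hy1.2
          · exact fun h3 => not_Y hs hy1.1 h' (by omega) (inLev_succ h3)
        have hgt := c_gt' hs hx.1 hnot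
        have := h.G_eq hxi hz'
        rw [sub_add_cancel, hg, hgt] at this
        simp at this
      rw [if_neg hng, ih]; simp
  have := run ((2 : ℤ) ^ m - 1).toNat (by omega)
  rw [show y - 2 ^ m + 1 + (((2 : ℤ) ^ m - 1).toNat : ℤ) = y by omega] at this
  exact this

/-- Active cells are the cells of the space-time diagrams attached to crossings of equal level. -/
theorem eq_of_act (h : t.Signals M) {i j : ℕ} {x y : ℤ} (hx : t.X (i + 1) x) (hy : t.Y (j + 1) y)
    (ha : t.act (x + 2 ^ i) (y + 2 ^ j) = true) : i < j ∧ t.c x y = .eq := by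
  have hs := h.skel
  simp only [act, Bool.and_eq_true, beq_iff_eq] at ha
  obtain ⟨⟨hc, hr⟩, hm⟩ := ha
  have hX := isX_add hs hx
  have hY := isY_add hs hy
  have hij : i < j := by
    by_contra hij
    rcases eq_or_lt_of_le (not_lt.1 hij) with rfl | h'
    · rw [c_eq hs hX hY] at hc; simp at hc
    · rw [c_gt hs (inLev_mono (by omega) hX.1) hY] at hc; simp at hc
  refine ⟨hij, ?_⟩
  have hpow : (2 : ℤ) ^ (j + 1) = 2 ^ j + 2 ^ j := by rw [pow_succ]; ring
  have hpos : (0 : ℤ) < 2 ^ j := by positivity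
  have hposi : (0 : ℤ) < 2 ^ i := by positivity
  -- the last column of level above `j`
  obtain ⟨b, hb⟩ := hs.clx (j + 1)
  obtain ⟨w, hw, hwx, hxw⟩ : ∃ w, t.X (j + 1) w ∧ w < x + 2 ^ i ∧ x + 2 ^ i ≤ w + 2 ^ (j + 1) := by
    refine ⟨x + 2 ^ i - 1 - (x + 2 ^ i - 1 - b) % 2 ^ (j + 1), (hb _).2 ?_, ?_, ?_⟩
    · have := Int.mul_ediv_add_emod (x + 2 ^ i - 1 - b) (2 ^ (j + 1))
      exact ⟨(x + 2 ^ i - 1 - b) / 2 ^ (j + 1), by omega⟩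
    · have := Int.emod_nonneg (x + 2 ^ i - 1 - b) (b := 2 ^ (j + 1)) (by positivity)
      omega
    · have := Int.emod_lt_of_pos (x + 2 ^ i - 1 - b) (b := 2 ^ (j + 1)) (by positivity)
      omega
  have hnX : ¬ t.X j (x + 2 ^ i) := fun h3 => hX.2 (inLev_mono (by omega) h3)
  have hww := isX_add hs hw
  have hne1 : x + 2 ^ i ≠ w + 2 ^ j := fun h3 => hnX (by rw [h3]; exact hww.1)
  have hlt : x + 2 ^ i < w + 2 ^ j := by
    by_contra hge
    -- then `rho` vanishes
    have h4 := ((hs.clx (j + 1)).add hw (2 ^ (j + 1))).2 dvd_rfl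
    have hne2 : x + 2 ^ i ≠ w + 2 ^ (j + 1) := fun h3 => hnX (by rw [h3]; exact inLev_succ h4)
    have hf : ∀ z, t.c z (y + 2 ^ j) = .lt → t.rho (z + 1) (y + 2 ^ j) = t.rho z (y + 2 ^ j) :=
      fun z hz => by rw [h.rho z, if_neg (by simp [hz]), if_pos hz]
    have e1 := row_const hs (f := fun z => t.rho z (y + 2 ^ j)) (z := x + 2 ^ i + 1)
      hww.1 hY.1 hf (by omega) (by omega)
    have e2 := row_const hs (f := fun z => t.rho z (y + 2 ^ j)) (z := w + 2 ^ (j + 1))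
      hww.1 hY.1 hf (by omega) (by omega)
    have e3 := h.rho (w + 2 ^ (j + 1)) (y + 2 ^ j)
    rw [c_gt hs h4 hY] at e3
    simp only [reduceCtorEq, if_false] at e3
    rw [e1, ← e2, e3] at hr
    simp at hr
  have hr2 := h.rho_eq (z := x + 2 ^ i + 1) hw hy (by omega) (by omega)
  rw [hr] at hr2
  have hc2 : t.c w y = .eq := by simpa using hr2.symm
  have hwx' : w ≤ x := by
    by_contra h5
    exact not_X hs (inLev_succ hx) (z := w) (by omega) (by omega) (inLev_mono (by omega) hw)
  rcases eq_or_lt_of_le hwx' with rfl | h6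
  · exact hc2
  · exfalso
    have h7 : ¬ t.X j x := not_X hs (inLev_succ hw) h6 (by omega)
    obtain ⟨m, hmj, hm2⟩ := exists_isLev_lt h7
    have him : i < m := by
      by_contra h8
      exact hm2.2 (inLev_mono (by omega) hx)
    rw [h.mu_false him hm2 (inLev_mono (by omega) hY.1)] at hm
    simp at hm

end Signals

end HConf

namespace HConf.Signals

variable {Q R : Type} {M : CMachine Q R} {t : HConf Q R}

theorem isX_of_eq (h : Skel t.px t.sx t.py t.sy t.c t.k t.k') {l : ℕ} {x y : ℤ}
    (hy : t.isY l y) (hc : t.c x y = .eq) : t.isX l x := by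
  refine ⟨?_, fun h' => ?_⟩
  · by_contra h'
    rw [c_lt' h h' hy.1] at hc; simp at hc
  · rw [c_gt h h' hy] at hc; simp at hc

theorem quiet (h : t.Signals M)
    {m l i : ℕ} {x z : ℤ} (hx : t.X m x) (hl : l < m) (hz : t.Y (i + 1) z)
    (hzm : ¬ t.Y m z) :
    t.mu (x + 2 ^ l) (z + 2 ^ i + 1) = t.mu (x + 2 ^ l) (z + 2 ^ i) ∧
      t.D (x + 2 ^ l) (z + 2 ^ i + 1) = t.D (x + 2 ^ l) (z + 2 ^ i) := by
  have hs := h.skel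
  have hi : i + 1 < m := by
    by_contra h'
    exact hzm (inLev_mono (by omega) hz)
  have hX := isX_add hs (inLev_mono (show l + 1 ≤ m by omega) hx)
  have hZ := isY_add hs hz
  have hgt := c_gt' hs hx hzm
  have hposl : (0 : ℤ) < 2 ^ l := by positivity
  rcases lt_trichotomy i l with hil | rfl | hil
  · have hc := c_gt hs (inLev_mono (show i + 1 ≤ l by omega) hX.1) hZ
    have ha : t.act (x + 2 ^ l) (z + 2 ^ i) = false := by simp [act, hc]
    rw [h.mu, h.D]
    simp [hc, ha]
  · have hc := c_eq hs hX hZ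
    have hg := h.G_eq (inLev_mono (show i + 1 ≤ m by omega) hx) hz
    rw [hgt] at hg
    have ha : t.act (x + 2 ^ i) (z + 2 ^ i) = false := by simp [act, hc]
    rw [h.mu, h.D]
    simp [hc, ha, hg]
  · have hc := c_lt hs hX (inLev_mono (show l + 1 ≤ i by omega) hZ.1)
    have him' : (2 : ℤ) ^ l < 2 ^ i := pow_lt_pow_right₀ (by norm_num) hil
    have hr := h.rho_eq (z := x + 2 ^ l + 1) (inLev_mono (show i + 1 ≤ m by omega) hx) hz
      (by omega) (by omega)
    rw [hgt] at hr
    have ha : t.act (x + 2 ^ l) (z + 2 ^ i) = false := by simp [act, hr]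
    rw [h.mu, h.D]
    simp [hc, ha, hr]

theorem quiet_run (h : t.Signals M) {m l j : ℕ} {x y : ℤ} (hx : t.X m x) (hy : t.Y m y) (hl : l < m)
    (hj : j + 1 < m) :
    t.mu (x + 2 ^ l) (y + 2 ^ (j + 1)) = t.mu (x + 2 ^ l) (y + 2 ^ j + 1) ∧
      t.D (x + 2 ^ l) (y + 2 ^ (j + 1)) = t.D (x + 2 ^ l) (y + 2 ^ j + 1) := by
  have hs := h.skel
  have hpow : (2 : ℤ) ^ (j + 1) = 2 ^ j + 2 ^ j := by rw [pow_succ]; ring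
  have hpos : (0 : ℤ) < 2 ^ j := by positivity
  have hle : (2 : ℤ) ^ (j + 1) ≤ 2 ^ m := pow_le_pow_right₀ (by norm_num) hj.le
  have hY := isY_add hs (inLev_mono (show j + 1 ≤ m by omega) hy)
  have := const_run (f := fun z => (t.mu (x + 2 ^ l) z, t.D (x + 2 ^ l) z)) (x := y + 2 ^ j + 1)
    (n := 2 ^ j - 1) (by omega) (fun z h1 h2 => by
      obtain ⟨i, hi, hz⟩ := exists_isLev_lt (not_Y hs hY.1 (z := z) (by omega) (by omega))
      have hz' := inLev_of_isLev (hs.cly i) (hs.cly (i + 1)) hz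
      have hposi : (0 : ℤ) < 2 ^ i := by positivity
      have hlow : y + 2 ^ j ≤ z - 2 ^ i := by
        by_contra h3
        exact not_Y hs (inLev_succ hz') (z := y + 2 ^ j) (by omega) (by omega)
          (inLev_mono (by omega) hY.1)
      have := h.quiet hx hl hz' (not_Y hs hy (by omega) (by omega))
      rw [sub_add_cancel] at this
      simp only [Prod.mk.injEq]
      exact this)
  rw [show y + 2 ^ j + 1 + (2 ^ j - 1) = y + 2 ^ (j + 1) by rw [hpow]; ring] at this
  simpa using this

theorem not_act (h : t.Signals M)
    {m l j : ℕ} {x y z : ℤ} (hx : t.X m x) (hy : t.isY m y) (hj : j < m)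
    (hl : l + 1 < m) (h1 : x + 2 ^ l < z) (h2 : z < x + 2 ^ (l + 1)) :
    t.act z (y + 2 ^ j) = false := by
  have hs := h.skel
  have hpow : (2 : ℤ) ^ (l + 1) = 2 ^ l + 2 ^ l := by rw [pow_succ]; ring
  have hpos : (0 : ℤ) < 2 ^ l := by positivity
  have hle : (2 : ℤ) ^ (l + 1) ≤ 2 ^ m := pow_le_pow_right₀ (by norm_num) hl.le
  have hX := isX_add hs (inLev_mono (show l + 1 ≤ m by omega) hx)
  obtain ⟨i, hi, hz⟩ := exists_isLev_lt (not_X hs hX.1 (z := z) (by omega) (by omega))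
  have hz' := inLev_of_isLev (hs.clx i) (hs.clx (i + 1)) hz
  have hposi : (0 : ℤ) < 2 ^ i := by positivity
  have hlow : x + 2 ^ l ≤ z - 2 ^ i := by
    by_contra h3
    exact not_X hs (inLev_succ hz') (z := x + 2 ^ l) (by omega) (by omega)
      (inLev_mono (by omega) hX.1)
  by_contra ha
  rw [Bool.not_eq_false] at ha
  have := h.eq_of_act hz' (inLev_mono (show j + 1 ≤ m by omega) hy.1)
    (by rwa [sub_add_cancel])
  exact not_X hs hx (by omega) (by omega) (isX_of_eq hs hy this.2).1

theorem row_values (h : t.Signals M)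
    (hM : ∀ r, M.op M.init r = .hold) {m j : ℕ} {x y : ℤ} (hx : t.isX m x)
    (hy : t.isY m y) (hj : j < m)
    (hD : ∀ l < j, t.D (x + 2 ^ l) (y + 2 ^ j) = M.digit j l ∧
      t.mu (x + 2 ^ l) (y + 2 ^ j) = true) :
    (∀ l < j, t.act (x + 2 ^ l) (y + 2 ^ j) = true) ∧
    (∀ l ≤ j, t.P (x + 2 ^ l) (y + 2 ^ j) =
      fun r => if l = 0 then true else M.digit j (l - 1) r) ∧
    (∀ l < j, t.N (x + 2 ^ l + 1) (y + 2 ^ j) = M.digit j (l + 1)) := by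
  have hs := h.skel
  have hX : ∀ l ≤ j, t.isX l (x + 2 ^ l) := fun l hl =>
    isX_add hs (inLev_mono (show l + 1 ≤ m by omega) hx.1)
  have hY := isY_add hs (inLev_mono (show j + 1 ≤ m by omega) hy.1)
  have hlt : ∀ l < j, t.c (x + 2 ^ l) (y + 2 ^ j) = .lt := fun l hl =>
    c_lt hs (hX l hl.le) (inLev_mono (by omega) hY.1)
  have hact : ∀ l < j, t.act (x + 2 ^ l) (y + 2 ^ j) = true := by
    intro l hl
    have hp : (2 : ℤ) ^ l < 2 ^ j := pow_lt_pow_right₀ (by norm_num) hl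
    have hpos : (0 : ℤ) < 2 ^ l := by positivity
    have := h.rho_eq (z := x + 2 ^ l + 1) (inLev_mono (show j + 1 ≤ m by omega) hx.1)
      (inLev_mono (show j + 1 ≤ m by omega) hy.1) (by omega) (by omega)
    simp [act, hlt l hl, this, c_eq hs hx hy, (hD l hl).2]
  have run : ∀ l < j, t.P (x + 2 ^ (l + 1)) (y + 2 ^ j) = t.P (x + 2 ^ l + 1) (y + 2 ^ j) ∧
      t.N (x + 2 ^ (l + 1)) (y + 2 ^ j) = t.N (x + 2 ^ l + 1) (y + 2 ^ j) := by
    intro l hl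
    have hpow : (2 : ℤ) ^ (l + 1) = 2 ^ l + 2 ^ l := by rw [pow_succ]; ring
    have hpos : (0 : ℤ) < 2 ^ l := by positivity
    have := const_run (f := fun z => (t.P z (y + 2 ^ j), t.N z (y + 2 ^ j)))
      (x := x + 2 ^ l + 1) (n := 2 ^ l - 1) (by omega) (fun z h1 h2 => by
        have hz : t.c z (y + 2 ^ j) = .lt :=
          c_lt' hs (not_X hs (hX l hl.le).1 (by omega) (by omega))
            (inLev_mono (by omega) hY.1)
        have ha := h.not_act hx.1 hy hj (l := l) (z := z) (by omega) (by omega) (by omega)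
        simp only [Prod.mk.injEq]
        refine ⟨?_, ?_⟩
        · rw [h.P]; simp [ha, hz]
        · rw [h.N z]; simp [ha, hz])
    rw [show x + 2 ^ l + 1 + (2 ^ l - 1) = x + 2 ^ (l + 1) by rw [hpow]; ring] at this
    simpa using this
  refine ⟨hact, ?_, ?_⟩
  · intro l hl
    cases l with
    | zero =>
      have hc : t.c x (y + 2 ^ j) = .gt := c_gt hs (inLev_mono (by omega) hx.1) hY
      rw [pow_zero, h.P]
      simp [act, hc]
    | succ l =>
      rw [(run l (by omega)).1, h.P, if_pos (hact l (by omega)), (hD l (by omega)).1]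
      simp
  · intro l hl
    rw [← (run l hl).2, h.N]
    rcases Nat.lt_or_ge (l + 1) j with h1 | h1
    · rw [if_pos (hact _ h1), (hD _ h1).1]
    · obtain rfl : j = l + 1 := by omega
      have hc := c_eq hs (hX _ le_rfl) hY
      rw [if_neg (by simp [act, hc]), if_neg (by simp [hc])]
      funext r
      have := M.run_le' hM (l + 1) r
      simp [CMachine.digit, this]

theorem data (h : t.Signals M) (hM : ∀ r, M.op M.init r = .hold) {m : ℕ} {x y : ℤ} (hx : t.isX m x)
    (hy : t.isY m y) (j : ℕ) (hj : j < m)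
    (hlab : ∀ i ≤ j, (t.Ly (y + 2 ^ i)).1 = (M.run i).1) :
    (∀ l < j, t.D (x + 2 ^ l) (y + 2 ^ j) = M.digit j l ∧ t.mu (x + 2 ^ l) (y + 2 ^ j) = true) ∧
    (∀ l ≤ j, t.D (x + 2 ^ l) (y + 2 ^ j + 1) = M.digit (j + 1) l ∧
      (j + 1 < m → t.mu (x + 2 ^ l) (y + 2 ^ j + 1) = true)) := by
  have hs := h.skel
  have step : ∀ j < m, (t.Ly (y + 2 ^ j)).1 = (M.run j).1 →
      (∀ l < j, t.D (x + 2 ^ l) (y + 2 ^ j) = M.digit j l ∧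
        t.mu (x + 2 ^ l) (y + 2 ^ j) = true) →
      (∀ l ≤ j, t.D (x + 2 ^ l) (y + 2 ^ j + 1) = M.digit (j + 1) l ∧
        (j + 1 < m → t.mu (x + 2 ^ l) (y + 2 ^ j + 1) = true)) := by
    intro j hj hq hD l hl
    obtain ⟨hact, hP, hN⟩ := h.row_values hM hx hy hj hD
    have hX := isX_add hs (inLev_mono (show l + 1 ≤ m by omega) hx.1)
    have hY := isY_add hs (inLev_mono (show j + 1 ≤ m by omega) hy.1)
    have hp : (2 : ℤ) ^ l ≤ 2 ^ j := pow_le_pow_right₀ (by norm_num) hl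
    have hpos : (0 : ℤ) < 2 ^ l := by positivity
    rcases eq_or_lt_of_le hl with rfl | hl'
    · have hc := c_eq hs hX hY
      have hg := h.G_eq (inLev_mono (show l + 1 ≤ m by omega) hx.1)
        (inLev_mono (show l + 1 ≤ m by omega) hy.1)
      rw [c_eq hs hx hy] at hg
      refine ⟨?_, fun h1 => ?_⟩
      · rw [h.D, if_neg (by simp [act, hc]), if_pos ⟨hc, by simpa using hg⟩]
        funext r
        rw [M.digit_succ, hq, hP l le_rfl]
        have e : ∀ l', l ≤ l' → M.digit l l' = fun _ => false := by
          intro l' hl'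
          funext r
          have := M.run_le' hM l r
          simp only [CMachine.digit, decide_eq_false_iff_not]; omega
        rw [e l le_rfl, e (l + 1) (by omega)]
      · rw [h.mu, if_pos ⟨hc, by simpa using hg⟩,
          sx_false (inLev_mono (show l + 2 ≤ m by omega) hx.1),
          sy_false (inLev_mono (show l + 2 ≤ m by omega) hy.1)]
        rfl
    · have hc := c_lt hs hX (inLev_mono (show l + 1 ≤ j by omega) hY.1)
      refine ⟨?_, fun h1 => ?_⟩
      · rw [h.D, if_pos (hact l hl'), hP l hl, hN l hl', (hD l hl').1, hq]
        funext r
        rw [M.digit_succ]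
      · have hk := k_row hs (z := x + 2 ^ l) (inLev_mono (show j + 1 ≤ m by omega) hx.1) hY
          (by omega) (by omega)
        rw [k_three hs (inLev_mono (show j + 2 ≤ m by omega) hx.1) hY] at hk
        rw [h.mu, if_neg (by simp [hc]), if_neg, (hD l hl').2]
        rw [hk]
        exact fun h3 => absurd h3.2.2 (by decide)
  induction j with
  | zero => exact ⟨by simp, step 0 hj (hlab 0 le_rfl) (by simp)⟩
  | succ j ih =>
    have ih := (ih (by omega) (fun i hi => hlab i (by omega))).2
    have hD : ∀ l < j + 1, t.D (x + 2 ^ l) (y + 2 ^ (j + 1)) = M.digit (j + 1) l ∧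
        t.mu (x + 2 ^ l) (y + 2 ^ (j + 1)) = true := by
      intro l hl
      obtain ⟨h1, h2⟩ := h.quiet_run hx.1 hy.1 (l := l) (by omega) hj
      obtain ⟨h3, h4⟩ := ih l (by omega)
      exact ⟨h2.trans h3, h1.trans (h4 hj)⟩
    exact ⟨hD, step _ hj (hlab _ le_rfl) hD⟩

theorem exists_isX (h : Skel t.px t.sx t.py t.sy t.c t.k t.k') (m : ℕ) : ∃ x, t.isX m x := by
  obtain ⟨b, hb⟩ := (h.clx (m + 1)).exists
  exact ⟨_, isX_add h hb⟩

theorem exists_isY (h : Skel t.px t.sx t.py t.sy t.c t.k t.k') (m : ℕ) : ∃ x, t.isY m x := by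
  obtain ⟨b, hb⟩ := (h.cly (m + 1)).exists
  exact ⟨_, isY_add h hb⟩

/-- The labels of rows of level `j` describe the state of the machine at time `j`. -/
theorem label (h : t.Signals M) (hM : ∀ r, M.op M.init r = .hold) (hc : t.Checks M) (j : ℕ) (y : ℤ)
    (hy : t.isY j y) : (t.Ly y).1 = (M.run j).1 ∧
      ∀ r, (t.Ly y).2.1 r = decide ((M.run j).2 r = 0) := by
  have hs := h.skel
  induction j using Nat.strong_induction_on generalizing y with
  | _ j ih =>
  have all : ∀ y', t.isY j y' → t.Ly y' = t.Ly y := by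
    intro y' hy'
    obtain ⟨x, hx⟩ := exists_isX hs j
    rw [← hc.lab_eq x y (c_eq hs hx hy), ← hc.lab_eq x y' (c_eq hs hx hy')]
  cases j with
  | zero =>
    obtain ⟨h1, h2⟩ := hc.lab_zero y (by have := hy.2; simpa [inLev] using this)
    exact ⟨h1, fun r => by simp [h2, CMachine.run]⟩
  | succ j =>
    have hq : (t.Ly y).1 = (M.run (j + 1)).1 := by
      obtain ⟨x, hx⟩ := exists_isX hs (j + 1)
      obtain ⟨y', hy'⟩ := exists_isY hs j
      have h1 := hc.lab_next x y' (c_gt hs hx.1 hy') (k_one hs hx hy')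
      rw [hc.lab_eq x y (c_eq hs hx hy)] at h1
      obtain ⟨h2, h3⟩ := ih j (by omega) y' hy'
      rw [h1, h2, funext h3, CMachine.run]
    refine ⟨hq, ?_⟩
    obtain ⟨x₀, hx₀⟩ := exists_isX hs (j + 2)
    obtain ⟨y₀, hy₀⟩ := exists_isY hs (j + 2)
    have hY : ∀ i ≤ j + 1, t.isY i (y₀ + 2 ^ i) := fun i hi =>
      isY_add hs (inLev_mono (by omega) hy₀.1)
    have hd := (h.data hM hx₀ hy₀ (j + 1) (by omega) (fun i hi => by
      rcases Nat.lt_or_ge i (j + 1) with h1 | h1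
      · exact (ih i h1 _ (hY i hi)).1
      · obtain rfl : i = j + 1 := by omega
        rw [all _ (hY _ le_rfl), hq])).1
    obtain ⟨hact, -, -⟩ := h.row_values hM hx₀ hy₀ (by omega) hd
    intro r
    have hp : t.px (x₀ + 2 ^ 0) = true := by
      have := (isX_add hs (l := 0) (inLev_mono (by omega) hx₀.1)).2
      simpa [inLev] using this
    rw [← all _ (hY _ le_rfl), hc.zero _ _ (hact 0 (by omega)) hp r, (hd 0 (by omega)).1]
    simp [CMachine.digit, Nat.pos_iff_ne_zero]

/-- Checked numbers are levels carrying the flag `false`. -/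
theorem flag (h : t.Signals M) (hM : ∀ r, M.op M.init r = .hold) (hchk : M.chk M.init = false)
    (hc : t.Checks M) {n : ℕ} (hn : M.Checked n) {x : ℤ} (hx : t.isX n x) :
    (t.Lx x).2.2 = false := by
  have hs := h.skel
  obtain ⟨j, hj, rfl⟩ := hn
  obtain ⟨j, rfl⟩ : ∃ i, j = i + 1 := by
    cases j with
    | zero => rw [CMachine.run] at hj; simp [hchk] at hj
    | succ i => exact ⟨i, rfl⟩
  set n := (M.run (j + 1)).2 M.r₀ with hn
  have hnj : n ≤ j := M.run_le hM j _
  obtain ⟨x₀, hx₀⟩ := exists_isX hs (j + 2)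
  obtain ⟨y₀, hy₀⟩ := exists_isY hs (j + 2)
  have hY : ∀ i ≤ j + 1, t.isY i (y₀ + 2 ^ i) := fun i hi =>
    isY_add hs (inLev_mono (by omega) hy₀.1)
  have hd := (h.data hM hx₀ hy₀ (j + 1) (by omega) (fun i hi =>
    (h.label hM hc i _ (hY i hi)).1)).1
  obtain ⟨hact, hP, -⟩ := h.row_values hM hx₀ hy₀ (by omega) hd
  have hX := isX_add hs (inLev_mono (show n + 1 ≤ j + 2 by omega) hx₀.1)
  have := hc.chk _ _ (hact n (by omega)) (by rw [(h.label hM hc _ _ (hY _ le_rfl)).1, hj])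
    (by
      rw [hP n (by omega)]
      simp only [CMachine.digit, ← hn]
      split_ifs <;> simp; omega)
    (by rw [(hd n (by omega)).1]; simp [CMachine.digit, ← hn])
  obtain ⟨y, hy⟩ := exists_isY hs n
  rw [← this, hc.lab_eq _ y (c_eq hs hx hy), hc.lab_eq _ y (c_eq hs hX hy)]

end HConf.Signals

open Filter in
/-- Finite alphabets: a sequence of configurations has a limit agreeing infinitely often with
the sequence on every finite set. -/
theorem exists_limit_config {I T : Type*} [Finite T] (F : ℕ → I → T) :
    ∃ g : I → T, ∀ (S : Finset I) (N : ℕ), ∃ n ≥ N, ∀ i ∈ S, F n i = g i := by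
  have h1 : ∀ i, ∃ t, ∀ᶠ n in (hyperfilter ℕ : Filter ℕ), F n i = t := by
    intro i
    have : ∀ᶠ n in (hyperfilter ℕ : Filter ℕ), ∃ t, F n i = t := by simp
    exact Ultrafilter.eventually_exists_iff.1 this
  choose g hg using h1
  refine ⟨g, fun S N => ?_⟩
  have h2 : ∀ᶠ n in (hyperfilter ℕ : Filter ℕ), ∀ i ∈ S, F n i = g i :=
    (Finset.eventually_all S).2 fun i _ => hg i
  have h3 : ∀ᶠ n in (hyperfilter ℕ : Filter ℕ), N ≤ n :=
    (Nat.hyperfilter_le_atTop) (eventually_ge_atTop N)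
  obtain ⟨n, hn, hS⟩ := (h3.and h2).exists
  exact ⟨n, hn, hS⟩

/-- The orbit of a time-dependent map started at time `-n`. -/
def orbitFrom {B : Type*} (f : ℤ → B → B) (b : B) (n : ℕ) (x : ℤ) : B :=
  Nat.rec b (fun i c => f (i - n) c) (x + n).toNat

theorem orbitFrom_succ {B : Type*} (f : ℤ → B → B) (b : B) (n : ℕ) (x : ℤ) (hx : -(n : ℤ) ≤ x) :
    orbitFrom f b n (x + 1) = f x (orbitFrom f b n x) := by
  unfold orbitFrom
  obtain ⟨i, hi⟩ := Int.eq_ofNat_of_zero_le (show 0 ≤ x + n by omega)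
  rw [show (x + 1 + n).toNat = i + 1 by omega, show (x + n).toNat = i by omega]
  show f (i - n) _ = _
  rw [show (i : ℤ) - n = x by omega]

theorem exists_orbit {B : Type*} [Finite B] [Nonempty B] (f : ℤ → B → B) :
    ∃ b : ℤ → B, ∀ x, b (x + 1) = f x (b x) := by
  obtain ⟨b₀⟩ := ‹Nonempty B›
  obtain ⟨g, hg⟩ := exists_limit_config (fun n x => orbitFrom f b₀ n x)
  refine ⟨g, fun x => ?_⟩
  obtain ⟨n, hn, h⟩ := hg {x, x + 1} (-x).toNat
  rw [← h x (by simp), ← h (x + 1) (by simp)]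
  exact orbitFrom_succ f b₀ n x (by omega)

theorem exists_orbit_left {B : Type*} [Finite B] [Nonempty B] (f : ℤ → B → B) :
    ∃ b : ℤ → B, ∀ x, b x = f x (b (x + 1)) := by
  obtain ⟨b, hb⟩ := exists_orbit (fun x => f (-x - 1))
  refine ⟨fun x => b (-x), fun x => ?_⟩
  have := hb (-(x + 1))
  rw [show -(x + 1) + 1 = -x by ring, show -(-(x + 1)) - 1 = x by ring] at this
  exact this

/-- A two-dimensional system of signals travelling left, right and up, whose rules are
functional, has a solution. -/
theorem exists_signals {R L U : Type*} [Finite R] [Finite L] [Finite U] [Nonempty R] [Nonempty L]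
    [Nonempty U] (fR : ℤ → ℤ → R → L → U → R) (fL : ℤ → ℤ → L → U → L)
    (fU : ℤ → ℤ → R → L → U → U) :
    ∃ (r : ℤ → ℤ → R) (l : ℤ → ℤ → L) (u : ℤ → ℤ → U),
      (∀ x y, r (x + 1) y = fR x y (r x y) (l (x + 1) y) (u x y)) ∧
      (∀ x y, l x y = fL x y (l (x + 1) y) (u x y)) ∧
      (∀ x y, u x (y + 1) = fU x y (r x y) (l (x + 1) y) (u x y)) := by
  have h1 : ∀ (y : ℤ) (u : ℤ → U), ∃ l : ℤ → L, ∀ x, l x = fL x y (l (x + 1)) (u x) :=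
    fun y u => exists_orbit_left (fun x b => fL x y b (u x))
  choose l hl using h1
  have h2 : ∀ (y : ℤ) (u : ℤ → U), ∃ r : ℤ → R,
      ∀ x, r (x + 1) = fR x y (r x) (l y u (x + 1)) (u x) :=
    fun y u => exists_orbit (fun x b => fR x y b (l y u (x + 1)) (u x))
  choose r hr using h2
  obtain ⟨u₀⟩ := ‹Nonempty U›
  let u : ℕ → ℤ → ℤ → U := fun n =>
    orbitFrom (fun y u x => fU x y (r y u x) (l y u (x + 1)) (u x)) (fun _ => u₀) n
  obtain ⟨g, hg⟩ := exists_limit_config (fun n (p : ℤ × ℤ) =>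
    (r p.2 (u n p.2) p.1, l p.2 (u n p.2) p.1, u n p.2 p.1))
  refine ⟨fun x y => (g (x, y)).1, fun x y => (g (x, y)).2.1, fun x y => (g (x, y)).2.2,
    fun x y => ?_, fun x y => ?_, fun x y => ?_⟩
  · obtain ⟨n, hn, h⟩ := hg {(x, y), (x + 1, y)} (-y).toNat
    show (g (x + 1, y)).1 = fR x y (g (x, y)).1 (g (x + 1, y)).2.1 (g (x, y)).2.2
    rw [← h (x, y) (by simp), ← h (x + 1, y) (by simp)]
    exact hr y (u n y) x
  · obtain ⟨n, hn, h⟩ := hg {(x, y), (x + 1, y)} (-y).toNat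
    show (g (x, y)).2.1 = fL x y (g (x + 1, y)).2.1 (g (x, y)).2.2
    rw [← h (x, y) (by simp), ← h (x + 1, y) (by simp)]
    exact hl y (u n y) x
  · obtain ⟨n, hn, h⟩ := hg {(x, y), (x + 1, y), (x, y + 1)} (-y).toNat
    show (g (x, y + 1)).2.2 = fU x y (g (x, y)).1 (g (x + 1, y)).2.1 (g (x, y)).2.2
    rw [← h (x, y) (by simp), ← h (x + 1, y) (by simp), ← h (x, y + 1) (by simp)]
    exact congrFun (orbitFrom_succ (fun y u x => fU x y (r y u x) (l y u (x + 1)) (u x)) (fun _ => u₀)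
      n y (by omega)) x

namespace HConf

/-- The level function of the ideal hierarchy, which is centred at the dyadic integer `-1/3`. -/
noncomputable def lev (x : ℤ) : ℕ := padicValInt 2 (3 * x + 1)

theorem pow_dvd_iff (m : ℕ) (x : ℤ) : (2 : ℤ) ^ m ∣ 3 * x + 1 ↔ m ≤ lev x := by
  have := padicValInt_dvd_iff (p := 2) m (3 * x + 1)
  rw [lev]
  push_cast at this
  rw [this]
  constructor
  · rintro (h | h)
    · omega
    · exact h
  · exact Or.inr

/-- Dyadic approximation of `-1/3`. -/
def cen : ℕ → ℤ
  | 0 => 1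
  | j + 1 => 4 * cen j + 1

theorem three_cen (j : ℕ) : 3 * cen j + 1 = 2 ^ (j + 2) * 2 ^ j := by
  induction j with
  | zero => norm_num [cen]
  | succ j ih =>
    rw [cen, show 3 * (4 * cen j + 1) + 1 = 4 * (3 * cen j + 1) by ring, ih]; ring

theorem pow_dvd_iff' {m j : ℕ} (hm : m ≤ j + 2) (x : ℤ) :
    (2 : ℤ) ^ m ∣ x - cen j ↔ m ≤ lev x := by
  rw [← pow_dvd_iff]
  have h1 : 3 * x + 1 = 3 * (x - cen j) + 2 ^ (j + 2) * 2 ^ j := by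
    rw [← three_cen]; ring
  have h2 : (2 : ℤ) ^ m ∣ 2 ^ (j + 2) * 2 ^ j := (pow_dvd_pow 2 hm).mul_right _
  rw [h1, dvd_add_left h2]
  have : IsCoprime ((2 : ℤ) ^ m) 3 := IsCoprime.pow_left (by norm_num)
  exact ⟨fun h => h.mul_left _, fun h => this.dvd_of_dvd_mul_left h⟩

/-- Side of a column with respect to the next level. -/
noncomputable def side (x : ℤ) : Bool := decide ((3 * x + 1) / 2 ^ lev x % 4 = 1)

/-- Phase of the stretch on the left of position `x` in a row of level `j`. -/
def phase (x : ℤ) (j : ℕ) : ZMod 4 := (((x - 1 - cen j) / 2 ^ j : ℤ) : ZMod 4)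

theorem phase_of_mul {x u : ℤ} {j : ℕ} (h : x - cen j = 2 ^ j * u) :
    phase x j = u - 1 ∧ phase (x + 1) j = u := by
  have hpos : (0 : ℤ) < 2 ^ j := by positivity
  constructor
  · rw [phase, show x - 1 - cen j = 2 ^ j * (u - 1) + (2 ^ j - 1) by linarith,
      Int.mul_add_ediv_left _ _ hpos.ne', Int.ediv_eq_zero_of_lt (by omega) (by omega)]
    push_cast; ring
  · rw [phase, show x + 1 - 1 - cen j = 2 ^ j * u by linarith, Int.mul_ediv_cancel_left _ hpos.ne']

theorem phase_succ {x : ℤ} {j : ℕ} (h : ¬ (2 : ℤ) ^ j ∣ x - cen j) :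
    phase (x + 1) j = phase x j := by
  have hpos : (0 : ℤ) < 2 ^ j := by positivity
  obtain ⟨q, r, h1, h2, h3⟩ : ∃ q r : ℤ, x - cen j = 2 ^ j * q + r ∧ 0 < r ∧ r < 2 ^ j := by
    refine ⟨(x - cen j) / 2 ^ j, (x - cen j) % 2 ^ j, (Int.mul_ediv_add_emod _ _).symm, ?_,
      Int.emod_lt_of_pos _ hpos⟩
    exact lt_of_le_of_ne (Int.emod_nonneg _ hpos.ne')
      (fun h' => h (Int.dvd_of_emod_eq_zero h'.symm))
  rw [phase, phase, show x + 1 - 1 - cen j = 2 ^ j * q + r by linarith,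
    show x - 1 - cen j = 2 ^ j * q + (r - 1) by linarith,
    Int.mul_add_ediv_left _ _ hpos.ne', Int.mul_add_ediv_left _ _ hpos.ne',
    Int.ediv_eq_zero_of_lt (by omega) (by omega), Int.ediv_eq_zero_of_lt (by omega) (by omega)]

theorem exists_unit {x : ℤ} {j : ℕ} (hj : lev x ≤ j) :
    ∃ u : ℤ, x - cen j = 2 ^ lev x * u ∧ u % 2 = 1 ∧ (side x = true ↔ u % 4 = 3) := by
  have hpos : (0 : ℤ) < 2 ^ lev x := by positivity
  obtain ⟨u, hu⟩ := (pow_dvd_iff' (m := lev x) (j := j) (by omega) x).2 le_rfl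
  have h1 : u % 2 = 1 := by
    by_contra h2
    have : (2 : ℤ) ^ (lev x + 1) ∣ x - cen j := by
      rw [hu, pow_succ]
      exact mul_dvd_mul_left _ (Int.dvd_of_emod_eq_zero (by omega))
    have := (pow_dvd_iff' (by omega) x).1 this
    omega
  refine ⟨u, hu, h1, ?_⟩
  obtain ⟨i, rfl⟩ := Nat.exists_eq_add_of_le hj
  have h2 : (3 * x + 1) / 2 ^ lev x = 3 * u + 4 * (2 ^ i * 2 ^ (lev x + i)) := by
    have : 3 * x + 1 = 2 ^ lev x * (3 * u + 4 * (2 ^ i * 2 ^ (lev x + i))) := by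
      have := three_cen (lev x + i)
      have h3 : 3 * x + 1 = 3 * (x - cen (lev x + i)) + (3 * cen (lev x + i) + 1) := by ring
      rw [h3, this, hu]; ring
    rw [this, Int.mul_ediv_cancel_left _ hpos.ne']
  rw [side, h2]
  simp only [decide_eq_true_eq]
  omega

theorem exists_even {x : ℤ} {j : ℕ} (hj : j < lev x) :
    ∃ u : ℤ, x - cen j = 2 ^ j * u ∧ u % 2 = 0 ∧ (u % 4 = 2 ↔ lev x = j + 1) := by
  obtain ⟨v, hv⟩ := (pow_dvd_iff' (m := j + 1) (j := j) (by omega) x).2 hj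
  refine ⟨2 * v, by rw [hv, pow_succ]; ring, by omega, ?_⟩
  have h1 : j + 2 ≤ lev x ↔ v % 2 = 0 := by
    rw [← pow_dvd_iff' (m := j + 2) (j := j) (by omega) x, hv, pow_succ 2 (j + 1),
      mul_dvd_mul_iff_left (by positivity), Int.dvd_iff_emod_eq_zero]
  omega

theorem cast_zmod {u v : ℤ} (h : u % 4 = v % 4) : ((u : ℤ) : ZMod 4) = v :=
  (ZMod.intCast_eq_intCast_iff' u v 4).2 h

/-- Comparison symbol in the ideal hierarchy. -/
noncomputable def icmp (x y : ℤ) : Ordering := compare (lev x) (lev y)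

theorem ideal_half {x y : ℤ} :
    (icmp x y = .eq → phase x (lev y) = if side x then 2 else 0) ∧
    (icmp x y = .eq → phase (x + 1) (lev y) = phase x (lev y) + 1) ∧
    (icmp x y = .gt → oddPhase (phase x (lev y))) ∧
    (icmp x y = .gt → phase (x + 1) (lev y) = phase x (lev y) + 1) ∧
    (icmp x y = .lt → phase (x + 1) (lev y) = phase x (lev y)) ∧
    (icmp x y = .gt → phase x (lev y) = 1 → lev x = lev y + 1 ∧
      (oddPhase (phase y (lev x)) ↔ side y = true)) := by
  simp only [icmp, compare_eq_iff_eq, compare_gt_iff_gt, compare_lt_iff_lt]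
  refine ⟨fun h => ?_, fun h => ?_, fun h => ?_, fun h => ?_, fun h => ?_, fun h h1 => ?_⟩
  · obtain ⟨u, h1, h2, h3⟩ := exists_unit h.le
    rw [h] at h1
    rw [(phase_of_mul h1).1]
    split_ifs with h4
    · rw [h3] at h4
      exact_mod_cast cast_zmod (u := u - 1) (v := 2) (by omega)
    · rw [h3] at h4
      exact_mod_cast cast_zmod (u := u - 1) (v := 0) (by omega)
  · obtain ⟨u, h1, -, -⟩ := exists_unit h.le
    rw [h] at h1
    rw [(phase_of_mul h1).1, (phase_of_mul h1).2]; ring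
  · obtain ⟨u, h1, h2, -⟩ := exists_even h
    rw [(phase_of_mul h1).1]
    rcases (show u % 4 = 2 ∨ u % 4 = 0 by omega) with h3 | h3
    · exact Or.inl (by exact_mod_cast cast_zmod (u := u - 1) (v := 1) (by omega))
    · exact Or.inr (by exact_mod_cast cast_zmod (u := u - 1) (v := 3) (by omega))
  · obtain ⟨u, h1, h2, -⟩ := exists_even h
    rw [(phase_of_mul h1).1, (phase_of_mul h1).2]; ring
  · refine phase_succ fun h1 => ?_
    rw [pow_dvd_iff' (by omega)] at h1
    omega
  · obtain ⟨u, h2, h3, h4⟩ := exists_even h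
    rw [(phase_of_mul h2).1] at h1
    have h5 : lev x = lev y + 1 := by
      rw [← h4]
      have : ((u - 1 : ℤ) : ZMod 4) = ((1 : ℤ) : ZMod 4) := by exact_mod_cast h1
      rw [ZMod.intCast_eq_intCast_iff'] at this
      push_cast at this
      omega
    refine ⟨h5, ?_⟩
    obtain ⟨v, h6, h7, h8⟩ := exists_unit (x := y) (j := lev x) (by omega)
    have h9 : phase y (lev x) = (((v - 1) / 2 : ℤ) : ZMod 4) := by
      rw [phase, show y - 1 - cen (lev x) = 2 ^ lev y * v - 1 by linarith, h5]
      congr 1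
      obtain ⟨w, hw⟩ : ∃ w, v = 2 * w + 1 := ⟨v / 2, by omega⟩
      have hpos : (0 : ℤ) < 2 ^ lev y := by positivity
      rw [show (2 : ℤ) ^ lev y * v - 1 = 2 ^ (lev y + 1) * w + (2 ^ lev y - 1) by
        rw [hw, pow_succ]; ring, Int.mul_add_ediv_left _ _ (by positivity),
        Int.ediv_eq_zero_of_lt (by omega) (by rw [pow_succ]; omega), hw]
      omega
    rw [h8, h9]
    unfold oddPhase
    have e1 : (((v - 1) / 2 : ℤ) : ZMod 4) = 1 ↔ (v - 1) / 2 % 4 = 1 := by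
      have := ZMod.intCast_eq_intCast_iff' ((v - 1) / 2) 1 4
      push_cast at this
      exact this
    have e3 : (((v - 1) / 2 : ℤ) : ZMod 4) = 3 ↔ (v - 1) / 2 % 4 = 3 := by
      have := ZMod.intCast_eq_intCast_iff' ((v - 1) / 2) 3 4
      push_cast at this
      exact this
    rw [e1, e3]
    omega

theorem icmp_swap (x y : ℤ) : icmp y x = (icmp x y).swap :=
  Std.OrientedCmp.eq_swap (cmp := compare (α := ℕ))

theorem lev_eq_zero (x : ℤ) : lev x = 0 ↔ x % 2 = 0 := by
  have := pow_dvd_iff 1 x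
  rw [pow_one] at this
  omega

theorem lev_add {x : ℤ} {m : ℕ} (h : m + 1 ≤ lev x) :
    lev (x + 2 ^ m) = m ∧ (side (x + 2 ^ m) = true ↔ lev x = m + 1) := by
  have hpos : (0 : ℤ) < 2 ^ m := by positivity
  obtain ⟨v, hv⟩ := (pow_dvd_iff _ _).2 h
  have h1 : 3 * (x + 2 ^ m) + 1 = 2 ^ m * (2 * v + 3) := by
    rw [show 3 * (x + 2 ^ m) + 1 = 3 * x + 1 + 3 * 2 ^ m by ring, hv, pow_succ]; ring
  have h2 : lev (x + 2 ^ m) = m := by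
    apply le_antisymm
    · by_contra h3
      have h3 : m + 1 ≤ lev (x + 2 ^ m) := by omega
      rw [← pow_dvd_iff, h1, pow_succ, mul_dvd_mul_iff_left hpos.ne'] at h3
      omega
    · rw [← pow_dvd_iff, h1]; exact dvd_mul_right _ _
  refine ⟨h2, ?_⟩
  rw [side, h2, h1, Int.mul_ediv_cancel_left _ hpos.ne', decide_eq_true_eq]
  have h3 : m + 2 ≤ lev x ↔ v % 2 = 0 := by
    rw [← pow_dvd_iff, hv, pow_succ 2 (m + 1), mul_dvd_mul_iff_left (by positivity),
      Int.dvd_iff_emod_eq_zero]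
  omega

/-- Parity label in the ideal hierarchy. -/
def par (x : ℤ) : Bool := decide (x % 2 = 0)

theorem inLev_iff (m : ℕ) (x : ℤ) : inLev par side m x ↔ m ≤ lev x := by
  induction m using Nat.twoStepInduction with
  | zero => simp [inLev]
  | one =>
    have := lev_eq_zero x
    rw [inLev, par, decide_eq_false_iff_not, ← this]
    omega
  | more m _ ih =>
    rw [inLev, ih]
    constructor
    · rintro ⟨h1, h2⟩
      have := (lev_add h1).2
      rw [h2] at this
      simp at this
      omega
    · intro h
      have := (lev_add (x := x) (m := m) (by omega)).2
      refine ⟨by omega, ?_⟩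
      rw [← Bool.not_eq_true, this]
      omega

theorem isLev_iff (m : ℕ) (x : ℤ) : isLev par side m x ↔ lev x = m := by
  rw [isLev, inLev_iff, inLev_iff]; omega

theorem ideal_skel :
    Skel par side par side icmp (fun x y => phase x (lev y)) (fun x y => phase y (lev x)) := by
  have hp : ∀ x, par x = true ↔ lev x = 0 := fun x => by
    rw [par, decide_eq_true_eq, lev_eq_zero]
  have hp' : ∀ x, par x = false ↔ 0 < lev x := fun x => by
    rw [← Bool.not_eq_true, hp]; omega
  have ha : ∀ x, par (x + 1) = !par x := fun x => by
    unfold par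
    rcases Int.emod_two_eq_zero_or_one x with h | h
    · simp [h]; omega
    · simp [h]; omega
  have sw : ∀ x y o, icmp x y = o → icmp y x = o.swap := fun x y o h => by rw [icmp_swap, h]
  exact {
    px_alt := ha
    py_alt := ha
    c_oo := fun x y h1 h2 => by
      rw [hp] at h1 h2; simp [icmp, h1, h2]
    c_eo := fun x y h1 h2 => by
      rw [hp'] at h1; rw [hp] at h2; rw [icmp, compare_gt_iff_gt]; omega
    c_oe := fun x y h1 h2 => by
      rw [hp] at h1; rw [hp'] at h2; rw [icmp, compare_lt_iff_lt]; omega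
    k_eq := fun x y h => ideal_half.1 h
    k_eq' := fun x y h => ideal_half.2.1 h
    k_gt := fun x y h => ideal_half.2.2.1 h
    k_gt' := fun x y h => ideal_half.2.2.2.1 h
    k_lt' := fun x y h => ideal_half.2.2.2.2.1 h
    l_eq := fun x y h => ideal_half.1 (sw x y _ h)
    l_eq' := fun x y h => ideal_half.2.1 (sw x y _ h)
    l_lt := fun x y h => ideal_half.2.2.1 (sw x y _ h)
    l_lt' := fun x y h => ideal_half.2.2.2.1 (sw x y _ h)
    l_gt' := fun x y h => ideal_half.2.2.2.2.1 (sw x y _ h)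
    centre := fun x y h h' => (ideal_half.2.2.2.2.2 h h').2
    centre' := fun x y h h' => (ideal_half.2.2.2.2.2 (sw x y _ h) h').2 }

/-- There is a configuration carrying the ideal hierarchy and prescribed admissible flags. -/
theorem exists_ideal {Q R : Type} [Finite Q] [Finite R] (M : CMachine Q R)
    (hM : ∀ r, M.op M.init r = .hold) (flag : ℕ → Bool)
    (hflag : ∀ n, flag n = true → ¬ M.Checked n) :
    ∃ t : HConf Q R, t.Signals M ∧ t.Checks M ∧ t.px = par ∧ t.py = par ∧ t.sx = side ∧
      t.sy = side ∧ t.c = icmp ∧ ∀ x, (t.Lx x).2.2 = flag (lev x) := by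
  let L : ℤ → Q × (R → Bool) × Bool := fun y =>
    ((M.run (lev y)).1, fun r => decide ((M.run (lev y)).2 r = 0), flag (lev y))
  obtain ⟨ρ, ell, υ, hr, hl, hu⟩ := exists_signals
    (R := Bool × Bool × (R → Bool)) (L := Bool × (R → Bool)) (U := Bool × Bool × (R → Bool))
    (fun x y r l u => (icmp x y == .eq, if icmp x y = .eq then u.1 else r.2.1,
      if (icmp x y == .lt && l.1 && u.2.1) = true then u.2.2
        else if icmp x y = .gt then fun _ => true else r.2.2))
    (fun x y l u => (if icmp x y = .eq then u.1 else if icmp x y = .lt then l.1 else false,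
      if (icmp x y == .lt && l.1 && u.2.1) = true then u.2.2
        else if icmp x y = .lt then l.2 else fun _ => false))
    (fun x y r l u =>
      (if icmp x y = .gt ∧ phase x (lev y) = 1 ∧ side y = false then r.2.1
        else if par x = true ∧ icmp x y = .lt then r.1 else u.1,
      if icmp x y = .eq ∧ u.1 = true then !side x && !side y
        else if icmp x y = .lt ∧ l.1 = true ∧ phase x (lev y) = 2 then false else u.2.1,
      if (icmp x y == .lt && l.1 && u.2.1) = true then
        fun s => (M.op (L y).1 s).bit r.2.2 u.2.2 l.2 s
      else if icmp x y = .eq ∧ u.1 = true then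
        fun s => (M.op (L y).1 s).bit r.2.2 (fun _ => false) (fun _ => false) s
      else u.2.2))
  let t : HConf Q R :=
    { px := par, sx := side, py := par, sy := side, Lx := L, Ly := L, c := icmp
      k := fun x y => phase x (lev y), k' := fun x y => phase y (lev x)
      tau := fun x y => (ρ x y).1, gam := fun x y => (ρ x y).2.1, P := fun x y => (ρ x y).2.2
      rho := fun x y => (ell x y).1, N := fun x y => (ell x y).2
      G := fun x y => (υ x y).1, mu := fun x y => (υ x y).2.1, D := fun x y => (υ x y).2.2 }
  have hs : t.Signals M :=
    { skel := ideal_skel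
      tau := fun x y => congrArg (·.1) (hr x y)
      gam := fun x y => congrArg (·.2.1) (hr x y)
      P := fun x y => congrArg (·.2.2) (hr x y)
      rho := fun x y => congrArg (·.1) (hl x y)
      N := fun x y => congrArg (·.2) (hl x y)
      G := fun x y => congrArg (·.1) (hu x y)
      mu := fun x y => congrArg (·.2.1) (hu x y)
      D := fun x y => congrArg (·.2.2) (hu x y) }
  have corner : ∀ x y, t.act x y = true → ∃ x' y' m, t.isX m x' ∧ t.isY m y' ∧
      lev x < lev y ∧ lev y < m ∧ x = x' + 2 ^ lev x ∧ y = y' + 2 ^ lev y := by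
    intro x y ha
    have hx := inLev_of_isLev (hs.skel.clx (lev x)) (hs.skel.clx (lev x + 1))
      ((isLev_iff _ _).2 (rfl : lev x = lev x))
    have hy := inLev_of_isLev (hs.skel.cly (lev y)) (hs.skel.cly (lev y + 1))
      ((isLev_iff _ _).2 (rfl : lev y = lev y))
    obtain ⟨h1, h2⟩ := hs.eq_of_act (x := x - 2 ^ lev x) (y := y - 2 ^ lev y) (i := lev x)
      (j := lev y) hx hy (by simpa using ha)
    have h3 : lev (x - 2 ^ lev x) = lev (y - 2 ^ lev y) := compare_eq_iff_eq.1 h2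
    have h4 := (inLev_iff _ _).1 hy
    refine ⟨_, _, lev (y - 2 ^ lev y), (isLev_iff _ _).2 h3, (isLev_iff _ _).2 rfl, h1, by omega,
      by ring, by ring⟩
  have values : ∀ x' y' m, t.isX m x' → t.isY m y' → ∀ j < m,
      (∀ l < j, t.D (x' + 2 ^ l) (y' + 2 ^ j) = M.digit j l) ∧
      (∀ l ≤ j, t.P (x' + 2 ^ l) (y' + 2 ^ j) =
        fun r => if l = 0 then true else M.digit j (l - 1) r) := by
    intro x' y' m hx hy j hj
    have h1 := (hs.data hM hx hy j hj (fun i hi => by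
      have : lev (y' + 2 ^ i) = i := by
        rw [← isLev_iff]
        exact Signals.isY_add hs.skel (inLev_mono (by omega) hy.1)
      show (M.run (lev (y' + 2 ^ i))).1 = _
      rw [this])).1
    exact ⟨fun l hl => (h1 l hl).1, (hs.row_values hM hx hy hj h1).2.1⟩
  refine ⟨t, hs, ?_, rfl, rfl, rfl, rfl, rfl, fun x => rfl⟩
  refine ⟨fun x y h => ?_, fun y h => ?_, fun x y h h' => ?_, fun x y h hx r => ?_,
    fun x y h h1 h2 h3 => ?_⟩
  · have : lev x = lev y := compare_eq_iff_eq.1 h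
    show L x = L y
    simp only [L, this]
  · have : lev y = 0 := by
      rw [lev_eq_zero]; simpa [t, par] using h
    show (L y).1 = M.init ∧ ∀ r, (L y).2.1 r = true
    simp [L, this, CMachine.run]
  · have : lev x = lev y + 1 := (ideal_half.2.2.2.2.2 h h').1
    show (L x).1 = M.next (L y).1 (L y).2.1
    simp only [L, this, CMachine.run]
  · obtain ⟨x', y', m, hx', hy', h1, h2, h3, h4⟩ := corner x y h
    have h5 := (values x' y' m hx' hy' (lev y) h2).1 (lev x) h1
    rw [← h3, ← h4] at h5
    have h6 : lev x = 0 := by rw [lev_eq_zero]; simpa [t, par] using hx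
    rw [h5, h6]
    show decide _ = !decide _
    rw [← decide_not]
    exact decide_eq_decide.2 (by omega)
  · obtain ⟨x', y', m, hx', hy', h5, h6, h7, h8⟩ := corner x y h
    obtain ⟨h9, h10⟩ := values x' y' m hx' hy' (lev y) h6
    have h9 := h9 (lev x) h5
    have h10 := h10 (lev x) h5.le
    rw [← h7, ← h8] at h9 h10
    rw [h9] at h3
    rw [h10] at h2
    by_contra hf
    refine hflag _ (by simpa using hf : flag (lev x) = true) ⟨lev y, h1, ?_⟩
    simp only [CMachine.digit, decide_eq_false_iff_not, not_lt] at h3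
    split_ifs at h2 with h0
    · omega
    · simp only [CMachine.digit, decide_eq_true_eq] at h2
      omega

end HConf

/-- Two-dimensional nearest-neighbour shifts. -/
def GridShift {T : Type*} (Nh Nv : T → T → Prop) : Set (ℤ → ℤ → T) :=
  {y | ∀ i j, Nh (y i j) (y (i + 1) j) ∧ Nv (y i j) (y i (j + 1))}

/-- Number of patterns of a nearest-neighbour shift. -/
noncomputable def gridCount {T : Type*} (Nh Nv : T → T → Prop) (W H : ℕ) : ℕ :=
  Set.ncard {p : Fin W → Fin H → T | ∃ y ∈ GridShift Nh Nv, ∀ (i : Fin W) (j : Fin H),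
    y (i : ℕ) (j : ℕ) = p i j}

/-- Right-moving signals. -/
structure RVal (Q R : Type) where
  e : Bool
  py : Bool
  sy : Bool
  L : Q × (R → Bool) × Bool
  k : ZMod 4
  tau : Bool
  gam : Bool
  P : R → Bool

/-- Left-moving signals. -/
structure LVal (R : Type) where
  rho : Bool
  N : R → Bool

/-- Up-moving signals. -/
structure UVal (Q R : Type) where
  e : Bool
  px : Bool
  sx : Bool
  L : Q × (R → Bool) × Bool
  k : ZMod 4
  G : Bool
  mu : Bool
  D : R → Bool

/-- Tiles: a comparison symbol, a free bit, and the incoming signals. -/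
structure Tile (Q R : Type) where
  c : Ordering
  fr : Bool
  r : RVal Q R
  l : LVal R
  u : UVal Q R

section finite

variable {Q R : Type} [Finite Q] [Finite R]

instance : Finite (RVal Q R) :=
  Finite.of_injective (fun r : RVal Q R => (r.e, r.py, r.sy, r.L, r.k, r.tau, r.gam, r.P))
    (by rintro ⟨⟩ ⟨⟩ h; simpa using h)

instance : Finite (LVal R) :=
  Finite.of_injective (fun r : LVal R => (r.rho, r.N)) (by rintro ⟨⟩ ⟨⟩ h; simpa using h)

instance : Finite (UVal Q R) :=
  Finite.of_injective (fun r : UVal Q R => (r.e, r.px, r.sx, r.L, r.k, r.G, r.mu, r.D))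
    (by rintro ⟨⟩ ⟨⟩ h; simpa using h)

instance : Finite (Tile Q R) :=
  Finite.of_injective (fun t : Tile Q R => (t.c, t.fr, t.r, t.l, t.u))
    (by rintro ⟨⟩ ⟨⟩ h; simpa using h)

end finite

namespace Tile

variable {Q R : Type} (M : CMachine Q R)

def act (t : Tile Q R) : Bool := t.c == .lt && t.l.rho && t.u.mu

/-- Outgoing right-moving signals. -/
def outR (t : Tile Q R) : RVal Q R where
  e := !t.r.e
  py := t.r.py
  sy := t.r.sy
  L := t.r.L
  k := if t.c = .lt then t.r.k else t.r.k + 1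
  tau := t.c == .eq
  gam := if t.c = .eq then t.u.G else t.r.gam
  P := if t.act = true then t.u.D else if t.c = .gt then fun _ => true else t.r.P

/-- Outgoing left-moving signals. -/
def outL (t : Tile Q R) : LVal R where
  rho := if t.c = .eq then t.u.G else if t.c = .lt then t.l.rho else false
  N := if t.act = true then t.u.D else if t.c = .lt then t.l.N else fun _ => false

/-- Outgoing up-moving signals. -/
def outU (t : Tile Q R) : UVal Q R where
  e := !t.u.e
  px := t.u.px
  sx := t.u.sx
  L := t.u.L
  k := if t.c = .gt then t.u.k else t.u.k + 1
  G := if t.c = .gt ∧ t.r.k = 1 ∧ t.r.sy = false then t.r.gam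
    else if t.u.px = true ∧ t.c = .lt then t.r.tau else t.u.G
  mu := if t.c = .eq ∧ t.u.G = true then !t.u.sx && !t.r.sy
    else if t.c = .lt ∧ t.l.rho = true ∧ t.r.k = 2 then false else t.u.mu
  D := if t.act = true then fun r => (M.op t.r.L.1 r).bit t.r.P t.u.D t.l.N r
    else if t.c = .eq ∧ t.u.G = true then
      fun r => (M.op t.r.L.1 r).bit t.r.P (fun _ => false) (fun _ => false) r
    else t.u.D

/-- Internal consistency of a tile. -/
structure Good (t : Tile Q R) : Prop where
  free : t.fr = true → t.c = .eq ∧ t.u.L.2.2 = true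
  ex : t.r.e = t.u.px
  ey : t.u.e = t.r.py
  c_oo : t.u.px = true → t.r.py = true → t.c = .eq
  c_eo : t.u.px = false → t.r.py = true → t.c = .gt
  c_oe : t.u.px = true → t.r.py = false → t.c = .lt
  k_eq : t.c = .eq → t.r.k = if t.u.sx then 2 else 0
  k_gt : t.c = .gt → oddPhase t.r.k
  l_eq : t.c = .eq → t.u.k = if t.r.sy then 2 else 0
  l_lt : t.c = .lt → oddPhase t.u.k
  centre : t.c = .gt → t.r.k = 1 → (oddPhase t.u.k ↔ t.r.sy = true)
  centre' : t.c = .lt → t.u.k = 1 → (oddPhase t.r.k ↔ t.u.sx = true)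
  lab_eq : t.c = .eq → t.u.L = t.r.L
  lab_zero : t.r.py = true → t.r.L.1 = M.init ∧ ∀ r, t.r.L.2.1 r = true
  lab_next : t.c = .gt → t.r.k = 1 → t.u.L.1 = M.next t.r.L.1 t.r.L.2.1
  zero : t.act = true → t.u.px = true → ∀ r, t.r.L.2.1 r = !t.u.D r
  chk : t.act = true → M.chk t.r.L.1 = true → t.r.P M.r₀ = true → t.u.D M.r₀ = false →
    t.u.L.2.2 = false

/-- Horizontal adjacency rule. -/
def Nh (s t : Tile Q R) : Prop := s.Good M ∧ t.r = s.outR ∧ s.l = t.outL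

/-- Vertical adjacency rule. -/
def Nv (s t : Tile Q R) : Prop := t.u = s.outU M

variable {M}

theorem exists_hconf {y : ℤ → ℤ → Tile Q R} (hy : y ∈ GridShift (Nh M) (Nv M)) :
    ∃ t : HConf Q R, t.Signals M ∧ t.Checks M ∧ (∀ i j, t.c i j = (y i j).c) ∧
      ∀ i j, (y i j).fr = true → t.c i j = .eq ∧ (t.Lx i).2.2 = true := by
  have hg : ∀ i j, (y i j).Good M := fun i j => (hy i j).1.1
  have hR : ∀ i j, (y (i + 1) j).r = (y i j).outR := fun i j => (hy i j).1.2.1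
  have hL : ∀ i j, (y i j).l = (y (i + 1) j).outL := fun i j => (hy i j).1.2.2
  have hU : ∀ i j, (y i (j + 1)).u = (y i j).outU M := fun i j => (hy i j).2
  have const : ∀ {α : Type} (f : ℤ → α), (∀ i, f (i + 1) = f i) → ∀ i, f i = f 0 := by
    intro α f hf i
    induction i using Int.induction_on with
    | zero => rfl
    | succ i ih => rw [hf, ih]
    | pred i ih => rw [← ih, ← hf (-(i : ℤ) - 1)]; congr 1; ring
  have cx : ∀ i j, ((y i j).u.px, (y i j).u.sx, (y i j).u.L) =
      ((y i 0).u.px, (y i 0).u.sx, (y i 0).u.L) := fun i =>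
    const _ fun j => by rw [hU]; rfl
  have cy : ∀ j i, ((y i j).r.py, (y i j).r.sy, (y i j).r.L) =
      ((y 0 j).r.py, (y 0 j).r.sy, (y 0 j).r.L) := fun j =>
    const _ fun i => by rw [hR]; rfl
  simp only [Prod.mk.injEq] at cx cy
  have px' : ∀ i j, (y i j).u.px = (y i 0).u.px := fun i j => (cx i j).1
  have sx' : ∀ i j, (y i j).u.sx = (y i 0).u.sx := fun i j => (cx i j).2.1
  have lx' : ∀ i j, (y i j).u.L = (y i 0).u.L := fun i j => (cx i j).2.2
  have py' : ∀ i j, (y i j).r.py = (y 0 j).r.py := fun i j => (cy j i).1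
  have sy' : ∀ i j, (y i j).r.sy = (y 0 j).r.sy := fun i j => (cy j i).2.1
  have ly' : ∀ i j, (y i j).r.L = (y 0 j).r.L := fun i j => (cy j i).2.2
  let t : HConf Q R :=
    { px := fun i => (y i 0).u.px, sx := fun i => (y i 0).u.sx, Lx := fun i => (y i 0).u.L
      py := fun j => (y 0 j).r.py, sy := fun j => (y 0 j).r.sy, Ly := fun j => (y 0 j).r.L
      c := fun i j => (y i j).c, k := fun i j => (y i j).r.k, k' := fun i j => (y i j).u.k
      tau := fun i j => (y i j).r.tau, gam := fun i j => (y i j).r.gam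
      P := fun i j => (y i j).r.P, rho := fun i j => (y i j).outL.rho
      N := fun i j => (y i j).outL.N, G := fun i j => (y i j).u.G, mu := fun i j => (y i j).u.mu
      D := fun i j => (y i j).u.D }
  have hrho : ∀ i j, t.rho (i + 1) j = (y i j).l.rho := fun i j => by rw [hL]
  have hN : ∀ i j, t.N (i + 1) j = (y i j).l.N := fun i j => by rw [hL]
  have hact : ∀ i j, t.act i j = (y i j).act := by
    intro i j
    rw [HConf.act, hrho]; rfl
  refine ⟨t, ?_, ?_, fun _ _ => rfl, fun i j h => ?_⟩
  · refine ⟨?_, fun i j => ?_, fun i j => ?_, fun i j => ?_, fun i j => ?_, fun i j => ?_,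
      fun i j => ?_, fun i j => ?_, fun i j => ?_⟩
    · exact {
        px_alt := fun i => by
          show (y (i + 1) 0).u.px = !(y i 0).u.px
          rw [← (hg (i + 1) 0).ex, ← (hg i 0).ex, hR]; rfl
        py_alt := fun j => by
          show (y 0 (j + 1)).r.py = !(y 0 j).r.py
          rw [← (hg 0 (j + 1)).ey, ← (hg 0 j).ey, hU]; rfl
        c_oo := fun i j => by simpa only [px', py'] using (hg i j).c_oo
        c_eo := fun i j => by simpa only [px', py'] using (hg i j).c_eo
        c_oe := fun i j => by simpa only [px', py'] using (hg i j).c_oe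
        k_eq := fun i j => by simpa only [sx', sy'] using (hg i j).k_eq
        k_eq' := fun i j (h : (y i j).c = _) => by
          show (y (i + 1) j).r.k = _
          rw [hR, outR, if_neg (by simp [h])]
        k_gt := fun i j => (hg i j).k_gt
        k_gt' := fun i j (h : (y i j).c = _) => by
          show (y (i + 1) j).r.k = _
          rw [hR, outR, if_neg (by simp [h])]
        k_lt' := fun i j (h : (y i j).c = _) => by
          show (y (i + 1) j).r.k = _
          rw [hR, outR, if_pos h]
        l_eq := fun i j => by simpa only [sx', sy'] using (hg i j).l_eq
        l_eq' := fun i j (h : (y i j).c = _) => by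
          show (y i (j + 1)).u.k = _
          rw [hU, outU, if_neg (by simp [h])]
        l_lt := fun i j => (hg i j).l_lt
        l_lt' := fun i j (h : (y i j).c = _) => by
          show (y i (j + 1)).u.k = _
          rw [hU, outU, if_neg (by simp [h])]
        l_gt' := fun i j (h : (y i j).c = _) => by
          show (y i (j + 1)).u.k = _
          rw [hU, outU, if_pos h]
        centre := fun i j => by simpa only [sx', sy'] using (hg i j).centre
        centre' := fun i j => by simpa only [sx', sy'] using (hg i j).centre' }
    · show (y (i + 1) j).r.tau = _
      rw [hR]; rfl
    · show (y (i + 1) j).r.gam = _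
      rw [hR]; rfl
    · show (y i (j + 1)).u.G = _
      rw [hU, outU]
      simp only [px', sy']; rfl
    · rw [hrho]; rfl
    · rw [hrho]
      show (y i (j + 1)).u.mu = _
      rw [hU, outU]
      simp only [sx', sy']; rfl
    · rw [hact, hN]; rfl
    · rw [hact]
      show (y (i + 1) j).r.P = _
      rw [hR]; rfl
    · rw [hact, hN]
      show (y i (j + 1)).u.D = _
      rw [hU, outU]
      simp only [ly']; rfl
  · exact {
      lab_eq := fun i j => by simpa only [lx', ly'] using (hg i j).lab_eq
      lab_zero := fun j => (hg 0 j).lab_zero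
      lab_next := fun i j => by simpa only [lx', ly'] using (hg i j).lab_next
      zero := fun i j => by rw [hact]; simpa only [lx', ly', px'] using (hg i j).zero
      chk := fun i j => by rw [hact]; simpa only [lx', ly'] using (hg i j).chk }
  · have := (hg i j).free h
    rwa [lx'] at this

theorem exists_grid {t : HConf Q R} (hs : t.Signals M) (hc : t.Checks M) (fr : ℤ → ℤ → Bool)
    (hfr : ∀ i j, fr i j = true → t.c i j = .eq ∧ (t.Lx i).2.2 = true) :
    ∃ y ∈ GridShift (Nh M) (Nv M), ∀ i j, (y i j).fr = fr i j := by
  let y : ℤ → ℤ → Tile Q R := fun i j =>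
    { c := t.c i j
      fr := fr i j
      r := ⟨t.px i, t.py j, t.sy j, t.Ly j, t.k i j, t.tau i j, t.gam i j, t.P i j⟩
      l := ⟨t.rho (i + 1) j, t.N (i + 1) j⟩
      u := ⟨t.py j, t.px i, t.sx i, t.Lx i, t.k' i j, t.G i j, t.mu i j, t.D i j⟩ }
  have hk := hs.skel
  refine ⟨y, fun i j => ⟨⟨?_, ?_, ?_⟩, ?_⟩, fun _ _ => rfl⟩
  · exact ⟨hfr i j, rfl, rfl, hk.c_oo i j, hk.c_eo i j, hk.c_oe i j, hk.k_eq i j, hk.k_gt i j,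
      hk.l_eq i j, hk.l_lt i j, hk.centre i j, hk.centre' i j, hc.lab_eq i j, hc.lab_zero j,
      hc.lab_next i j, hc.zero i j, hc.chk i j⟩
  · have : t.k (i + 1) j = if t.c i j = .lt then t.k i j else t.k i j + 1 := by
      cases h : t.c i j
      · rw [if_pos rfl, hk.k_lt' i j h]
      · rw [if_neg (by simp), hk.k_eq' i j h]
      · rw [if_neg (by simp), hk.k_gt' i j h]
    show RVal.mk _ _ _ _ _ _ _ _ = RVal.mk _ _ _ _ _ _ _ _
    rw [hk.px_alt, this, hs.tau, hs.gam, hs.P]; rfl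
  · show LVal.mk _ _ = LVal.mk _ _
    rw [hs.rho, hs.N]; rfl
  · have : t.k' i (j + 1) = if t.c i j = .gt then t.k' i j else t.k' i j + 1 := by
      cases h : t.c i j
      · rw [if_neg (by simp), hk.l_lt' i j h]
      · rw [if_neg (by simp), hk.l_eq' i j h]
      · rw [if_pos rfl, hk.l_gt' i j h]
    show UVal.mk _ _ _ _ _ _ _ _ = UVal.mk _ _ _ _ _ _ _ _
    rw [hk.py_alt, this, hs.G, hs.mu, hs.D]; rfl

/-- A window is determined by its boundary and by its comparison symbols and free bits. -/
theorem determined {y z : ℤ → ℤ → Tile Q R} (hy : y ∈ GridShift (Nh M) (Nv M))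
    (hz : z ∈ GridShift (Nh M) (Nv M)) {W H : ℕ}
    (hr : ∀ j : ℕ, j < H → (y 0 j).r = (z 0 j).r)
    (hl : ∀ j : ℕ, j < H → (y W j).outL = (z W j).outL)
    (hu : ∀ i : ℕ, i < W → (y i 0).u = (z i 0).u)
    (hc : ∀ i j : ℕ, i < W → j < H → (y i j).c = (z i j).c ∧ (y i j).fr = (z i j).fr) :
    ∀ j : ℕ, j < H → ∀ i : ℕ, i < W → y i j = z i j := by
  have hR : ∀ y ∈ GridShift (Nh M) (Nv M), ∀ i j, (y (i + 1) j).r = (y i j).outR :=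
    fun y hy i j => (hy i j).1.2.1
  have hL : ∀ y ∈ GridShift (Nh M) (Nv M), ∀ i j, (y i j).l = (y (i + 1) j).outL :=
    fun y hy i j => (hy i j).1.2.2
  have hU : ∀ y ∈ GridShift (Nh M) (Nv M), ∀ i j, (y i (j + 1)).u = (y i j).outU M :=
    fun y hy i j => (hy i j).2
  have ext : ∀ s t : Tile Q R, s.c = t.c → s.fr = t.fr → s.r = t.r → s.l = t.l → s.u = t.u →
      s = t := by
    rintro ⟨⟩ ⟨⟩ h1 h2 h3 h4 h5; simp_all
  have row : ∀ j : ℕ, j < H → (∀ i : ℕ, i < W → (y i j).u = (z i j).u) →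
      ∀ i : ℕ, i < W → y i j = z i j := by
    intro j hj hu
    have left : ∀ i : ℕ, i ≤ W → (y (W - i : ℕ) j).outL = (z (W - i : ℕ) j).outL := by
      intro i
      induction i with
      | zero => intro _; exact hl j hj
      | succ i ih =>
        intro hi
        have e : ((W - (i + 1) : ℕ) : ℤ) + 1 = (W - i : ℕ) := by omega
        have h1 := hL y hy (W - (i + 1) : ℕ) j
        have h2 := hL z hz (W - (i + 1) : ℕ) j
        rw [e] at h1 h2
        have h3 := hc (W - (i + 1)) j (by omega) hj
        rw [outL, outL, act, act, h1, h2, ih (by omega), hu _ (by omega), h3.1]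
    have hl' : ∀ i : ℕ, i < W → (y i j).l = (z i j).l := by
      intro i hi
      rw [hL y hy, hL z hz]
      have := left (W - (i + 1)) (by omega)
      rw [show W - (W - (i + 1)) = i + 1 by omega] at this
      exact_mod_cast this
    intro i
    induction i with
    | zero =>
      intro hi
      exact ext _ _ (hc 0 j hi hj).1 (hc 0 j hi hj).2 (hr j hj) (hl' 0 hi) (hu 0 hi)
    | succ i ih =>
      intro hi
      refine ext _ _ (hc _ j hi hj).1 (hc _ j hi hj).2 ?_ (hl' _ hi) (hu _ hi)
      push_cast
      rw [hR y hy, hR z hz, ih (by omega)]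
  intro j
  induction j with
  | zero => intro hj; exact row 0 hj hu
  | succ j ih =>
    intro hj
    refine row _ hj fun i hi => ?_
    push_cast
    rw [hU y hy, hU z hz, ih (by omega) i hi]

end Tile

theorem card_class_le (q : ℕ) (a : ℤ) (W : ℕ) :
    (Finset.univ.filter fun i : Fin W => (q : ℤ) ∣ (i : ℕ) - a).card ≤ W / q + 1 := by
  rw [← Finset.card_range (W / q + 1)]
  refine Finset.card_le_card_of_injOn (fun i => (i : ℕ) / q) ?_ ?_
  · intro i _
    simp only [Finset.coe_range, Set.mem_Iio]
    exact Nat.lt_succ_of_le (Nat.div_le_div_right i.2.le)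
  · intro i hi j hj hij
    simp only [Finset.coe_filter, Finset.mem_univ, true_and, Set.mem_ofPred_eq] at hi hj
    have h1 : (q : ℤ) ∣ ((i : ℕ) : ℤ) - ((j : ℕ) : ℤ) := by
      have := dvd_sub hi hj
      rwa [sub_sub_sub_cancel_right] at this
    have h2 : (i : ℕ) % q = (j : ℕ) % q :=
      ((Nat.modEq_iff_dvd (n := q) (a := (j : ℕ)) (b := (i : ℕ))).2 h1).symm
    have h3 : (i : ℕ) / q = (j : ℕ) / q := hij
    apply Fin.ext
    rw [← Nat.div_add_mod (i : ℕ) q, ← Nat.div_add_mod (j : ℕ) q, h2, h3]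

theorem le_card_class (q : ℕ) (hq : 0 < q) (a : ℤ) (W : ℕ) :
    W / q ≤ (Finset.univ.filter fun i : Fin W => (q : ℤ) ∣ (i : ℕ) - a).card := by
  have hq' : (0 : ℤ) < q := by exact_mod_cast hq
  have h0 := Int.emod_nonneg a hq'.ne'
  have h1 := Int.emod_lt_of_pos a hq'
  have h2 : ∀ k < W / q, (a % q).toNat + q * k < W := by
    intro k hk
    have h3 : q * (k + 1) ≤ W := (Nat.mul_le_mul_left q hk).trans (Nat.mul_div_le W q)
    rw [mul_add] at h3
    omega
  let f : Fin (W / q) → Fin W := fun k => ⟨(a % q).toNat + q * k, h2 k k.2⟩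
  have hf : Function.Injective f := by
    intro k k' h
    have h3 : (a % q).toNat + q * (k : ℕ) = (a % q).toNat + q * (k' : ℕ) := congrArg Fin.val h
    exact Fin.ext (Nat.eq_of_mul_eq_mul_left hq (by omega))
  rw [← Fintype.card_fin (W / q), ← Finset.card_univ, ← Finset.card_image_of_injective _ hf]
  refine Finset.card_le_card fun i hi => ?_
  obtain ⟨k, -, rfl⟩ := Finset.mem_image.1 hi
  refine Finset.mem_filter.2 ⟨Finset.mem_univ _, ?_⟩
  have h3 := Int.mul_ediv_add_emod a q
  refine ⟨k - a / q, ?_⟩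
  simp only [f]
  push_cast
  rw [Int.toNat_of_nonneg h0, mul_sub]
  linarith

/-- Exact level `l` for the chain of residue classes of `a`. -/
def exactLev (a : ℤ) (l : ℕ) (x : ℤ) : Prop :=
  (2 : ℤ) ^ l ∣ x - a ∧ ¬ (2 : ℤ) ^ (l + 1) ∣ x - a

theorem exactLev_dvd {a x : ℤ} {l : ℕ} (h : exactLev a l x) :
    ((2 ^ (l + 1) : ℕ) : ℤ) ∣ x - (a + 2 ^ l) := by
  obtain ⟨⟨u, hu⟩, h2⟩ := h
  have h3 : u % 2 = 1 := by
    by_contra h4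
    obtain ⟨v, rfl⟩ : ∃ v, u = 2 * v := ⟨u / 2, by omega⟩
    exact h2 ⟨v, by rw [hu, pow_succ]; ring⟩
  obtain ⟨v, rfl⟩ : ∃ v, u = 2 * v + 1 := ⟨u / 2, by omega⟩
  exact ⟨v, by push_cast; rw [pow_succ]; linarith⟩

namespace HConf

variable {Q R : Type} {M : CMachine Q R} {t : HConf Q R}

open Classical in
/-- Value of the comparison symbol forced by residue classes modulo `2 ^ m`. -/
noncomputable def forced (m : ℕ) (a b x y : ℤ) : Ordering :=
  if ∃ l < m, exactLev a l x ∧ exactLev b l y then .eq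
  else if ∃ l ≤ m, ¬ (2 : ℤ) ^ l ∣ x - a ∧ (2 : ℤ) ^ l ∣ y - b then .lt else .gt

theorem exists_base {p s : ℤ → Bool} (h : ∀ m, IsClass (2 ^ m) (inLev p s m)) (m : ℕ) :
    ∃ a : ℕ, a < 2 ^ m ∧ ∀ l ≤ m, ∀ x, inLev p s l x ↔ (2 : ℤ) ^ l ∣ x - a := by
  obtain ⟨a, ha⟩ := (h m).exists
  have hpos : (0 : ℤ) < 2 ^ m := by positivity
  have h0 := Int.emod_nonneg a hpos.ne'
  have h1 := Int.emod_lt_of_pos a hpos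
  refine ⟨(a % 2 ^ m).toNat, by zify; rw [Int.toNat_of_nonneg h0]; exact h1, fun l hl x => ?_⟩
  rw [Int.toNat_of_nonneg h0]
  have h2 : inLev p s m (a % 2 ^ m) := by
    have := (h m).add ha (a % 2 ^ m - a)
    rw [add_sub_cancel] at this
    rw [this]
    exact (Int.mod_modEq a (2 ^ m)).symm.dvd
  have := (h l).add (inLev_mono hl h2) (x - a % 2 ^ m)
  rwa [add_sub_cancel] at this

/-- The comparison symbols and free bits are forced away from the cells of high level and the
cells of unchecked level. -/
theorem forced_spec (hM : ∀ r, M.op M.init r = .hold) (hchk : M.chk M.init = false)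
    (hs : t.Signals M) (hc : t.Checks M) (m : ℕ) {a b : ℤ}
    (ha : ∀ l ≤ m, ∀ x, t.X l x ↔ (2 : ℤ) ^ l ∣ x - a)
    (hb : ∀ l ≤ m, ∀ x, t.Y l x ↔ (2 : ℤ) ^ l ∣ x - b) {x y : ℤ}
    (hxy : ¬ ((2 : ℤ) ^ m ∣ x - a ∧ (2 : ℤ) ^ m ∣ y - b)) :
    t.c x y = forced m a b x y ∧ (t.c x y = .eq → (t.Lx x).2.2 = true →
      ∃ l < m, exactLev a l x ∧ exactLev b l y ∧ ¬ M.Checked l) := by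
  have hk := hs.skel
  have ha' : ∀ l < m, ∀ x, t.isX l x ↔ exactLev a l x := fun l hl x => by
    exact and_congr (ha l hl.le x) (not_congr (ha (l + 1) hl x))
  have hb' : ∀ l < m, ∀ x, t.isY l x ↔ exactLev b l x := fun l hl x => by
    exact and_congr (hb l hl.le x) (not_congr (hb (l + 1) hl x))
  rw [← ha m le_rfl, ← hb m le_rfl] at hxy
  constructor
  · unfold forced
    split_ifs with h1 h2
    · obtain ⟨l, hl, h2, h3⟩ := h1
      exact Signals.c_eq hk ((ha' l hl x).2 h2) ((hb' l hl y).2 h3)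
    · obtain ⟨l, hl, h3, h4⟩ := h2
      exact Signals.c_lt' hk (by rwa [ha l hl]) ((hb l hl y).2 h4)
    · push Not at h2
      by_cases hx : t.X m x
      · exact Signals.c_gt' hk hx (fun h => hxy ⟨hx, h⟩)
      · obtain ⟨l, hl, h3⟩ := exists_isLev_lt hx
        have h4 : ¬ t.Y (l + 1) y := by
          rw [hb (l + 1) hl]
          exact h2 (l + 1) hl (by rw [← ha (l + 1) hl]; exact h3.2)
        by_cases h5 : t.Y l y
        · exact absurd ⟨l, hl, (ha' l hl x).1 h3, (hb' l hl y).1 ⟨h5, h4⟩⟩ h1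
        · exact Signals.c_gt' hk h3.1 h5
  · intro h1 h2
    by_cases hx : t.X m x
    · rw [Signals.c_gt' hk hx (fun h => hxy ⟨hx, h⟩)] at h1
      simp at h1
    · obtain ⟨l, hl, h3⟩ := exists_isLev_lt hx
      have h4 := Signals.isY_of_eq hk h3 h1
      refine ⟨l, hl, (ha' l hl x).1 h3, (hb' l hl y).1 h4, fun h5 => ?_⟩
      rw [hs.flag hM hchk hc h5 h3] at h2
      simp at h2

end HConf

namespace Tile

variable {Q R : Type} {M : CMachine Q R}

/-- Windows of comparison symbols and free bits. -/
def cfWindows (M : CMachine Q R) (W H : ℕ) : Set (Fin W → Fin H → Ordering × Bool) :=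
  {p | ∃ y ∈ GridShift (Nh M) (Nv M), ∀ (i : Fin W) (j : Fin H),
    ((y (i : ℕ) (j : ℕ)).c, (y (i : ℕ) (j : ℕ)).fr) = p i j}

open Classical in
/-- Values that may occur at a cell, given the residue classes. -/
noncomputable def options (M : CMachine Q R) (m : ℕ) (a b x y : ℤ) : Finset (Ordering × Bool) :=
  if (2 : ℤ) ^ m ∣ x - a ∧ (2 : ℤ) ^ m ∣ y - b then Finset.univ
  else if ∃ l < m, exactLev a l x ∧ exactLev b l y ∧ ¬ M.Checked l then
    {(HConf.forced m a b x y, false), (HConf.forced m a b x y, true)}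
  else {(HConf.forced m a b x y, false)}

open Classical in
theorem card_options (m : ℕ) (a b x y : ℤ) : (options M m a b x y).card ≤
    2 ^ (3 * (if (2 : ℤ) ^ m ∣ x - a ∧ (2 : ℤ) ^ m ∣ y - b then 1 else 0) +
      ∑ l ∈ (Finset.range m).filter (fun l => ¬ M.Checked l),
        if exactLev a l x ∧ exactLev b l y then 1 else 0) := by
  unfold options
  split_ifs with h1 h2
  · calc (Finset.univ : Finset (Ordering × Bool)).card ≤ 2 ^ 3 := by decide
      _ ≤ _ := Nat.pow_le_pow_right (by norm_num) (by omega)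
  · obtain ⟨l, hl, h3, h4, h5⟩ := h2
    have : 1 ≤ ∑ l ∈ (Finset.range m).filter (fun l => ¬ M.Checked l),
        if exactLev a l x ∧ exactLev b l y then 1 else 0 := by
      refine le_trans ?_ (Finset.single_le_sum (f := fun l =>
        if exactLev a l x ∧ exactLev b l y then 1 else 0) (fun _ _ => Nat.zero_le _)
        (Finset.mem_filter.2 ⟨Finset.mem_range.2 hl, h5⟩))
      simp [h3, h4]
    calc _ ≤ 2 := Finset.card_le_two
      _ = 2 ^ 1 := rfl
      _ ≤ _ := Nat.pow_le_pow_right (by norm_num) (by omega)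
  · rw [Finset.card_singleton]
    exact Nat.one_le_two_pow

theorem cfWindows_subset (hM : ∀ r, M.op M.init r = .hold) (hchk : M.chk M.init = false)
    (W H m : ℕ) : cfWindows M W H ⊆
      ((Finset.range (2 ^ m) ×ˢ Finset.range (2 ^ m)).biUnion fun ab =>
        Fintype.piFinset fun i : Fin W => Fintype.piFinset fun j : Fin H =>
          options M m ab.1 ab.2 (i : ℕ) (j : ℕ) : Finset (Fin W → Fin H → Ordering × Bool)) := by
  rintro p ⟨y, hy, hp⟩
  obtain ⟨t, hs, hc, h1, h2⟩ := exists_hconf hy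
  obtain ⟨a, ha, ha'⟩ := HConf.exists_base hs.skel.clx m
  obtain ⟨b, hb, hb'⟩ := HConf.exists_base hs.skel.cly m
  simp only [Finset.coe_biUnion, Set.mem_iUnion, Finset.mem_coe, Fintype.mem_piFinset]
  refine ⟨(a, b), Finset.mem_product.2 ⟨Finset.mem_range.2 ha, Finset.mem_range.2 hb⟩,
    fun i j => ?_⟩
  rw [← hp i j, options, ← h1]
  split_ifs with h3 h4
  · exact Finset.mem_univ _
  · rw [← (HConf.forced_spec hM hchk hs hc m ha' hb' h3).1]
    cases (y (i : ℕ) (j : ℕ)).fr <;> simp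
  · obtain ⟨h5, h6⟩ := HConf.forced_spec hM hchk hs hc m ha' hb' h3
    rw [← h5]
    cases h : (y (i : ℕ) (j : ℕ)).fr
    · simp
    · obtain ⟨h7, h8⟩ := h2 _ _ h
      exact absurd (h6 h7 h8) h4

theorem sum_indicator_mul {W H : ℕ} (p : Fin W → Prop) (q : Fin H → Prop) [DecidablePred p]
    [DecidablePred q] : ∑ i, ∑ j, (if p i ∧ q j then 1 else 0) =
      (Finset.univ.filter p).card * (Finset.univ.filter q).card := by
  rw [Finset.card_filter, Finset.card_filter, Finset.sum_mul_sum]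
  refine Finset.sum_congr rfl fun i _ => Finset.sum_congr rfl fun j _ => ?_
  by_cases hp : p i <;> by_cases hq : q j <;> simp [hp, hq]

open Classical in
theorem card_cfWindows (hM : ∀ r, M.op M.init r = .hold) (hchk : M.chk M.init = false)
    (W H m : ℕ) : (cfWindows M W H).ncard ≤
      4 ^ m * 2 ^ (3 * ((W / 2 ^ m + 1) * (H / 2 ^ m + 1)) +
        ∑ l ∈ (Finset.range m).filter (fun l => ¬ M.Checked l),
          (W / 2 ^ (l + 1) + 1) * (H / 2 ^ (l + 1) + 1)) := by
  refine (Set.ncard_le_ncard (cfWindows_subset hM hchk W H m) (Finset.finite_toSet _)).trans ?_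
  rw [Set.ncard_coe_finset]
  refine Finset.card_biUnion_le.trans ?_
  have h4 : (4 : ℕ) ^ m = (Finset.range (2 ^ m) ×ˢ Finset.range (2 ^ m)).card := by
    rw [Finset.card_product, Finset.card_range, ← mul_pow]; rfl
  rw [h4, ← smul_eq_mul]
  refine Finset.sum_le_card_nsmul _ _ _ (fun ab _ => ?_)
  · rw [Fintype.card_piFinset]
    simp_rw [Fintype.card_piFinset]
    refine (Finset.prod_le_prod' fun i _ => Finset.prod_le_prod' fun j _ =>
      card_options m ab.1 ab.2 _ _).trans ?_
    simp_rw [Finset.prod_pow_eq_pow_sum]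
    refine Nat.pow_le_pow_right (by norm_num) ?_
    simp_rw [Finset.sum_add_distrib]
    refine add_le_add ?_ ?_
    · simp_rw [← Finset.mul_sum]
      rw [sum_indicator_mul (fun i : Fin W => (2 : ℤ) ^ m ∣ (i : ℕ) - (ab.1 : ℤ))
        (fun j : Fin H => (2 : ℤ) ^ m ∣ (j : ℕ) - (ab.2 : ℤ))]
      have h1 := card_class_le (2 ^ m) ab.1 W
      have h2 := card_class_le (2 ^ m) ab.2 H
      push_cast at h1 h2
      exact Nat.mul_le_mul_left _ (Nat.mul_le_mul h1 h2)
    · rw [Finset.sum_congr rfl (fun i _ => Finset.sum_comm), Finset.sum_comm]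
      refine Finset.sum_le_sum fun l _ => ?_
      rw [sum_indicator_mul (fun i : Fin W => exactLev ab.1 l (i : ℕ))
        (fun j : Fin H => exactLev ab.2 l (j : ℕ))]
      refine Nat.mul_le_mul ?_ ?_
      · exact (Finset.card_le_card (Finset.monotone_filter_right _ fun i _ h =>
          exactLev_dvd h)).trans (card_class_le (2 ^ (l + 1)) _ W)
      · exact (Finset.card_le_card (Finset.monotone_filter_right _ fun i _ h =>
          exactLev_dvd h)).trans (card_class_le (2 ^ (l + 1)) _ H)

theorem gridCount_le_cfWindows [Finite Q] [Finite R] (M : CMachine Q R) (W H : ℕ) :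
    gridCount (Nh M) (Nv M) W H ≤ Nat.card (RVal Q R) ^ H * Nat.card (LVal R) ^ H *
      Nat.card (UVal Q R) ^ W * (cfWindows M W H).ncard := by
  let S := {p : Fin W → Fin H → Tile Q R | ∃ y ∈ GridShift (Nh M) (Nv M),
    ∀ (i : Fin W) (j : Fin H), y (i : ℕ) (j : ℕ) = p i j}
  have hS : ∀ p : S, ∃ y ∈ GridShift (Nh M) (Nv M),
    ∀ (i : Fin W) (j : Fin H), y (i : ℕ) (j : ℕ) = p.1 i j := fun p => p.2
  choose y hy hp using hS
  let f : S → ((Fin H → RVal Q R) × (Fin H → LVal R)) × (Fin W → UVal Q R) × cfWindows M W H :=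
    fun p => ((fun j => (y p 0 (j : ℕ)).r, fun j => (y p W (j : ℕ)).outL),
      fun i => (y p (i : ℕ) 0).u,
      ⟨fun i j => ((y p (i : ℕ) (j : ℕ)).c, (y p (i : ℕ) (j : ℕ)).fr), y p, hy p, fun _ _ => rfl⟩)
  have hf : Function.Injective f := by
    intro p q hpq
    have h1 := congrArg (fun z => z.1.1) hpq
    have h2 := congrArg (fun z => z.1.2) hpq
    have h3 := congrArg (fun z => z.2.1) hpq
    have h4 := congrArg (fun z => z.2.2.1) hpq
    apply Subtype.ext
    funext i j
    rw [← hp p i j, ← hp q i j]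
    refine determined (hy p) (hy q) (fun j hj => congrFun h1 ⟨j, hj⟩)
      (fun j hj => congrFun h2 ⟨j, hj⟩) (fun i hi => congrFun h3 ⟨i, hi⟩)
      (fun i j hi hj => ?_) j j.2 i i.2
    have := congrFun (congrFun h4 ⟨i, hi⟩) ⟨j, hj⟩
    exact Prod.mk.inj this
  have := Nat.card_le_card_of_injective f hf
  simp only [Nat.card_prod, Nat.card_fun, Nat.card_fin] at this
  rw [Nat.card_coe_set_eq] at this
  show S.ncard ≤ _
  rw [← Nat.card_coe_set_eq]
  refine this.trans_eq ?_
  rw [Nat.card_coe_set_eq]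
  ring

open Classical in
theorem le_gridCount [Finite Q] [Finite R] (hM : ∀ r, M.op M.init r = .hold) (W H m : ℕ) :
    2 ^ (∑ l ∈ (Finset.range m).filter (fun l => ¬ M.Checked l),
      (W / 2 ^ (l + 1)) * (H / 2 ^ (l + 1))) ≤ gridCount (Nh M) (Nv M) W H := by
  obtain ⟨t, hs, hc, -, -, -, -, h1, h2⟩ := HConf.exists_ideal M hM
    (fun n => decide (¬ M.Checked n)) (by simp)
  let D := {ij : Fin W × Fin H // HConf.lev (ij.1 : ℕ) = HConf.lev (ij.2 : ℕ) ∧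
    ¬ M.Checked (HConf.lev (ij.1 : ℕ))}
  have key : ∀ g : D → Bool, ∃ y ∈ GridShift (Nh M) (Nv M),
      ∀ d : D, (y (d.1.1 : ℕ) (d.1.2 : ℕ)).fr = g d := by
    intro g
    obtain ⟨y, hy, hfr⟩ := exists_grid hs hc (fun i j => decide (∃ d : D, ((d.1.1 : ℕ) : ℤ) = i ∧
      ((d.1.2 : ℕ) : ℤ) = j ∧ g d = true)) (by
        intro i j h
        obtain ⟨d, rfl, rfl, -⟩ := of_decide_eq_true h
        refine ⟨?_, ?_⟩
        · rw [h1]; exact compare_eq_iff_eq.2 d.2.1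
        · rw [h2]; exact decide_eq_true d.2.2)
    refine ⟨y, hy, fun d => ?_⟩
    rw [hfr]
    cases hd : g d
    · refine decide_eq_false ?_
      rintro ⟨d', h3, h4, h5⟩
      have : d' = d := by
        apply Subtype.ext
        apply Prod.ext
        · exact Fin.ext (by exact_mod_cast h3)
        · exact Fin.ext (by exact_mod_cast h4)
      rw [this, hd] at h5
      simp at h5
    · exact decide_eq_true ⟨d, rfl, rfl, hd⟩
  choose y hy hg using key
  have hcard : 2 ^ Nat.card D ≤ gridCount (Nh M) (Nv M) W H := by
    let S := {p : Fin W → Fin H → Tile Q R | ∃ y ∈ GridShift (Nh M) (Nv M),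
      ∀ (i : Fin W) (j : Fin H), y (i : ℕ) (j : ℕ) = p i j}
    let f : (D → Bool) → S := fun g => ⟨fun i j => y g (i : ℕ) (j : ℕ), y g, hy g, fun _ _ => rfl⟩
    have hf : Function.Injective f := by
      intro g g' h
      funext d
      rw [← hg g d, ← hg g' d]
      exact congrArg Tile.fr (congrFun (congrFun (congrArg Subtype.val h) d.1.1) d.1.2)
    have := Nat.card_le_card_of_injective f hf
    rw [Nat.card_fun, Nat.card_coe_set_eq, Nat.card_eq_fintype_card (α := Bool),
      Fintype.card_bool] at this
    exact this
  refine le_trans (Nat.pow_le_pow_right (by norm_num) ?_) hcard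
  rw [Nat.card_eq_fintype_card, Fintype.card_subtype]
  have hlev : ∀ (l : ℕ) (W : ℕ), W / 2 ^ (l + 1) ≤
      (Finset.univ.filter fun i : Fin W => HConf.lev (i : ℕ) = l).card := by
    intro l W
    refine (le_card_class (2 ^ (l + 1)) (by positivity) (HConf.cen l + 2 ^ l) W).trans
      (Finset.card_le_card (Finset.monotone_filter_right _ fun i _ hi => ?_))
    push_cast at hi
    have h3 := HConf.pow_dvd_iff' (m := l) (j := l) (by omega) (i : ℕ)
    have h4 := HConf.pow_dvd_iff' (m := l + 1) (j := l) (by omega) (i : ℕ)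
    have e : ((i : ℕ) : ℤ) - HConf.cen l = (i : ℕ) - (HConf.cen l + 2 ^ l) + 2 ^ l := by ring
    have h5 := h3.1 (by
      rw [e]; exact dvd_add ((pow_dvd_pow 2 (Nat.le_succ l)).trans hi) dvd_rfl)
    have h6 : ¬ l + 1 ≤ HConf.lev (i : ℕ) := by
      rw [← h4, e, Int.dvd_add_right hi, pow_succ]
      intro h7
      have := Int.le_of_dvd (by positivity) h7
      have : (0 : ℤ) < 2 ^ l := by positivity
      omega
    omega
  calc ∑ l ∈ (Finset.range m).filter (fun l => ¬ M.Checked l),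
      (W / 2 ^ (l + 1)) * (H / 2 ^ (l + 1))
      ≤ ∑ l ∈ (Finset.range m).filter (fun l => ¬ M.Checked l),
        ((Finset.univ.filter fun i : Fin W => HConf.lev (i : ℕ) = l) ×ˢ
          (Finset.univ.filter fun i : Fin H => HConf.lev (i : ℕ) = l)).card := by
        refine Finset.sum_le_sum fun l _ => ?_
        rw [Finset.card_product]
        exact Nat.mul_le_mul (hlev l W) (hlev l H)
    _ = (((Finset.range m).filter (fun l => ¬ M.Checked l)).biUnion fun l =>
        ((Finset.univ.filter fun i : Fin W => HConf.lev (i : ℕ) = l) ×ˢ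
          (Finset.univ.filter fun i : Fin H => HConf.lev (i : ℕ) = l))).card := by
        rw [Finset.card_biUnion]
        intro l _ l' _ hll
        show Disjoint _ _
        rw [Finset.disjoint_left]
        intro ij h3 h4
        simp only [Finset.mem_product, Finset.mem_filter, Finset.mem_univ, true_and] at h3 h4
        exact hll (h3.1.symm.trans h4.1)
    _ ≤ _ := by
        refine Finset.card_le_card fun ij => ?_
        simp only [Finset.mem_biUnion, Finset.mem_product, Finset.mem_filter, Finset.mem_univ,
          true_and]
        rintro ⟨l, ⟨-, h3⟩, h4, h5⟩
        exact ⟨h4.trans h5.symm, h4 ▸ h3⟩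

end Tile

section graph

variable {A : Type*} {E : A → A → Prop}

/-- The first `n` steps of `α` follow edges. -/
def IsWalk (E : A → A → Prop) (n : ℕ) (α : ℕ → A) : Prop := ∀ i < n, E (α i) (α (i + 1))

/-- There is a walk of length `n` from `a` to `b`. -/
def Reach (E : A → A → Prop) (n : ℕ) (a b : A) : Prop := ∃ α, α 0 = a ∧ α n = b ∧ IsWalk E n α

/-- Concatenation of walks. -/
def glue (n : ℕ) (α β : ℕ → A) (i : ℕ) : A := if i ≤ n then α i else β (i - n)

theorem glue_le {n i : ℕ} {α β : ℕ → A} (h : i ≤ n) : glue n α β i = α i := if_pos h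

theorem glue_add {n : ℕ} {α β : ℕ → A} (h : α n = β 0) (i : ℕ) : glue n α β (n + i) = β i := by
  unfold glue
  split_ifs with h1
  · obtain rfl : i = 0 := by omega
    simpa using h
  · rw [Nat.add_sub_cancel_left]

theorem IsWalk.glue {m n : ℕ} {α β : ℕ → A} (hα : IsWalk E m α) (hβ : IsWalk E n β)
    (h : α m = β 0) : IsWalk E (m + n) (glue m α β) := by
  intro i hi
  rcases lt_or_ge i m with h1 | h1
  · rw [glue_le h1.le, glue_le h1]; exact hα i h1
  · obtain ⟨j, rfl⟩ := Nat.exists_eq_add_of_le h1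
    rw [glue_add h, add_assoc, glue_add h]; exact hβ j (by omega)

theorem IsWalk.mono {m n : ℕ} {α : ℕ → A} (hα : IsWalk E n α) (h : m ≤ n) : IsWalk E m α :=
  fun i hi => hα i (by omega)

theorem IsWalk.shift {m n : ℕ} {α : ℕ → A} (hα : IsWalk E (m + n) α) :
    IsWalk E n (fun i => α (m + i)) := fun i hi => hα (m + i) (by omega)

theorem Reach.refl (a : A) : Reach E 0 a a := ⟨fun _ => a, rfl, rfl, fun i hi => by omega⟩

theorem Reach.trans {m n : ℕ} {a b c : A} : Reach E m a b → Reach E n b c → Reach E (m + n) a c := by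
  rintro ⟨α, h1, h2, h3⟩ ⟨β, h4, h5, h6⟩
  have h : α m = β 0 := h2.trans h4.symm
  exact ⟨glue m α β, (glue_le (Nat.zero_le _)).trans h1, (glue_add h n).trans h5, h3.glue h6 h⟩

theorem Reach.split {m n : ℕ} {a b : A} : Reach E (m + n) a b → ∃ c, Reach E m a c ∧ Reach E n c b :=
  fun ⟨α, h1, h2, h3⟩ => ⟨α m, ⟨α, h1, rfl, h3.mono (by omega)⟩, _, by simp, h2, h3.shift⟩

theorem reach_one {a b : A} : Reach E 1 a b ↔ E a b := by
  constructor
  · rintro ⟨α, rfl, rfl, h⟩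
    exact h 0 one_pos
  · intro h
    refine ⟨fun i => if i = 0 then a else b, by simp, by simp, fun i hi => ?_⟩
    obtain rfl : i = 0 := by omega
    simpa using h

theorem Reach.mul {n : ℕ} {a : A} (h : Reach E n a a) (k : ℕ) : Reach E (n * k) a a := by
  induction k with
  | zero => exact Reach.refl a
  | succ k ih => exact ih.trans h

theorem Reach.transGen {n : ℕ} {a b : A} (h : Reach E (n + 1) a b) : Relation.TransGen E a b := by
  induction n generalizing b with
  | zero => exact .single (reach_one.1 h)
  | succ n ih =>
    obtain ⟨c, h1, h2⟩ := h.split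
    exact (ih h1).tail (reach_one.1 h2)

theorem exists_reach {a b : A} (h : Relation.TransGen E a b) : ∃ n, 0 < n ∧ Reach E n a b := by
  induction h with
  | single h => exact ⟨1, one_pos, reach_one.2 h⟩
  | tail _ h ih =>
    obtain ⟨n, _, h1⟩ := ih
    exact ⟨n + 1, by omega, h1.trans (reach_one.2 h)⟩

namespace IsSCC

variable {S : Set A}

theorem mem_of (hS : IsSCC E S) {a c : A} (ha : a ∈ S) (h1 : Relation.TransGen E a c)
    (h2 : Relation.TransGen E c a) : c ∈ S := by
  have := hS.2.2 (insert c S) (Set.subset_insert _ _) (by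
    rintro x (rfl | hx) y (rfl | hy)
    · exact h2.trans h1
    · exact h2.trans (hS.2.1 _ ha _ hy)
    · exact (hS.2.1 _ hx _ ha).trans h1
    · exact hS.2.1 _ hx _ hy)
  rw [← this]
  exact Set.mem_insert _ _

theorem exists_back (hS : IsSCC E S) {a b : A} (ha : a ∈ S) (hb : b ∈ S) :
    ∃ n, 0 < n ∧ Reach E n a b := exists_reach (hS.2.1 a ha b hb)

/-- Walks between vertices of a component stay in it. -/
theorem mem_mid (hS : IsSCC E S) {a b c : A} {m n : ℕ} (ha : a ∈ S) (hb : b ∈ S)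
    (h1 : Reach E m a c) (h2 : Reach E n c b) : c ∈ S := by
  obtain ⟨k, hk, h⟩ := hS.exists_back ha ha
  obtain ⟨l, hl, h'⟩ := hS.exists_back hb ha
  refine hS.mem_of ha ((?_ : Reach E (k + m - 1 + 1) a c).transGen)
    ((?_ : Reach E (n + l - 1 + 1) c a).transGen)
  · rw [Nat.sub_add_cancel (by omega)]; exact h.trans h1
  · rw [Nat.sub_add_cancel (by omega)]; exact h2.trans h'

theorem exists_succ (hS : IsSCC E S) {a : A} (ha : a ∈ S) : ∃ b ∈ S, E a b := by
  obtain ⟨n, hn, h⟩ := hS.exists_back ha ha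
  obtain ⟨n, rfl⟩ := Nat.exists_eq_succ_of_ne_zero hn.ne'
  rw [Nat.succ_eq_add_one, add_comm] at h
  obtain ⟨c, h1, h2⟩ := h.split
  exact ⟨c, hS.mem_mid ha ha h1 h2, reach_one.1 h1⟩

/-- If all walks of some length `d + 2` have shortcut edges, the component is a state-split
cycle. -/
theorem stateSplit_of_forward (hS : IsSCC E S) {d : ℕ}
    (h : ∀ a ∈ S, ∀ b ∈ S, Reach E (d + 2) a b → E a b) : StateSplitType E S := by
  have short : ∀ k, ∀ a ∈ S, ∀ b ∈ S, Reach E (1 + (d + 1) * k) a b → E a b := by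
    intro k
    induction k with
    | zero => exact fun a _ b _ h => reach_one.1 h
    | succ k ih =>
      intro a ha b hb hab
      rw [show 1 + (d + 1) * (k + 1) = (1 + (d + 1) * k) + (d + 1) by ring] at hab
      obtain ⟨c, h1, h2⟩ := hab.split
      have := (reach_one.2 (ih a ha c (hS.mem_mid ha hb h1 h2) h1)).trans h2
      rw [show 1 + (d + 1) = d + 2 by ring] at this
      exact h a ha b hb this
  obtain ⟨a₀, h₀⟩ := hS.1
  let Γ : AddSubgroup ℤ :=
    { carrier := {z | ∃ i j : ℕ, Reach E i a₀ a₀ ∧ Reach E j a₀ a₀ ∧ z = i - j}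
      zero_mem' := ⟨0, 0, .refl _, .refl _, by simp⟩
      add_mem' := by
        rintro _ _ ⟨i, j, h1, h2, rfl⟩ ⟨i', j', h3, h4, rfl⟩
        exact ⟨i + i', j + j', h1.trans h3, h2.trans h4, by push_cast; ring⟩
      neg_mem' := by
        rintro _ ⟨i, j, h1, h2, rfl⟩
        exact ⟨j, i, h2, h1, by ring⟩ }
  obtain ⟨g, hg⟩ := Int.subgroup_cyclic Γ
  have memΓ : ∀ z : ℤ, (∃ i j : ℕ, Reach E i a₀ a₀ ∧ Reach E j a₀ a₀ ∧ z = (i : ℤ) - j) ↔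
      (z : ZMod g.natAbs) = 0 := by
    intro z
    rw [ZMod.intCast_zmod_eq_zero_iff_dvd, Int.natAbs_dvd, ← Int.mem_zmultiples_iff,
      AddSubgroup.zmultiples_eq_closure, ← hg]
    rfl
  have hpos : 0 < g.natAbs := by
    obtain ⟨n, hn, h1⟩ := hS.exists_back h₀ h₀
    rw [Nat.pos_iff_ne_zero]
    intro h2
    have := (memΓ n).1 ⟨n, 0, h1, .refl _, by simp⟩
    rw [h2, ZMod.intCast_zmod_eq_zero_iff_dvd] at this
    rw [Nat.cast_zero, zero_dvd_iff] at this
    omega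
  have hex : ∀ v, ∃ n, v ∈ S → Reach E n a₀ v := by
    intro v
    by_cases hv : v ∈ S
    · obtain ⟨n, -, hn⟩ := hS.exists_back h₀ hv
      exact ⟨n, fun _ => hn⟩
    · exact ⟨0, fun h => absurd h hv⟩
  choose len hlen using hex
  have wd : ∀ v ∈ S, ∀ n, Reach E n a₀ v → (len v : ZMod g.natAbs) = n := by
    intro v hv n hn
    obtain ⟨r, -, hr⟩ := hS.exists_back hv h₀
    have := (memΓ ((len v : ℤ) - n)).1 ⟨len v + r, n + r, (hlen v hv).trans hr, hn.trans hr, by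
      push_cast; ring⟩
    push_cast at this
    exact sub_eq_zero.1 this
  refine ⟨g.natAbs, hpos, fun v => (len v : ZMod g.natAbs), fun i => ?_, fun v hv w hw =>
    ⟨fun hvw => ?_, fun hvw => ?_⟩⟩
  · have hk : ∀ k, ∃ v ∈ S, Reach E k a₀ v := by
      intro k
      induction k with
      | zero => exact ⟨a₀, h₀, .refl _⟩
      | succ k ih =>
        obtain ⟨v, hv, h1⟩ := ih
        obtain ⟨w, hw, h2⟩ := hS.exists_succ hv
        exact ⟨w, hw, h1.trans (reach_one.2 h2)⟩
    have : NeZero g.natAbs := ⟨hpos.ne'⟩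
    obtain ⟨v, hv, h1⟩ := hk i.val
    exact ⟨v, hv, (wd v hv _ h1).trans (ZMod.natCast_zmod_val i)⟩
  · have := wd w hw _ ((hlen v hv).trans (reach_one.2 hvw))
    push_cast at this
    exact this
  · obtain ⟨x, -, hx⟩ := hS.exists_back hv h₀
    have h1 : ((x + len w - 1 : ℤ) : ZMod g.natAbs) = 0 := by
      have := (memΓ ((len v : ℤ) + x)).1 ⟨len v + x, 0, (hlen v hv).trans hx, .refl _, by simp⟩
      push_cast at this ⊢
      change (len w : ZMod g.natAbs) = len v + 1 at hvw
      rw [hvw, ← this]; ring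
    obtain ⟨i, j, hi, hj, hij⟩ := (memΓ _).2 h1
    refine short i v hv w hw ?_
    have := ((hx.trans hj).trans (hi.mul d)).trans (hlen w hw)
    convert this using 1
    zify
    linear_combination -hij

/-- If all walks of some length `e + 2` have reverse edges, the component is a state-split
cycle. -/
theorem stateSplit_of_backward (hS : IsSCC E S) {e : ℕ}
    (h : ∀ a ∈ S, ∀ b ∈ S, Reach E (e + 2) b a → E a b) : StateSplitType E S := by
  have rev : ∀ k, ∀ a ∈ S, ∀ b ∈ S, Reach E ((e + 2) * k) a b → Reach E k b a := by
    intro k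
    induction k with
    | zero =>
      rintro a _ b _ ⟨α, rfl, rfl, _⟩
      exact .refl _
    | succ k ih =>
      intro a ha b hb hab
      rw [mul_add, mul_one, add_comm] at hab
      obtain ⟨c, h1, h2⟩ := hab.split
      have hc := hS.mem_mid ha hb h1 h2
      exact (ih c hc b hb h2).trans (reach_one.2 (h c hc a ha h1))
  refine hS.stateSplit_of_forward (d := (e + 2) * (e + 2) - 2) fun a ha b hb hab => ?_
  rw [Nat.sub_add_cancel (by nlinarith)] at hab
  exact h a ha b hb (rev _ a ha b hb hab)

end IsSCC

/-- Closed walks parametrised by `ℤ/p`. -/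
def cycles (E : A → A → Prop) (p : ℕ) : Set (ZMod p → A) := {w | ∀ i, E (w i) (w (i + 1))}

theorem cycles_shift {p : ℕ} {w : ZMod p → A} (hw : w ∈ cycles E p) (r : ZMod p) :
    (fun i => w (i + r)) ∈ cycles E p := fun i => by
  show E (w (i + r)) (w (i + 1 + r))
  rw [add_right_comm]; exact hw _

theorem cycle_of_walk {p : ℕ} [NeZero p] {α : ℕ → A} (h : IsWalk E p α) (h0 : α p = α 0) :
    (fun i : ZMod p => α i.val) ∈ cycles E p := by
  intro i
  show E (α i.val) (α (i + 1).val)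
  have hi := ZMod.val_lt i
  have h1 := h i.val hi
  have h2 : (i + 1).val = (i.val + 1) % p := by
    conv_lhs => rw [← ZMod.natCast_zmod_val i]
    rw [← ZMod.val_natCast]; push_cast; rfl
  rcases eq_or_lt_of_le (Nat.succ_le_of_lt hi) with h3 | h3
  · rw [Nat.succ_eq_add_one] at h3
    rw [h2, h3, Nat.mod_self, ← h0]
    rwa [h3] at h1
  · rwa [h2, Nat.mod_eq_of_lt h3]

/-- Uniform closing of walks inside components. -/
theorem exists_closing [Finite A] (E : A → A → Prop) : ∃ L C : ℕ, 0 < L ∧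
    ∀ S, IsSCC E S → ∀ a ∈ S, Reach E L a a ∧ ∀ b ∈ S, ∀ n, Reach E n a b →
      ∀ p, L ∣ p → n + C ≤ p → Reach E (p - n) b a := by
  have := Fintype.ofFinite A
  have h1 : ∀ v, ∃ l, 0 < l ∧ (Relation.TransGen E v v → Reach E l v v) := by
    intro v
    by_cases h : Relation.TransGen E v v
    · obtain ⟨l, hl, h1⟩ := exists_reach h
      exact ⟨l, hl, fun _ => h1⟩
    · exact ⟨1, one_pos, fun h' => absurd h' h⟩
  choose l hl hl' using h1
  have hL : 0 < ∏ v, l v := Finset.prod_pos fun v _ => hl v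
  have hloop : ∀ v, Relation.TransGen E v v → Reach E (∏ v, l v) v v := fun v hv => by
    obtain ⟨k, hk⟩ := Finset.dvd_prod_of_mem l (Finset.mem_univ v)
    rw [hk]; exact (hl' v hv).mul k
  set L := ∏ v, l v
  have h2 : ∀ (a b : A) (r : Fin L), ∃ m, ∀ n, n % L = r → Reach E n a b →
      Relation.TransGen E b a → Reach E m b a ∧ L ∣ n + m := by
    intro a b r
    by_cases h : ∃ n, n % L = r ∧ Reach E n a b ∧ Relation.TransGen E b a
    · obtain ⟨n, hn, h3, h4⟩ := h
      obtain ⟨m, hm, h5⟩ := exists_reach h4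
      have key : Reach E (m + (n + m) * (L - 1)) b a := h5.trans ((h3.trans h5).mul _)
      refine ⟨m + (n + m) * (L - 1), fun n' hn' _ _ => ⟨key, ?_⟩⟩
      have h6 : n + (m + (n + m) * (L - 1)) = L * (n + m) := by
        obtain ⟨L', hL'⟩ := Nat.exists_eq_succ_of_ne_zero hL.ne'
        rw [hL', Nat.succ_eq_add_one, Nat.add_sub_cancel]; ring
      have h7 : n' ≡ n [MOD L] := hn'.trans hn.symm
      exact (Nat.modEq_zero_iff_dvd).1 ((h7.add_right _).trans
        (Nat.modEq_zero_iff_dvd.2 ⟨_, h6⟩))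
    · exact ⟨0, fun n h3 h4 h5 => absurd ⟨n, h3, h4, h5⟩ h⟩
  choose m hm using h2
  refine ⟨L, ∑ a, ∑ b, ∑ r, m a b r, hL, fun S hS a ha => ⟨hloop a (hS.2.1 a ha a ha),
    fun b hb n hn p hp hnp => ?_⟩⟩
  obtain ⟨h3, h4⟩ := hm a b ⟨n % L, Nat.mod_lt _ hL⟩ n rfl hn (hS.2.1 b hb a ha)
  set q := m a b ⟨n % L, Nat.mod_lt _ hL⟩ with hq
  have h5 : q ≤ ∑ a, ∑ b, ∑ r, m a b r :=
    ((Finset.single_le_sum (f := fun r => m a b r) (fun _ _ => Nat.zero_le _)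
      (Finset.mem_univ _)).trans (Finset.single_le_sum (f := fun b => ∑ r, m a b r)
      (fun _ _ => Nat.zero_le _) (Finset.mem_univ b))).trans
      (Finset.single_le_sum (f := fun a => ∑ b, ∑ r, m a b r)
      (fun _ _ => Nat.zero_le _) (Finset.mem_univ a))
  obtain ⟨k, hk⟩ := (Nat.dvd_sub hp h4)
  have := h3.trans ((hloop a (hS.2.1 a ha a ha)).mul k)
  rw [← hk, show q + (p - (n + q)) = p - n by omega] at this
  exact this

end graph

section graph

variable {A : Type*} {E : A → A → Prop}

theorem Reach.of_walk {n : ℕ} {α : ℕ → A} (h : IsWalk E n α) {i : ℕ} (hi : i ≤ n) :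
    Reach E i (α 0) (α i) ∧ Reach E (n - i) (α i) (α n) := by
  obtain ⟨m, rfl⟩ := Nat.exists_eq_add_of_le hi
  refine ⟨⟨α, rfl, rfl, h.mono hi⟩, ⟨fun j => α (i + j), rfl, ?_, ?_⟩⟩ <;>
    rw [Nat.add_sub_cancel_left]
  exact h.shift

/-- A walk whose ends are joined by a second walk lies on a cycle. -/
theorem cycle_of_glue {p n : ℕ} [NeZero p] (hn : n ≤ p) {α γ : ℕ → A} (hα : IsWalk E n α)
    (hγ : IsWalk E (p - n) γ) (h1 : α n = γ 0) (h2 : γ (p - n) = α 0) :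
    (fun i : ZMod p => glue n α γ i.val) ∈ cycles E p := by
  apply cycle_of_walk
  · have := hα.glue hγ h1
    rwa [Nat.add_sub_cancel' hn] at this
  · rw [glue_le (Nat.zero_le n), ← h2, ← glue_add h1 (p - n), Nat.add_sub_cancel' hn]

theorem exists_cycle {p n : ℕ} [NeZero p] (hn : n < p) {a b : A} (h : Reach E n a b)
    (h' : Reach E (p - n) b a) : ∃ w ∈ cycles E p, w 0 = a ∧ w (n : ZMod p) = b := by
  obtain ⟨α, h1, h2, h3⟩ := h
  obtain ⟨γ, h4, h5, h6⟩ := h'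
  refine ⟨_, cycle_of_glue hn.le h3 h6 (h2.trans h4.symm) (h5.trans h1.symm), ?_, ?_⟩
  · show glue n α γ (0 : ZMod p).val = a
    rw [ZMod.val_zero, glue_le (Nat.zero_le n), h1]
  · show glue n α γ (n : ZMod p).val = b
    rw [ZMod.val_natCast_of_lt hn, glue_le le_rfl, h2]

/-- If condition D fails, long cycles determine the direction of time. -/
theorem detection [Finite A] (hD : ¬ ConditionD E) {L C : ℕ}
    (hLC : ∀ S, IsSCC E S → ∀ a ∈ S, Reach E L a a ∧ ∀ b ∈ S, ∀ n, Reach E n a b →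
      ∀ p, L ∣ p → n + C ≤ p → Reach E (p - n) b a) {p : ℕ} (hp : L ∣ p) (hpC : 2 * C + 2 < p)
    (r r' : ZMod p) (h : ∀ w ∈ cycles E p, E (w r) (w r')) : r' = r + 1 := by
  have : NeZero p := ⟨by omega⟩
  have key : ∀ S, IsSCC E S → ∀ a ∈ S, ∀ b ∈ S, ∀ n, n < p → n + C ≤ p → Reach E n a b →
      (∀ x, r' = r + n → x = (n : ZMod p) → E a b) ∧ (r = r' + n → E b a) := by
    intro S hS a ha b hb n hn hnC hab
    obtain ⟨w, hw, h1, h2⟩ := exists_cycle hn hab ((hLC S hS a ha).2 b hb n hab p hp hnC)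
    refine ⟨fun x hr _ => ?_, fun hr => ?_⟩
    · have := h _ (cycles_shift hw (-r))
      subst hr
      simpa [h1, h2] using this
    · have := h _ (cycles_shift hw (-r'))
      subst hr
      simpa [h1, h2] using this
  unfold ConditionD at hD
  push Not at hD
  obtain ⟨⟨S₁, hS₁, hr⟩, ⟨S₂, hS₂, hs⟩, ⟨S₃, hS₃, ht⟩⟩ := hD
  unfold ReflexiveType at hr
  unfold SymmetricType at hs
  push Not at hr hs
  obtain ⟨v, hv, hvv⟩ := hr
  obtain ⟨x, hx, y, hy, hxy, hxy1, hxy2⟩ := hs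
  set d := (r' - r).val with hd
  have hdp : d < p := ZMod.val_lt _
  have hrd : r' = r + (d : ZMod p) := by
    rw [hd, ZMod.natCast_zmod_val]; ring
  have hre : r = r' + ((p - d : ℕ) : ZMod p) := by
    rw [Nat.cast_sub hdp.le, ZMod.natCast_self, hrd]; ring
  rcases Nat.eq_zero_or_pos d with h0 | h0
  · exact absurd ((key S₁ hS₁ v hv v hv 0 (by omega) (by omega) (.refl v)).1 0
      (by rw [hrd, h0]) (by simp)) hvv
  rcases eq_or_lt_of_le (Nat.succ_le_of_lt h0) with h1 | h1
  · rw [hrd, ← h1]; simp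
  rcases le_or_gt (d + C) p with h2 | h2
  · refine absurd (hS₃.stateSplit_of_forward (d := d - 2) fun a ha b hb hab => ?_) ht
    rw [Nat.sub_add_cancel h1] at hab
    exact (key S₃ hS₃ a ha b hb d hdp h2 hab).1 _ hrd rfl
  rcases eq_or_lt_of_le (show 1 ≤ p - d by omega) with h3 | h3
  · rw [← h3] at hre
    exact absurd ((key S₂ hS₂ x hx y hy 1 (by omega) (by omega) (reach_one.2 hxy1)).2 hre) hxy2
  · refine absurd (hS₃.stateSplit_of_backward (e := p - d - 2) fun a ha b hb hab => ?_) ht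
    rw [Nat.sub_add_cancel h3] at hab
    exact (key S₃ hS₃ b hb a ha (p - d) (by omega) (by omega) hab).2 hre

/-- Two walks with the same ends in a component, such that no two consecutive interior steps can
be exchanged between them. -/
theorem exists_channel {S : Set A} (hS : IsSCC E S) (ht : ¬ StateSplitType E S) {L : ℕ}
    (hL : 0 < L) (hloop : ∀ a ∈ S, Reach E L a a) :
    ∃ ℓ, 2 ≤ ℓ ∧ ∃ α β : ℕ → A, IsWalk E (ℓ + 1) α ∧ IsWalk E (ℓ + 1) β ∧ α 0 = β 0 ∧
      α (ℓ + 1) = β (ℓ + 1) ∧ α 0 ∈ S ∧ α (ℓ + 1) ∈ S ∧ (∀ i, 1 ≤ i → i ≤ ℓ → α i ≠ β i) ∧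
      ∀ i, 1 ≤ i → i < ℓ → ¬ (E (α i) (β (i + 1)) ∧ E (β i) (α (i + 1))) := by
  classical
  have hex : ∃ n, ∃ α β : ℕ → A, IsWalk E n α ∧ IsWalk E n β ∧ α 0 = β 0 ∧ α n = β n ∧
      α 0 ∈ S ∧ α n ∈ S ∧ ∃ i < n, ¬ (E (α i) (β (i + 1)) ∧ E (β i) (α (i + 1))) := by
    have h1 : ∃ a ∈ S, ∃ b ∈ S, Reach E (L + 1) a b ∧ ¬ E a b := by
      by_contra! h
      refine ht (hS.stateSplit_of_forward (d := L - 1) fun a ha b hb hab => h a ha b hb ?_)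
      rwa [show L - 1 + 2 = L + 1 by omega] at hab
    obtain ⟨a, ha, b, hb, ⟨x, hx0, hx1, hx⟩, hab⟩ := h1
    obtain ⟨u, hu0, hu1, hu⟩ := hloop a ha
    obtain ⟨v, hv0, hv1, hv⟩ := hloop b hb
    have e1 : u L = x 0 := hu1.trans hx0.symm
    have e2 : x (L + 1) = v 0 := hx1.trans hv0.symm
    have w2 := hx.glue hv e2
    rw [show L + 1 + L = L + (L + 1) by ring] at w2
    have e3 := glue_add e2 L
    rw [show L + 1 + L = L + (L + 1) by ring] at e3
    refine ⟨L + (L + 1), glue L u x, glue (L + 1) x v, hu.glue hx e1, w2, ?_, ?_, ?_, ?_, L,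
      by omega, fun h => hab ?_⟩
    · rw [glue_le (Nat.zero_le _), glue_le (Nat.zero_le _), hu0, hx0]
    · rw [glue_add e1, e3, hx1, hv1]
    · rwa [glue_le (Nat.zero_le _), hu0]
    · rwa [glue_add e1, hx1]
    · have := h.1
      rwa [glue_le le_rfl, glue_le le_rfl, hu1, hx1] at this
  obtain ⟨α, β, hα, hβ, h0, hn, hS0, hSn, i₀, hi₀, hnc⟩ := Nat.find_spec hex
  have hmin := fun m (hm : m < Nat.find hex) => Nat.find_min hex hm
  generalize Nat.find hex = n at *
  have ne : ∀ i < n, ¬ (E (α i) (β (i + 1)) ∧ E (β i) (α (i + 1))) →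
      α i ≠ β i ∧ α (i + 1) ≠ β (i + 1) := by
    intro i hi h
    constructor
    · intro e; rw [e] at h; exact h ⟨hβ i hi, e ▸ hα i hi⟩
    · intro e; rw [e] at h; exact h ⟨e ▸ hα i hi, hβ i hi⟩
  have hi1 : 1 ≤ i₀ := by
    rw [Nat.one_le_iff_ne_zero]; rintro rfl; exact (ne 0 hi₀ hnc).1 h0
  have hi2 : i₀ + 1 < n := by
    refine lt_of_le_of_ne hi₀ fun e => (ne _ hi₀ hnc).2 (e ▸ hn)
  have memS : ∀ i ≤ n, α i ∈ S := fun i hi =>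
    hS.mem_mid hS0 hSn (Reach.of_walk hα hi).1 (Reach.of_walk hα hi).2
  have all : ∀ i, 1 ≤ i → i + 1 < n → ¬ (E (α i) (β (i + 1)) ∧ E (β i) (α (i + 1))) := by
    intro i h1 h2 hc
    rcases lt_trichotomy i i₀ with h | rfl | h
    · refine hmin (n - i) (by omega) ⟨fun j => α (i + j), fun j => if j = 0 then α i else β (i + j),
        ?_, ?_, by simp, ?_, memS _ (by omega), ?_, i₀ - i, by omega, ?_⟩
      · intro j hj; exact hα (i + j) (by omega)
      · intro j hj
        rcases Nat.eq_zero_or_pos j with rfl | hj0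
        · simpa using hc.1
        · simpa [hj0.ne', add_assoc] using hβ (i + j) (by omega)
      · show α (i + (n - i)) = if n - i = 0 then α i else β (i + (n - i))
        rw [if_neg (by omega), Nat.add_sub_cancel' (by omega), hn]
      · show α (i + (n - i)) ∈ S
        rwa [Nat.add_sub_cancel' (by omega)]
      · simpa [show i + (i₀ - i) = i₀ by omega, show ¬ i₀ - i = 0 by omega,
          show i + (i₀ - i + 1) = i₀ + 1 by omega] using hnc
    · exact hnc hc
    · refine hmin (i + 1) h2 ⟨α, fun j => if j ≤ i then β j else α j,
        hα.mono h2.le, ?_, by simpa using h0, by simp, hS0, memS _ h2.le, i₀, by omega, ?_⟩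
      · intro j hj
        rcases eq_or_lt_of_le (Nat.le_of_lt_succ hj) with rfl | hj0
        · simpa using hc.2
        · simpa [hj0.le, Nat.succ_le_of_lt hj0] using hβ j (by omega)
      · simpa [h.le, Nat.succ_le_of_lt h] using hnc
  obtain ⟨ℓ, rfl⟩ : ∃ ℓ, n = ℓ + 1 := ⟨n - 1, by omega⟩
  refine ⟨ℓ, by omega, α, β, hα, hβ, h0, hn, hS0, hSn, fun i h1 h2 => ?_,
    fun i h1 h2 => all i h1 (by omega)⟩
  rcases eq_or_lt_of_le h2 with rfl | h2
  · obtain ⟨i, rfl⟩ := Nat.exists_eq_add_of_le' h1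
    exact (ne i (by omega) (all i (by omega) (by omega))).2
  · exact (ne i (by omega) (all i h1 (by omega))).1

/-- If condition D fails, there are cycles of a common length which determine the direction of
time, among which two form a non-exchangeable pair. -/
theorem exists_gadget [Finite A] (hD : ¬ ConditionD E) : ∃ p ℓ : ℕ, 2 ≤ ℓ ∧ ℓ < p ∧
    (∀ r r' : ZMod p, (∀ w ∈ cycles E p, E (w r) (w r')) → r' = r + 1) ∧
    ∃ α ∈ cycles E p, ∃ β ∈ cycles E p,
      (∀ i : ZMod p, i.val = 0 ∨ ℓ < i.val → α i = β i) ∧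
      (∀ i : ZMod p, 1 ≤ i.val → i.val ≤ ℓ → α i ≠ β i) ∧
      ∀ i : ZMod p, 1 ≤ i.val → i.val < ℓ →
        ¬ (E (α i) (β (i + 1)) ∧ E (β i) (α (i + 1))) := by
  obtain ⟨L, C, hL, hLC⟩ := exists_closing E
  have hD' := hD
  unfold ConditionD at hD'
  push Not at hD'
  obtain ⟨-, -, ⟨S, hS, ht⟩⟩ := hD'
  obtain ⟨ℓ, hℓ, α, β, hα, hβ, h0, h1, hS0, hS1, hne, hnc⟩ :=
    exists_channel hS ht hL fun a ha => (hLC S hS a ha).1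
  set p := L * (2 * C + ℓ + 3) with hp
  have hpp : 2 * C + ℓ + 3 ≤ p := Nat.le_mul_of_pos_left _ hL
  have : NeZero p := ⟨by omega⟩
  obtain ⟨γ, hγ0, hγ1, hγ⟩ := (hLC S hS _ hS0).2 _ hS1 _ (Reach.of_walk hα le_rfl).1 p ⟨_, hp⟩
    (by omega)
  have hval : ∀ i : ZMod p, i.val ≤ ℓ → (i + 1).val = i.val + 1 := by
    intro i hi
    have : Fact (1 < p) := ⟨by omega⟩
    rw [ZMod.val_add_of_lt, ZMod.val_one]
    rw [ZMod.val_one]; omega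
  refine ⟨p, ℓ, hℓ, by omega, fun r r' h => detection hD hLC ⟨_, hp⟩ (by omega) r r' h, _,
    cycle_of_glue (by omega) hα hγ hγ0.symm hγ1, _,
    cycle_of_glue (by omega) hβ hγ (hγ0.trans h1).symm (hγ1.trans h0), ?_, ?_, ?_⟩
  · intro i hi
    show glue _ α γ i.val = glue _ β γ i.val
    unfold glue
    split_ifs with h2
    · rcases hi with hi | hi
      · rw [hi, h0]
      · rw [show i.val = ℓ + 1 by omega, h1]
    · rfl
  · intro i hi1 hi2
    show glue _ α γ i.val ≠ glue _ β γ i.val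
    rw [glue_le (by omega), glue_le (by omega)]
    exact hne _ hi1 hi2
  · intro i hi1 hi2
    show ¬ (E (glue _ α γ i.val) (glue _ β γ (i + 1).val) ∧
      E (glue _ β γ i.val) (glue _ α γ (i + 1).val))
    rw [hval i hi2.le, glue_le (by omega), glue_le (by omega), glue_le (by omega),
      glue_le (by omega)]
    exact hnc _ hi1 hi2

end graph

section sync

variable {A : Type*} {E : A → A → Prop}

/-- The colouring of the synchronising rows: a zone of period `N`, a zone of period `N + 1`, and
a zone in which every cycle is followed by its shift. -/
def syncRow {p : ℕ} (e : ℕ → ZMod p → A) (N l k : ℕ) : ZMod p → A :=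
  if k < l then e (k % N) else if k < 2 * l then e ((k - l) % (N + 1) % N) else
    fun i => e ((k - 2 * l) / (N * (N + 1)) / 2) (i + ((k - 2 * l) / (N * (N + 1)) % 2 : ℕ))

variable {p : ℕ} {e : ℕ → ZMod p → A} {N l : ℕ}

theorem syncRow_pair (he : 0 < N) {δ : ℕ} (h1 : N * (N + 1) ≤ δ) (h2 : δ + N * (N + 1) ≤ 2 * l)
    {a b : ℕ} (ha : a < N) (hb : b < N) :
    ∃ k, k < l ∧ l ≤ k + δ ∧ k + δ < 2 * l ∧ syncRow e N l k = e a ∧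
      syncRow e N l (k + δ) = e b := by
  obtain ⟨k₀, hk0, hk1, hk2⟩ : ∃ k₀, l ≤ k₀ + δ ∧ k₀ + N * (N + 1) ≤ l ∧
      k₀ + δ + N * (N + 1) ≤ 2 * l := by
    rcases le_or_gt δ l with h | h
    · exact ⟨l - δ, by omega, by omega, by omega⟩
    · exact ⟨0, by omega, by omega, by omega⟩
  obtain ⟨u, hu⟩ := Nat.exists_eq_add_of_le hk0
  obtain ⟨M, rfl⟩ := Nat.exists_eq_succ_of_ne_zero he.ne'
  rw [Nat.succ_eq_add_one] at *
  have hco : Nat.Coprime (M + 1) (M + 1 + 1) := by simp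
  set t := (Nat.chineseRemainder hco (a + M * k₀) (b + (M + 1) * u) : ℕ) with ht
  have h3 : t < (M + 1) * (M + 1 + 1) :=
    Nat.chineseRemainder_lt_mul hco _ _ (by omega) (by omega)
  have h4 : t ≡ a + M * k₀ [MOD M + 1] := (Nat.chineseRemainder hco _ _).2.1
  have h5 : t ≡ b + (M + 1) * u [MOD M + 1 + 1] := (Nat.chineseRemainder hco _ _).2.2
  refine ⟨k₀ + t, by omega, by omega, by omega, ?_, ?_⟩
  · have h6 : (k₀ + t) % (M + 1) = a := by
      have : k₀ + t ≡ a [MOD M + 1] := by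
        refine (h4.add_left k₀).trans ?_
        rw [show k₀ + (a + M * k₀) = a + (M + 1) * k₀ by ring]
        simp [Nat.ModEq]
      rw [Nat.ModEq, Nat.mod_eq_of_lt ha] at this
      exact this
    rw [syncRow, if_pos (by omega), h6]
  · have h6 : (u + t) % (M + 1 + 1) = b := by
      have : u + t ≡ b [MOD M + 1 + 1] := by
        refine (h5.add_left u).trans ?_
        rw [show u + (b + (M + 1) * u) = b + (M + 1 + 1) * u by ring]
        simp [Nat.ModEq]
      rw [Nat.ModEq, Nat.mod_eq_of_lt (by omega : b < M + 1 + 1)] at this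
      exact this
    rw [syncRow, if_neg (by omega), if_pos (by omega),
      show k₀ + t + δ - l = u + t by omega, h6, Nat.mod_eq_of_lt hb]

theorem syncRow_first {m u : ℕ} (hu : u < N * (N + 1)) :
    syncRow e N l (2 * l + (2 * (N * (N + 1)) * m + u)) = e m := by
  rw [syncRow, if_neg (by omega), if_neg (by omega), Nat.add_sub_cancel_left,
    show 2 * (N * (N + 1)) * m + u = u + N * (N + 1) * (2 * m) by ring,
    Nat.add_mul_div_left _ _ (by omega), Nat.div_eq_of_lt hu]
  funext i
  simp

theorem syncRow_second {m u : ℕ} (hu : u < N * (N + 1)) :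
    syncRow e N l (2 * l + (2 * (N * (N + 1)) * m + (N * (N + 1) + u))) =
      fun i => e m (i + 1) := by
  rw [syncRow, if_neg (by omega), if_neg (by omega), Nat.add_sub_cancel_left,
    show 2 * (N * (N + 1)) * m + (N * (N + 1) + u) = u + N * (N + 1) * (1 + 2 * m) by ring,
    Nat.add_mul_div_left _ _ (by omega), Nat.div_eq_of_lt hu]
  funext i
  rw [show (0 + (1 + 2 * m)) / 2 = m by omega, show (0 + (1 + 2 * m)) % 2 = 1 by omega]
  simp

/-- Rows with the property that the vertical offset and the horizontal phase of a column
determine those of the next column. -/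
theorem exists_sync [Finite A] (hp : 1 < p)
    (hdet : ∀ r r' : ZMod p, (∀ w ∈ cycles E p, E (w r) (w r')) → r' = r + 1) (d : ℕ) :
    ∃ s, ∃ c : ℕ → ZMod p → A, (∀ k, c k ∈ cycles E p) ∧ ∀ δ < s + d, ∀ r r' : ZMod p,
      (∀ k < s, ∀ k' < s, k' = k + δ ∨ k' + (s + d) = k + δ → E (c k r) (c k' r')) →
      δ = 0 ∧ r' = r + 1 := by
  have : NeZero p := ⟨by omega⟩
  have hone : (1 : ZMod p) ≠ 0 := by
    have : Fact (1 < p) := ⟨hp⟩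
    exact one_ne_zero
  have hbad : ∀ r r' : ZMod p, ¬ ∀ w ∈ cycles E p, ∀ w' ∈ cycles E p, E (w r) (w' r') := by
    intro r r' h
    have := hdet r r fun w hw => by
      have := h w hw _ (cycles_shift hw (r - r'))
      simpa using this
    exact hone (by simpa using this)
  obtain ⟨N, e, hN, heP, hes⟩ : ∃ (N : ℕ) (e : ℕ → ZMod p → A), 0 < N ∧
      (∀ k, e k ∈ cycles E p) ∧ ∀ w ∈ cycles E p, ∃ m < N, e m = w := by
    obtain ⟨N, ⟨f⟩⟩ := Finite.exists_equiv_fin (cycles E p)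
    have hne : 0 < N := by
      rw [Nat.pos_iff_ne_zero]
      rintro rfl
      exact hbad 0 0 fun w hw => (f ⟨w, hw⟩).elim0
    refine ⟨N, fun k => f.symm ⟨k % N, Nat.mod_lt _ hne⟩, hne, fun k => Subtype.coe_prop _,
      fun w hw => ⟨f ⟨w, hw⟩, Fin.is_lt _, ?_⟩⟩
    simp [Nat.mod_eq_of_lt (Fin.is_lt _)]
  set K := N * (N + 1) with hK
  have hKpos : 0 < K := by positivity
  set l := 2 * (K * N) + d + 2 * K with hl
  set s := 2 * l + 2 * (K * N) with hs
  have hrow : ∀ m < N, 2 * K * m + 2 * K ≤ 2 * (K * N) := fun m hm => by nlinarith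
  refine ⟨s, syncRow e N l, fun k => ?_, fun δ hδ r r' h => ?_⟩
  · unfold syncRow
    split_ifs
    · exact heP _
    · exact heP _
    · exact cycles_shift (heP _) _
  have hsame : δ < K → r' = r + 1 := by
    intro h1
    refine hdet r r' fun w hw => ?_
    obtain ⟨m, hm, rfl⟩ := hes w hw
    have := hrow m hm
    have := h (2 * l + (2 * K * m + 0)) (by omega) (2 * l + (2 * K * m + δ)) (by omega)
      (Or.inl (by omega))
    rwa [syncRow_first hKpos, syncRow_first h1] at this
  rcases Nat.eq_zero_or_pos δ with h0 | h0
  · exact ⟨h0, hsame (by omega)⟩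
  exfalso
  rcases lt_or_ge δ K with h1 | h1
  · have h2 := hsame h1
    have h3 : r' + 1 = r + 1 := hdet _ _ fun w hw => by
      obtain ⟨m, hm, rfl⟩ := hes w hw
      have := hrow m hm
      have := h (2 * l + (2 * K * m + (K - 1))) (by omega)
        (2 * l + (2 * K * m + (K + (δ - 1)))) (by omega) (Or.inl (by omega))
      rwa [syncRow_first (by omega), syncRow_second (by omega)] at this
    rw [h2] at h3
    exact hone (by simpa using h3)
  rcases le_or_gt (δ + K) (2 * l) with h2 | h2
  · refine hbad r r' fun w hw w' hw' => ?_
    obtain ⟨a, ha, rfl⟩ := hes w hw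
    obtain ⟨b, hb, rfl⟩ := hes w' hw'
    obtain ⟨k, hk1, hk2, hk3, hk4, hk5⟩ := syncRow_pair (e := e) hN h1 h2 ha hb
    have := h k (by omega) (k + δ) (by omega) (Or.inl rfl)
    rwa [hk4, hk5] at this
  obtain ⟨ε, hε⟩ := Nat.exists_eq_add_of_lt hδ
  rcases le_or_gt K (ε + 1) with h3 | h3
  · refine hbad r r' fun w hw w' hw' => ?_
    obtain ⟨a, ha, rfl⟩ := hes w hw
    obtain ⟨b, hb, rfl⟩ := hes w' hw'
    obtain ⟨k, hk1, hk2, hk3, hk4, hk5⟩ := syncRow_pair (e := e) (l := l) hN h3 (by omega) hb ha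
    have := h (k + (ε + 1)) (by omega) k (by omega) (Or.inr (by omega))
    rwa [hk4, hk5] at this
  · have h4 : r' = r + 1 := hdet r r' fun w hw => by
      obtain ⟨m, hm, rfl⟩ := hes w hw
      have := hrow m hm
      have := h (2 * l + (2 * K * m + (ε + 1))) (by omega) (2 * l + (2 * K * m + 0)) (by omega)
        (Or.inr (by omega))
      rwa [syncRow_first hKpos, syncRow_first h3] at this
    have h5 : r' = (r + 1) + 1 := hdet _ _ fun w hw => by
      obtain ⟨m, hm, rfl⟩ := hes w hw
      have := hrow m hm
      have := h (2 * l + (2 * K * m + (K + 0))) (by omega)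
        (2 * l + (2 * K * m + (K - (ε + 1)))) (by omega) (Or.inr (by omega))
      rwa [syncRow_second (by omega), syncRow_first (by omega)] at this
    rw [h4] at h5
    exact hone (by simpa using h5)

end sync

section simulation

/-- The data of a simulation of tilings over `T` by columns: cycles `c` for the synchronising
rows, and a pair of cycles `α`, `β` carrying data in the other rows. -/
structure SimData {A : Type*} (E : A → A → Prop) (T : Type*) where
  p : ℕ
  ℓ : ℕ
  s : ℕ
  d : ℕ
  c : ℕ → ZMod p → A
  α : ZMod p → A
  β : ZMod p → A
  idx : ℕ → ZMod p × T × Bool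
  two_le : 2 ≤ ℓ
  lt_p : ℓ < p
  d_pos : 0 < d
  c_mem : ∀ k, c k ∈ cycles E p
  α_mem : α ∈ cycles E p
  β_mem : β ∈ cycles E p
  eq_out : ∀ i : ZMod p, i.val = 0 ∨ ℓ < i.val → α i = β i
  ne_in : ∀ i : ZMod p, 1 ≤ i.val → i.val ≤ ℓ → α i ≠ β i
  not_cross : ∀ i : ZMod p, 1 ≤ i.val → i.val < ℓ →
    ¬ (E (α i) (β (i + 1)) ∧ E (β i) (α (i + 1)))
  idx_surj : ∀ q, ∃ k < d, idx k = q
  sync : ∀ δ < s + d, ∀ r r' : ZMod p,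
    (∀ k < s, ∀ k' < s, k' = k + δ ∨ k' + (s + d) = k + δ → E (c k r) (c k' r')) →
      δ = 0 ∧ r' = r + 1

theorem exists_simData {A : Type*} [Finite A] {E : A → A → Prop} (hD : ¬ ConditionD E)
    (T : Type*) [Finite T] [Nonempty T] : Nonempty (SimData E T) := by
  obtain ⟨p, ℓ, h2, hℓ, hdet, α, hα, β, hβ, h3, h4, h5⟩ := exists_gadget hD
  have : NeZero p := ⟨by omega⟩
  obtain ⟨d, ⟨f⟩⟩ := Finite.exists_equiv_fin (ZMod p × T × Bool)
  have hd : 0 < d := by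
    rw [Nat.pos_iff_ne_zero]
    rintro rfl
    exact (f (0, Classical.arbitrary T, true)).elim0
  obtain ⟨s, c, hc, hs⟩ := exists_sync (by omega) hdet d
  refine ⟨⟨p, ℓ, s, d, c, α, β, fun k => f.symm ⟨k % d, Nat.mod_lt _ hd⟩, h2, hℓ, hd, hc, hα, hβ,
    h3, h4, h5, fun q => ⟨f q, Fin.is_lt _, ?_⟩, hs⟩⟩
  simp [Nat.mod_eq_of_lt (Fin.is_lt _)]

namespace SimData

variable {A : Type*} {E : A → A → Prop} {T : Type*} (D : SimData E T)

/-- The number of rows of a block. -/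
def n : ℕ := D.s + D.d

theorem n_pos : 0 < D.n := Nat.add_pos_right _ D.d_pos

instance : NeZero D.p := ⟨by have := D.lt_p; omega⟩

theorem one_lt_p : 1 < D.p := by have := D.lt_p; have := D.two_le; omega

open Classical in
/-- The entry of a data row in a column of phase `r`. -/
noncomputable def dataRow (r : ZMod D.p) (η : ZMod D.p → T) (q : ZMod D.p × T × Bool) : A :=
  if (η q.1 = q.2.1 ↔ q.2.2 = false) then D.β (r - q.1 + 1) else D.α (r - q.1 + 1)

/-- The entries of a block in a column of phase `r`. -/
noncomputable def blk (r : ZMod D.p) (η : ZMod D.p → T) (k : ℕ) : A :=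
  if k < D.s then D.c k r else D.dataRow r η (D.idx (k - D.s))

theorem blk_sync {r : ZMod D.p} {η : ZMod D.p → T} {k : ℕ} (hk : k < D.s) :
    D.blk r η k = D.c k r := if_pos hk

theorem exists_blk (q : ZMod D.p × T × Bool) :
    ∃ k < D.n, ∀ r η, D.blk r η k = D.dataRow r η q := by
  obtain ⟨k, hk, rfl⟩ := D.idx_surj q
  refine ⟨D.s + k, by unfold n; omega, fun r η => ?_⟩
  rw [blk, if_neg (by omega), Nat.add_sub_cancel_left]

theorem val_add_one {i : ZMod D.p} (h : i.val + 1 < D.p) : (i + 1).val = i.val + 1 := by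
  have : Fact (1 < D.p) := ⟨D.one_lt_p⟩
  rw [ZMod.val_add_of_lt, ZMod.val_one]
  rwa [ZMod.val_one]

/-- Two blocks of the same phase with the same entries carry the same visible data. -/
theorem decode {r j : ZMod D.p} {η η' : ZMod D.p → T} (hj : (r - j).val < D.ℓ)
    (h : ∀ k < D.n, D.blk r η k = D.blk r η' k) : η j = η' j := by
  obtain ⟨k, hk, hkb⟩ := D.exists_blk (j, η j, false)
  have h1 := h k hk
  have hv : (r - j + 1).val = (r - j).val + 1 := D.val_add_one (by have := D.lt_p; omega)
  have := D.ne_in (r - j + 1) (by omega) (by omega)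
  rw [hkb, hkb, dataRow, dataRow] at h1
  by_contra hne
  have hne' : ¬ η' j = η j := fun h => hne h.symm
  simp [hne'] at h1
  exact this h1.symm

/-- Data is transferred to the next column. -/
theorem transfer {r j : ZMod D.p} {η η' : ZMod D.p → T} (hj : (r - j).val + 1 < D.ℓ)
    (h : ∀ k < D.n, E (D.blk r η k) (D.blk (r + 1) η' k)) : η j = η' j := by
  have hv : (r - j + 1).val = (r - j).val + 1 := D.val_add_one (by have := D.lt_p; omega)
  have hc := D.not_cross (r - j + 1) (by omega) (by omega)
  obtain ⟨k, hk, hkb⟩ := D.exists_blk (j, η j, false)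
  obtain ⟨k', hk', hkb'⟩ := D.exists_blk (j, η j, true)
  have h1 := h k hk
  have h2 := h k' hk'
  rw [hkb, hkb, dataRow, dataRow] at h1
  rw [hkb', hkb', dataRow, dataRow] at h2
  rw [show r + 1 - j + 1 = r - j + 1 + 1 by ring] at h1 h2
  by_contra hne
  have hne' : ¬ η' j = η j := fun h => hne h.symm
  simp [hne'] at h1 h2
  exact hc ⟨h2, h1⟩

/-- Consecutive blocks of a column carrying admissible data. -/
def GoodPair (Nh Nv : T → T → Prop) (x : ℤ → A) (v : ℤ) (r : ZMod D.p) : Prop :=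
  ∃ η η' : ZMod D.p → T, Nh (η (r - 1)) (η r) ∧ Nv (η r) (η' r) ∧
    ∀ k < D.n, x (v + k) = D.blk r η k ∧ x (v + D.n + k) = D.blk r η' k

/-- The vertical shift of the simulation. -/
def cols (Nh Nv : T → T → Prop) : Set (ℤ → A) :=
  {x | ∃ v r, ∀ m : ℤ, D.GoodPair Nh Nv x (v + m * D.n) r}

variable {D} {Nh Nv : T → T → Prop}

theorem sync_blocks {x : ℤ → A} {v : ℤ} {r ρ : ZMod D.p} {δ : ℕ}
    (h : D.GoodPair Nh Nv x v r) (hδ : δ < D.n)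
    (hE : ∀ k < D.s, E (D.c k ρ) (x (v + δ + k))) : δ = 0 ∧ r = ρ + 1 := by
  obtain ⟨η, η', -, -, hb⟩ := h
  refine D.sync δ hδ ρ r fun k hk k' hk' hkk => ?_
  have h1 := hb k' (by unfold n; omega)
  rw [D.blk_sync hk', D.blk_sync hk'] at h1
  have h2 := hE k hk
  rcases hkk with e | e
  · rwa [show v + δ + k = v + k' by omega, h1.1] at h2
  · rwa [show v + δ + k = v + D.n + k' by unfold n; omega, h1.2] at h2

theorem GoodPair.first {x : ℤ → A} {v : ℤ} {r : ZMod D.p} (h : D.GoodPair Nh Nv x v r) :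
    ∀ k < D.s, x (v + k) = D.c k r := by
  obtain ⟨η, η', -, -, hb⟩ := h
  intro k hk
  rw [(hb k (by unfold n; omega)).1, D.blk_sync hk]

theorem GoodPair.second {x : ℤ → A} {v : ℤ} {r : ZMod D.p} (h : D.GoodPair Nh Nv x v r) :
    ∀ k < D.s, x (v + D.n + k) = D.c k r := by
  obtain ⟨η, η', -, -, hb⟩ := h
  intro k hk
  rw [(hb k (by unfold n; omega)).2, D.blk_sync hk]

/-- The parse of a column into blocks is unique. -/
theorem GoodPair.unique {x : ℤ → A} {v : ℤ} {r r' : ZMod D.p} {δ : ℕ}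
    (h : D.GoodPair Nh Nv x v r) (hδ : δ < D.n)
    (h' : ∀ k < D.s, x (v + δ + k) = D.c k r') : δ = 0 ∧ r = r' := by
  have := sync_blocks (ρ := r' - 1) h hδ fun k hk => by
    rw [h' k hk]
    simpa using D.c_mem k (r' - 1)
  simpa using this

theorem GoodPair.congr {x z : ℤ → A} {v w : ℤ} {r : ZMod D.p} (h : D.GoodPair Nh Nv z w r)
    (hx : ∀ k : ℕ, k < 2 * D.n → x (v + k) = z (w + k)) : D.GoodPair Nh Nv x v r := by
  obtain ⟨η, η', h1, h2, hb⟩ := h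
  refine ⟨η, η', h1, h2, fun k hk => ⟨?_, ?_⟩⟩
  · rw [hx k (by omega)]; exact (hb k hk).1
  · have := hx (D.n + k) (by omega)
    push_cast at this
    rw [← add_assoc, ← add_assoc] at this
    rw [this]; exact (hb k hk).2

/-- If every window of length `3 n` contains two good blocks, the column is good. -/
theorem mem_cols_of_local {x : ℤ → A}
    (h : ∀ a : ℤ, ∃ v, a ≤ v ∧ v < a + D.n ∧ ∃ r, D.GoodPair Nh Nv x v r) :
    x ∈ D.cols Nh Nv := by
  obtain ⟨v, -, -, r, hv⟩ := h 0
  have up : ∀ v, D.GoodPair Nh Nv x v r → D.GoodPair Nh Nv x (v + D.n) r := by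
    intro v hv
    obtain ⟨w, hw1, hw2, r', hw⟩ := h (v + 1)
    obtain ⟨δ, rfl⟩ := Int.exists_add_of_le (show v ≤ w by omega)
    rcases lt_or_ge δ D.n with h1 | h1
    · have := (hv.unique h1 hw.first).1
      omega
    · obtain rfl : δ = D.n := by omega
      have := (hw.unique (δ := 0) D.n_pos (r' := r) (by simpa using hv.second)).2
      exact this ▸ hw
  have down : ∀ v, D.GoodPair Nh Nv x v r → D.GoodPair Nh Nv x (v - D.n) r := by
    intro v hv
    obtain ⟨w, hw1, hw2, r', hw⟩ := h (v - D.n)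
    obtain ⟨δ, rfl⟩ := Int.exists_add_of_le (show w ≤ v by omega)
    rcases lt_or_ge δ D.n with h1 | h1
    · have := (hw.unique h1 hv.first).1
      omega
    · obtain rfl : δ = D.n := by omega
      have := (hv.unique (δ := 0) D.n_pos (r' := r') (by simpa using hw.second)).2
      rw [this, add_sub_cancel_right]
      exact hw
  refine ⟨v, r, fun m => ?_⟩
  induction m using Int.induction_on with
  | zero => simpa using hv
  | succ i ih =>
    have := up _ ih
    rwa [add_assoc, ← add_one_mul] at this
  | pred i ih =>
    have := down _ ih
    rwa [add_sub_assoc, ← sub_one_mul] at this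

theorem isSFT_cols [Finite A] : IsSFT1 (D.cols Nh Nv) := by
  have hfin : {w : List A | w.length = 3 * D.n ∧ ¬ wordIn (D.cols Nh Nv) w}.Finite :=
    (List.finite_length_eq A (3 * D.n)).subset fun w hw => hw.1
  refine ⟨hfin.toFinset, Set.Subset.antisymm (fun x hx w hw hwx => ?_) fun x hx => ?_⟩
  · rw [Set.Finite.mem_toFinset] at hw
    exact hw.2 ⟨x, hx, hwx⟩
  refine mem_cols_of_local fun a => ?_
  set w := List.ofFn (fun i : Fin (3 * D.n) => x (a + (i : ℕ))) with hw
  have h1 : wordIn (D.cols Nh Nv) w := by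
    by_contra hno
    refine hx w ?_ ⟨a, fun k hk => by simp [hw]⟩
    rw [Set.Finite.mem_toFinset]
    exact ⟨by simp [hw], hno⟩
  obtain ⟨z, ⟨v, r, hz⟩, b, hb⟩ := h1
  have hb' : ∀ k : ℕ, k < 3 * D.n → z (b + k) = x (a + k) := by
    intro k hk
    rw [hb k (by simpa [hw] using hk)]
    simp [hw]
  have hn : (0 : ℤ) < D.n := by exact_mod_cast D.n_pos
  have e1 := Int.emod_nonneg (v - b) hn.ne'
  have e2 := Int.emod_lt_of_pos (v - b) hn
  have e3 := Int.emod_add_mul_ediv (v - b) D.n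
  obtain ⟨t, ht⟩ := Int.eq_ofNat_of_zero_le e1
  refine ⟨a + t, by omega, by omega, r, (hz (-((v - b) / D.n))).congr fun k hk => ?_⟩
  have := hb' (t + k) (by omega)
  rw [show v + -((v - b) / D.n) * D.n + k = b + (t + k : ℕ) by push_cast; linarith, this]
  congr 1
  push_cast; ring

end SimData

end simulation

section simulation

namespace SimData

variable {A : Type*} {E : A → A → Prop} {T : Type*} {D : SimData E T} {Nh Nv : T → T → Prop}

/-- The configuration simulating `y`, with vertical offset `v` and phase `r`. -/
noncomputable def sim (D : SimData E T) (v : ℤ) (r : ZMod D.p) (y : ℤ → ℤ → T) (z : ℤ × ℤ) : A :=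
  D.blk (r + z.1) (fun j => y (z.1 - (r + z.1 - j).val) ((z.2 - v) / D.n))
    ((z.2 - v) % D.n).toNat

theorem sim_apply (v : ℤ) (r : ZMod D.p) (y : ℤ → ℤ → T) (i m : ℤ) {k : ℕ} (hk : k < D.n) :
    D.sim v r y (i, v + m * D.n + k) =
      D.blk (r + i) (fun j => y (i - (r + i - j).val) m) k := by
  have hn : (0 : ℤ) < D.n := by exact_mod_cast D.n_pos
  have e : v + m * D.n + k - v = k + m * D.n := by ring
  have h1 : (v + m * D.n + k - v) / D.n = m := by
    rw [e, Int.add_mul_ediv_right _ _ hn.ne', Int.ediv_eq_zero_of_lt (by omega) (by omega),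
      zero_add]
  have h2 : (v + m * D.n + k - v) % D.n = k := by
    rw [e, Int.add_mul_emod_self_right, Int.emod_eq_of_lt (by omega) (by omega)]
  simp only [sim]
  rw [h1, h2, Int.toNat_natCast]

theorem exists_row (D : SimData E T) (v l : ℤ) : ∃ m : ℤ, ∃ k : ℕ, k < D.n ∧ l = v + m * D.n + k := by
  have hn : (0 : ℤ) < D.n := by exact_mod_cast D.n_pos
  have e1 := Int.emod_nonneg (l - v) hn.ne'
  have e2 := Int.emod_lt_of_pos (l - v) hn
  have e3 := Int.emod_add_mul_ediv (l - v) D.n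
  obtain ⟨k, hk⟩ := Int.eq_ofNat_of_zero_le e1
  exact ⟨(l - v) / D.n, k, by omega, by linarith⟩

theorem eq_of_val_out {r j : ZMod D.p} {η η' : ZMod D.p → T} (h : (r - j).val < D.ℓ → η j = η' j)
    (b : T × Bool) : D.dataRow r η (j, b) = D.dataRow r η' (j, b) := by
  rcases lt_or_ge (r - j).val D.ℓ with h1 | h1
  · simp only [dataRow]
    rw [h h1]
  · have : D.α (r - j + 1) = D.β (r - j + 1) := by
      apply D.eq_out
      rcases lt_or_ge ((r - j).val + 1) D.p with h2 | h2
      · right; rw [D.val_add_one h2]; omega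
      · left
        have h3 := ZMod.val_lt (r - j)
        have h4 : ((r - j).val : ZMod D.p) = r - j := ZMod.natCast_zmod_val _
        rw [show r - j + 1 = (((r - j).val + 1 : ℕ) : ZMod D.p) by push_cast; rw [h4],
          show (r - j).val + 1 = D.p by omega, ZMod.natCast_self, ZMod.val_zero]
    simp only [dataRow, this, ite_self]

theorem blk_congr {r : ZMod D.p} {η η' : ZMod D.p → T}
    (h : ∀ j, (r - j).val < D.ℓ → η j = η' j) (k : ℕ) : D.blk r η k = D.blk r η' k := by
  unfold blk
  split_ifs
  · rfl
  · exact eq_of_val_out (h _) _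

/-- Simulating configurations lie in the combined subshift. -/
theorem sim_mem (v : ℤ) (r : ZMod D.p) {y : ℤ → ℤ → T} (hy : y ∈ GridShift Nh Nv) :
    D.sim v r y ∈ XHV (vertexShift E) (D.cols Nh Nv) := by
  refine ⟨fun l i => ?_, fun i => ⟨v, r + i, fun m => ?_⟩⟩
  · obtain ⟨m, k, hk, rfl⟩ := D.exists_row v l
    show E (D.sim v r y (i, _)) (D.sim v r y (i + 1, _))
    rw [sim_apply _ _ _ _ _ hk, sim_apply _ _ _ _ _ hk]
    push_cast
    rw [← add_assoc]
    set R := r + (i : ZMod D.p)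
    unfold blk
    split_ifs with hs
    · exact D.c_mem k R
    · generalize hq : D.idx (k - D.s) = q
      obtain ⟨j, b⟩ := q
      have h1 : D.dataRow R (fun j => y (i - (R - j).val) m) (j, b) =
          D.dataRow R (fun j => y (i + 1 - (R + 1 - j).val) m) (j, b) := by
        refine eq_of_val_out (fun h => ?_) b
        have : (R + 1 - j).val = (R - j).val + 1 := by
          rw [show R + 1 - j = R - j + 1 by ring]
          exact D.val_add_one (by have := D.lt_p; omega)
        rw [this]
        congr 1
        push_cast; ring
      rw [h1]
      simp only [dataRow]
      rw [show R + 1 - j + 1 = R - j + 1 + 1 by ring]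
      split_ifs
      · exact D.β_mem _
      · exact D.α_mem _
  · refine ⟨fun j => y (i - (r + i - j).val) m, fun j => y (i - (r + i - j).val) (m + 1),
      ?_, ?_, fun k hk => ⟨sim_apply v r y i m hk, ?_⟩⟩
    · have h1 : (r + i - (r + i - 1)).val = 1 := by
        have : Fact (1 < D.p) := ⟨D.one_lt_p⟩
        rw [sub_sub_cancel, ZMod.val_one]
      have := (hy (i - 1) m).1
      simp only [h1, sub_self, ZMod.val_zero]
      simpa using this
    · have := (hy i m).2
      simpa using this
    · rw [show v + m * D.n + D.n + k = v + (m + 1) * D.n + k by ring]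
      exact sim_apply v r y i (m + 1) hk

theorem adjacent {x x' : ℤ → A} {v v' : ℤ} {r r' : ZMod D.p} (hE : ∀ l, E (x l) (x' l))
    (h : ∀ m : ℤ, D.GoodPair Nh Nv x (v + m * D.n) r)
    (h' : ∀ m : ℤ, D.GoodPair Nh Nv x' (v' + m * D.n) r') :
    (D.n : ℤ) ∣ v' - v ∧ r' = r + 1 := by
  obtain ⟨m, δ, hδ, hv⟩ := D.exists_row v' v
  have := sync_blocks (ρ := r) (h' m) hδ fun k hk => by
    have h1 := (h 0).first k hk
    rw [zero_mul, add_zero] at h1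
    have h2 := hE (v + k)
    rwa [h1, hv] at h2
  refine ⟨⟨-m, ?_⟩, this.2⟩
  rw [hv, this.1]; push_cast; ring

/-- Every element of the combined subshift is a simulating configuration. -/
theorem exists_sim {x : ℤ × ℤ → A} (hx : x ∈ XHV (vertexShift E) (D.cols Nh Nv)) :
    ∃ v : ℤ, 0 ≤ v ∧ v < D.n ∧ ∃ r, ∃ y ∈ GridShift Nh Nv, x = D.sim v r y := by
  obtain ⟨hrow, hcol⟩ := hx
  choose V R hVR using hcol
  have hE : ∀ i l : ℤ, E (x (i, l)) (x (i + 1, l)) := fun i l => hrow l i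
  have hadj : ∀ i, (D.n : ℤ) ∣ V (i + 1) - V i ∧ R (i + 1) = R i + 1 :=
    fun i => adjacent (hE i) (hVR i) (hVR (i + 1))
  have hall : ∀ i, (D.n : ℤ) ∣ V i - V 0 ∧ R i = R 0 + i := by
    intro i
    induction i using Int.induction_on with
    | zero => simp
    | succ i ih =>
      refine ⟨?_, ?_⟩
      · rw [← sub_add_sub_cancel _ (V i)]; exact dvd_add (hadj i).1 ih.1
      · rw [(hadj i).2, ih.2]; push_cast; ring
    | pred i ih =>
      have := hadj (-i - 1)
      rw [sub_add_cancel] at this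
      refine ⟨?_, ?_⟩
      · rw [← sub_sub_sub_cancel_left _ _ (V (-i))]
        rw [← dvd_neg]
        convert dvd_sub this.1 ih.1 using 1
        ring
      · rw [eq_sub_of_add_eq this.2.symm, ih.2]; push_cast; ring
  obtain ⟨m₀, v, hv, hv0⟩ := D.exists_row 0 (V 0)
  set r := R 0
  have good : ∀ i m : ℤ, D.GoodPair Nh Nv (fun l => x (i, l)) (v + m * D.n) (r + i) := by
    intro i m
    obtain ⟨⟨t, ht⟩, hR⟩ := hall i
    have := hVR i (m - m₀ - t)
    rw [hR] at this
    convert this using 1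
    rw [sub_mul, sub_mul]
    linarith
  choose η η' hη1 hη2 hη3 using good
  have hx1 : ∀ i m : ℤ, ∀ k < D.n, x (i, v + m * D.n + k) = D.blk (r + i) (η i m) k :=
    fun i m k hk => (hη3 i m k hk).1
  have htr : ∀ i m : ℤ, ∀ j, (r + i - j).val + 1 < D.ℓ → η i m j = η (i + 1) m j := by
    intro i m j hj
    refine D.transfer hj fun k hk => ?_
    have := hE i (v + m * D.n + k)
    rw [hx1 i m k hk, hx1 (i + 1) m k hk] at this
    push_cast at this
    rwa [← add_assoc] at this
  have hval : ∀ o : ℕ, o < D.ℓ → ((o : ℕ) : ZMod D.p).val = o := fun o ho =>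
    ZMod.val_natCast_of_lt (ho.trans D.lt_p)
  have hy : ∀ o : ℕ, o < D.ℓ → ∀ i m : ℤ, η i m (r + i - o) = η (i - o) m (r + (i - o : ℤ)) := by
    intro o
    induction o with
    | zero => intro _ i m; simp
    | succ o ih =>
      intro ho i m
      have h1 := htr (i - 1) m (r + i - (o + 1 : ℕ)) (by
        rw [show r + ((i - 1 : ℤ) : ZMod D.p) - (r + i - (o + 1 : ℕ)) = (o : ℕ) by
          push_cast; ring, hval o (by omega)]
        omega)
      rw [sub_add_cancel] at h1
      have h2 := ih (by omega) (i - 1) m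
      rw [← h1, show r + (i : ZMod D.p) - (o + 1 : ℕ) = r + ((i - 1 : ℤ) : ZMod D.p) - o by
        push_cast; ring, h2]
      have e : i - 1 - (o : ℤ) = i - (o + 1 : ℕ) := by push_cast; ring
      rw [e]
  refine ⟨v, by omega, by omega, r, fun i m => η i m (r + i), fun i m => ⟨?_, ?_⟩, ?_⟩
  · have h1 := hη1 (i + 1) m
    have h2 := htr i m (r + i) (by have := D.two_le; simp; omega)
    show Nh (η i m (r + i)) (η (i + 1) m (r + (i + 1 : ℤ)))
    rw [h2]
    convert h1 using 2
    push_cast; ring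
  · have h1 := hη2 i m
    have h2 : η' i m (r + i) = η i (m + 1) (r + i) := by
      refine D.decode (r := r + i) (by simpa using by have := D.two_le; omega) fun k hk => ?_
      rw [← (hη3 i m k hk).2, ← (hη3 i (m + 1) k hk).1]
      show x _ = x _
      congr 2; ring
    rwa [h2] at h1
  · funext ⟨i, l⟩
    obtain ⟨m, k, hk, rfl⟩ := D.exists_row v l
    rw [sim_apply _ _ _ _ _ hk, hx1 i m k hk]
    refine blk_congr (fun j hj => ?_) k
    have := hy (r + i - j).val hj i m
    rwa [ZMod.natCast_zmod_val, sub_sub_cancel] at this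

end SimData

end simulation

section simulation

theorem gridShift_shift {T : Type*} {Nh Nv : T → T → Prop} {y : ℤ → ℤ → T}
    (hy : y ∈ GridShift Nh Nv) (a b : ℤ) : (fun i j => y (i + a) (j + b)) ∈ GridShift Nh Nv := by
  intro i j
  have := hy (i + a) (j + b)
  rwa [add_right_comm i a 1, add_right_comm j b 1] at this

namespace SimData

variable {A : Type*} {E : A → A → Prop} {T : Type*} {D : SimData E T} {Nh Nv : T → T → Prop}

theorem gridCount_le_patCount [Finite A] [Nonempty T] (N : ℕ) : gridCount Nh Nv N (N / D.n) ≤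
    patCount2 (XHV (vertexShift E) (D.cols Nh Nv)) N N := by
  set S := {p : Fin N → Fin (N / D.n) → T |
    ∃ y ∈ GridShift Nh Nv, ∀ (i : Fin N) (j : Fin (N / D.n)), y (i : ℕ) (j : ℕ) = p i j} with hS
  have hch : ∀ p, ∃ y : ℤ → ℤ → T, p ∈ S → y ∈ GridShift Nh Nv ∧
      ∀ (i : Fin N) (j : Fin (N / D.n)), y (i : ℕ) (j : ℕ) = p i j := by
    intro p
    by_cases hp : p ∈ S
    · obtain ⟨y, hy⟩ := hp
      exact ⟨y, fun _ => hy⟩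
    · exact ⟨fun _ _ => Classical.arbitrary T, fun h => absurd h hp⟩
  choose Y hY using hch
  refine Set.ncard_le_ncard_of_injOn
    (fun p (i j : Fin N) => D.sim 0 0 (Y p) ((i : ℤ), (j : ℤ))) ?_ ?_ (Set.toFinite _)
  · intro p hp
    exact ⟨_, sim_mem 0 0 (hY p hp).1, fun i j => rfl⟩
  · intro p hp q hq hpq
    funext i m
    rw [← (hY p hp).2, ← (hY q hq).2]
    have := D.decode (r := (0 : ZMod D.p) + (i : ℕ)) (j := (0 : ZMod D.p) + (i : ℕ))
      (η := fun j => Y p ((i : ℕ) - ((0 : ZMod D.p) + ((i : ℕ) : ℤ) - j).val) (m : ℕ))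
      (η' := fun j => Y q ((i : ℕ) - ((0 : ZMod D.p) + ((i : ℕ) : ℤ) - j).val) (m : ℕ))
      (by have := D.two_le; simp; omega) fun k hk => by
        have hlt : (m : ℕ) * D.n + k < N := by
          have h1 : ((m : ℕ) + 1) * D.n ≤ N :=
            (Nat.mul_le_mul_right _ m.2).trans (Nat.div_mul_le_self _ _)
          rw [add_mul, one_mul] at h1
          omega
        have h1 := congrFun (congrFun hpq i) ⟨m * D.n + k, hlt⟩
        have e : (((m : ℕ) * D.n + k : ℕ) : ℤ) = 0 + (m : ℕ) * D.n + k := by push_cast; ring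
        simp only [e] at h1
        rw [sim_apply _ _ _ _ _ hk, sim_apply _ _ _ _ _ hk] at h1
        simpa using h1
    simpa using this

theorem patCount_le_gridCount [Finite T] (N : ℕ) :
    patCount2 (XHV (vertexShift E) (D.cols Nh Nv)) N N ≤
      D.n * D.p * gridCount Nh Nv (N + D.p) (N / D.n + 2) := by
  set X := XHV (vertexShift E) (D.cols Nh Nv)
  set G := {q : Fin (N + D.p) → Fin (N / D.n + 2) → T |
    ∃ y ∈ GridShift Nh Nv, ∀ (i : Fin (N + D.p)) (j : Fin (N / D.n + 2)),
      y (i : ℕ) (j : ℕ) = q i j} with hG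
  set S := {q : Fin N → Fin N → A | ∃ x ∈ X, ∀ (i j : Fin N), x ((i : ℤ), (j : ℤ)) = q i j}
    with hS
  have hch : ∀ q : S, ∃ v : Fin D.n, ∃ r : ZMod D.p, ∃ y ∈ GridShift Nh Nv,
      ∀ i j : Fin N, D.sim (v : ℕ) r y ((i : ℤ), (j : ℤ)) = q.1 i j := by
    rintro ⟨q, x, hx, hxq⟩
    obtain ⟨v, hv0, hv, r, y, hy, rfl⟩ := exists_sim hx
    obtain ⟨w, rfl⟩ := Int.eq_ofNat_of_zero_le hv0
    exact ⟨⟨w, by exact_mod_cast hv⟩, r, y, hy, hxq⟩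
  choose v r y hy hyq using hch
  let f : S → Fin D.n × ZMod D.p × G := fun q =>
    (v q, r q, ⟨fun i j => y q ((i : ℕ) + -D.p) ((j : ℕ) + -1), _, gridShift_shift (hy q) (-D.p) (-1),
      fun _ _ => rfl⟩)
  have hf : Function.Injective f := by
    intro q q' h
    simp only [f, Prod.mk.injEq, Subtype.mk.injEq] at h
    obtain ⟨h1, h2, h3⟩ := h
    apply Subtype.ext
    funext i j
    rw [← hyq, ← hyq, h1, h2]
    obtain ⟨m, k, hk, hj⟩ := D.exists_row (v q' : ℕ) (j : ℕ)
    rw [hj, sim_apply _ _ _ _ _ hk, sim_apply _ _ _ _ _ hk]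
    refine blk_congr (fun t ht => ?_) k
    have ho := (ZMod.val_lt (r q' + (((i : ℕ) : ℤ) : ZMod D.p) - t)).le
    set o := (r q' + (((i : ℕ) : ℤ) : ZMod D.p) - t).val
    have hn : (0 : ℤ) < D.n := by exact_mod_cast D.n_pos
    have hm1 : 0 ≤ m + 1 := by
      by_contra hneg
      have : (m + 1) * D.n ≤ -1 * D.n := mul_le_mul_of_nonneg_right (by omega) hn.le
      have := (v q').2
      have : (0 : ℤ) ≤ (v q' : ℕ) + m * D.n + k := by rw [← hj]; omega
      nlinarith
    obtain ⟨m', hm'⟩ := Int.eq_ofNat_of_zero_le hm1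
    have hm2 : m' < N / D.n + 2 := by
      have h5 : m ≤ (N / D.n : ℕ) := by
        push_cast
        apply (Int.le_ediv_iff_mul_le hn).2
        have := j.2
        omega
      omega
    have := congrFun (congrFun h3 ⟨(i : ℕ) + D.p - o, by have := i.2; omega⟩) ⟨m', hm2⟩
    simp only at this
    rw [Nat.cast_sub (by omega)] at this
    convert this using 2 <;> push_cast <;> omega
  have hcard := Nat.card_le_card_of_injective f hf
  rw [Nat.card_prod, Nat.card_prod, Nat.card_fin,
    Nat.card_zmod, ← mul_assoc] at hcard
  exact hcard

end SimData

/-- If condition D fails, every tiling system over a finite set is simulated, up to a vertical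
rescaling, by a combined subshift. -/
theorem exists_simulation {A : Type*} [Finite A] {E : A → A → Prop} (hD : ¬ ConditionD E)
    {T : Type*} [Finite T] [Nonempty T] (Nh Nv : T → T → Prop) :
    ∃ V : Set (ℤ → A), IsSFT1 V ∧
      ((GridShift Nh Nv).Nonempty → (XHV (vertexShift E) V).Nonempty) ∧
      ∃ n C W : ℕ, 0 < n ∧ ∀ N,
        gridCount Nh Nv N (N / n) ≤ patCount2 (XHV (vertexShift E) V) N N ∧
        patCount2 (XHV (vertexShift E) V) N N ≤ C * gridCount Nh Nv (N + W) (N / n + 2) := by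
  obtain ⟨D⟩ := exists_simData hD T
  exact ⟨D.cols Nh Nv, D.isSFT_cols, fun ⟨y, hy⟩ => ⟨_, D.sim_mem 0 0 hy⟩, D.n, D.n * D.p, D.p,
    D.n_pos, fun N => ⟨D.gridCount_le_patCount N, D.patCount_le_gridCount N⟩⟩

end simulation

/-- Structured counter programs over registers indexed by natural numbers. -/
inductive Prog : Type
  | inc (a : ℕ)
  | dec (a : ℕ)
  | copy (a s : ℕ)
  | chk
  | seq (p q : Prog)
  | whl (a : ℕ) (p : Prog)

namespace Prog

/-- The control flow of a program: the new continuation, depending on zero tests. -/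
def nextCont : List Prog → (ℕ → Bool) → List Prog
  | [], _ => []
  | seq p q :: k, _ => p :: q :: k
  | whl a p :: k, z => if z a then k else p :: whl a p :: k
  | _ :: k, _ => k

/-- The action of the current instruction on the registers. -/
def act : List Prog → (ℕ → ℕ) → ℕ → ℕ
  | inc a :: _, st => Function.update st a (st a + 1)
  | dec a :: _, st => Function.update st a (st a - 1)
  | copy a s :: _, st => Function.update st a (st s)
  | _, st => st

/-- One step of a program. -/
def step (x : List Prog × (ℕ → ℕ)) : List Prog × (ℕ → ℕ) :=
  (nextCont x.1 fun a => decide (x.2 a = 0), act x.1 x.2)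

/-- The next instruction is a check. -/
def IsChk (x : List Prog × (ℕ → ℕ)) : Prop := x.1.head? = some chk

/-- A step that performs no check. -/
def Silent (x y : List Prog × (ℕ → ℕ)) : Prop := ¬ IsChk x ∧ step x = y

/-- The program `p` terminates from `st` with `st'`, without a check. -/
def Runs (p : Prog) (st st' : ℕ → ℕ) : Prop :=
  ∀ k, Relation.ReflTransGen Silent (p :: k, st) (k, st')

theorem runs_inc (a : ℕ) (st : ℕ → ℕ) : Runs (inc a) st (Function.update st a (st a + 1)) :=
  fun _ => .single ⟨by simp [IsChk], rfl⟩

theorem runs_dec (a : ℕ) (st : ℕ → ℕ) : Runs (dec a) st (Function.update st a (st a - 1)) :=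
  fun _ => .single ⟨by simp [IsChk], rfl⟩

theorem runs_copy (a s : ℕ) (st : ℕ → ℕ) : Runs (copy a s) st (Function.update st a (st s)) :=
  fun _ => .single ⟨by simp [IsChk], rfl⟩

theorem Runs.seq {p q : Prog} {a b c : ℕ → ℕ} (h : Runs p a b) (h' : Runs q b c) :
    Runs (seq p q) a c :=
  fun k => .head ⟨by simp [IsChk], rfl⟩ ((h (q :: k)).trans (h' k))

theorem runs_whl_zero {r : ℕ} {p : Prog} {a : ℕ → ℕ} (h : a r = 0) : Runs (whl r p) a a :=
  fun k => .single ⟨by simp [IsChk], by simp [step, nextCont, act, h]⟩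

theorem Runs.whl {r : ℕ} {p : Prog} {a b c : ℕ → ℕ} (h : a r ≠ 0) (hp : Runs p a b)
    (hl : Runs (whl r p) b c) : Runs (whl r p) a c :=
  fun k => .head (b := (p :: .whl r p :: k, a)) ⟨by simp [IsChk], by simp [step, nextCont, act, h]⟩
    ((hp _).trans (hl k))

theorem runs_clear (r : ℕ) (st : ℕ → ℕ) : Runs (whl r (dec r)) st (Function.update st r 0) := by
  induction h : st r generalizing st with
  | zero =>
    rw [← h, Function.update_eq_self]
    exact runs_whl_zero h
  | succ n ih =>
    have := ih (Function.update st r (st r - 1)) (by simp [h])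
    rw [Function.update_idem] at this
    exact (runs_dec r st).whl (by omega) this

/-- Some program computes `f` from the registers `ρ` into `out`, preserving all other registers
below `b`. -/
def Computes {n : ℕ} (f : List.Vector ℕ n → ℕ) (ρ : Fin n → ℕ) (out b : ℕ) : Prop :=
  ∃ p, ∀ st, ∃ st', Runs p st st' ∧ st' out = f (List.Vector.ofFn fun i => st (ρ i)) ∧
    ∀ r < b, r ≠ out → st' r = st r

theorem computes_of_primrec' {n : ℕ} {f : List.Vector ℕ n → ℕ} (hf : Nat.Primrec' f) :
    ∀ (ρ : Fin n → ℕ) (out b : ℕ), (∀ i, ρ i < b) → out < b → Computes f ρ out b := by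
  induction hf with
  | zero =>
    intro ρ out b _ _
    exact ⟨_, fun st => ⟨_, runs_clear out st, by simp, fun r _ hr => by simp [hr]⟩⟩
  | succ =>
    intro ρ out b _ _
    refine ⟨_, fun st => ⟨_, (runs_copy out (ρ 0) st).seq (runs_inc out _), ?_, fun r _ hr => ?_⟩⟩
    · simp [List.Vector.head_ofFn]
    · simp [hr]
  | get i =>
    intro ρ out b _ _
    exact ⟨_, fun st => ⟨_, runs_copy out (ρ i) st, by simp, fun r _ hr => by simp [hr]⟩⟩
  | @comp n m f g _ _ ihf ihg =>
    intro ρ out b hρ hout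
    have key : ∀ j ≤ m, ∃ p, ∀ st, ∃ st', Runs p st st' ∧
        (∀ i : Fin m, i < j → st' (b + i) = g i (List.Vector.ofFn fun i => st (ρ i))) ∧
        ∀ r < b, st' r = st r := by
      intro j
      induction j with
      | zero =>
        intro _
        exact ⟨_, fun st => ⟨_, runs_copy 0 0 st, by simp, by simp⟩⟩
      | succ j ih =>
        intro hj
        obtain ⟨p, hp⟩ := ih (by omega)
        obtain ⟨q, hq⟩ := ihg ⟨j, hj⟩ ρ (b + j) (b + m) (fun i => by have := hρ i; omega) (by omega)
        refine ⟨seq p q, fun st => ?_⟩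
        obtain ⟨s, hs, hs1, hs2⟩ := hp st
        obtain ⟨s', hs', hs1', hs2'⟩ := hq s
        have hv : (List.Vector.ofFn fun i => s (ρ i)) = List.Vector.ofFn fun i => st (ρ i) :=
          congrArg _ (funext fun i => hs2 _ (hρ i))
        rw [hv] at hs1'
        refine ⟨s', hs.seq hs', fun i hi => ?_, fun r hr => ?_⟩
        · rcases Nat.lt_succ_iff_lt_or_eq.1 hi with h | h
          · rw [hs2' _ (by omega) (by omega), hs1 i h]
          · obtain rfl : i = ⟨j, hj⟩ := Fin.ext h
            exact hs1'
        · rw [hs2' _ (by omega) (by omega), hs2 r hr]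
    obtain ⟨p, hp⟩ := key m le_rfl
    obtain ⟨q, hq⟩ := ihf (fun i => b + i) out (b + m) (fun i => by omega) (by omega)
    refine ⟨seq p q, fun st => ?_⟩
    obtain ⟨s, hs, hs1, hs2⟩ := hp st
    obtain ⟨s', hs', hs1', hs2'⟩ := hq s
    refine ⟨s', hs.seq hs', ?_, fun r hr hr' => ?_⟩
    · rw [hs1']
      exact congrArg f (congrArg _ (funext fun i => hs1 i i.2))
    · rw [hs2' r (by omega) hr', hs2 r hr]
  | @prec n f g _ _ ihf ihg =>
    intro ρ out b hρ hout
    obtain ⟨p, hp⟩ := ihf (fun i => ρ i.succ) (b + 2) (b + 4)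
      (fun i => by have := hρ i.succ; omega) (by omega)
    obtain ⟨q, hq⟩ := ihg (Fin.cons (b + 1) (Fin.cons (b + 2) fun i => ρ i.succ)) (b + 3) (b + 4)
      (Fin.cases (by simp) (Fin.cases (by simp) fun i => by
        have := hρ i.succ; simp only [Fin.cons_succ]; omega)) (by omega)
    have loop : ∀ (m y : ℕ) (w : List.Vector ℕ n) (st : ℕ → ℕ), st b = m → st (b + 1) = y →
        (List.Vector.ofFn fun i => st (ρ (Fin.succ i))) = w →
        st (b + 2) = Nat.rec (f w) (fun y IH => g (y ::ᵥ IH ::ᵥ w)) y →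
        ∃ st', Runs (whl b (seq (dec b) (seq q (seq (copy (b + 2) (b + 3)) (inc (b + 1))))))
            st st' ∧
          st' (b + 2) = Nat.rec (f w) (fun y IH => g (y ::ᵥ IH ::ᵥ w)) (y + m) ∧
          ∀ r < b, st' r = st r := by
      intro m
      induction m with
      | zero =>
        intro y w st hb hy hw hacc
        exact ⟨st, runs_whl_zero hb, hacc, fun _ _ => rfl⟩
      | succ m ih =>
        intro y w st hb hy hw hacc
        obtain ⟨s, hs, hs1, hs2⟩ := hq (Function.update st b (st b - 1))
        have hv : (List.Vector.ofFn fun i : Fin (n + 2) =>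
            Function.update st b (st b - 1)
              ((Fin.cons (b + 1) (Fin.cons (b + 2) fun i => ρ i.succ) : Fin (n + 2) → ℕ) i)) =
            y ::ᵥ (Nat.rec (f w) (fun y IH => g (y ::ᵥ IH ::ᵥ w)) y) ::ᵥ w := by
          simp only [List.Vector.ofFn, Fin.cons_zero, Fin.cons_succ]
          rw [← hw, Function.update_of_ne (by omega), Function.update_of_ne (by omega), hy, hacc,
            ← hw]
          congr 3
          funext i
          exact Function.update_of_ne (hρ i.succ).ne _ _
        rw [hv] at hs1
        have hs3 : ∀ r < b, s r = st r := fun r hr => by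
          rw [hs2 r (by omega) (by omega), Function.update_of_ne hr.ne]
        obtain ⟨s', hs', hs1', hs2'⟩ := ih (y + 1) w
          (Function.update (Function.update s (b + 2) (s (b + 3))) (b + 1)
            (Function.update s (b + 2) (s (b + 3)) (b + 1) + 1))
          (by simp [hs2 b (by omega) (by omega), hb])
          (by simp [hs2 (b + 1) (by omega) (by omega), hy])
          (by
            rw [← hw]
            congr 1
            funext i
            have := hρ i.succ
            rw [Function.update_of_ne (by omega), Function.update_of_ne (by omega), hs3 _ this])
          (by simp [hs1])
        refine ⟨s', ((runs_dec b st).seq (hs.seq ((runs_copy _ _ s).seq (runs_inc _ _)))).whl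
          (by omega) hs', ?_, fun r hr => ?_⟩
        · rw [hs1', Nat.add_right_comm]; rfl
        · rw [hs2' r hr, Function.update_of_ne (by omega), Function.update_of_ne (by omega),
            hs3 r hr]
    refine ⟨seq (copy b (ρ 0)) (seq (whl (b + 1) (dec (b + 1))) (seq p (seq
      (whl b (seq (dec b) (seq q (seq (copy (b + 2) (b + 3)) (inc (b + 1))))))
      (copy out (b + 2))))), fun st => ?_⟩
    obtain ⟨s, hs, hs1, hs2⟩ := hp (Function.update (Function.update st b (st (ρ 0))) (b + 1) 0)
    have hs3 : ∀ r < b, s r = st r := fun r hr => by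
      rw [hs2 r (by omega) (by omega), Function.update_of_ne (by omega),
        Function.update_of_ne hr.ne]
    have hw : (List.Vector.ofFn fun i => s (ρ (Fin.succ i))) =
        List.Vector.ofFn fun i => st (ρ (Fin.succ i)) :=
      congrArg _ (funext fun i => hs3 _ (hρ i.succ))
    have hw' : (List.Vector.ofFn fun i => Function.update (Function.update st b (st (ρ 0)))
        (b + 1) 0 (ρ (Fin.succ i))) = List.Vector.ofFn fun i => st (ρ (Fin.succ i)) :=
      congrArg _ (funext fun i => by
        have := hρ i.succ
        rw [Function.update_of_ne (by omega), Function.update_of_ne (by omega)])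
    rw [hw'] at hs1
    obtain ⟨s', hs', hs1', hs2'⟩ := loop (st (ρ 0)) 0 _ s
      (by simp [hs2 b (by omega) (by omega)]) (by simp [hs2 (b + 1) (by omega) (by omega)]) hw hs1
    refine ⟨_, (runs_copy _ _ st).seq ((runs_clear _ _).seq (hs.seq (hs'.seq (runs_copy _ _ s')))),
      ?_, fun r hr hr' => ?_⟩
    · rw [Function.update_self, hs1', Nat.zero_add]
      simp [List.Vector.head_ofFn, List.Vector.tail_ofFn]
    · rw [Function.update_of_ne hr', hs2' r hr, hs3 r hr]

end Prog

namespace Prog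

/-- The continuations occurring while running `p` before `k`. -/
def conts : Prog → List Prog → Set (List Prog)
  | seq p q, k => insert (seq p q :: k) (conts p (q :: k) ∪ conts q k)
  | whl a p, k => insert (whl a p :: k) (conts p (whl a p :: k))
  | p, k => {p :: k}

theorem finite_conts (p : Prog) (k : List Prog) : (conts p k).Finite := by
  induction p generalizing k with
  | seq p q ihp ihq => exact ((ihp _).union (ihq _)).insert _
  | whl a p ih => exact (ih _).insert _
  | _ => exact Set.finite_singleton _

theorem mem_conts_self (p : Prog) (k : List Prog) : p :: k ∈ conts p k := by
  cases p <;> simp [conts]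

theorem nextCont_mem_conts {p : Prog} {k k' : List Prog} (h : k' ∈ conts p k) (z : ℕ → Bool) :
    nextCont k' z ∈ insert k (conts p k) := by
  induction p generalizing k with
  | seq p q ihp ihq =>
    rcases h with rfl | h | h
    · exact .inr (.inr (.inl (mem_conts_self p _)))
    · rcases ihp h with h | h
      · rw [h]
        exact .inr (.inr (.inr (mem_conts_self q k)))
      · exact .inr (.inr (.inl h))
    · rcases ihq h with h | h
      · exact .inl h
      · exact .inr (.inr (.inr h))
  | whl a p ih =>
    rcases h with rfl | h
    · simp only [nextCont]
      split_ifs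
      · exact .inl rfl
      · exact .inr (.inr (mem_conts_self p _))
    · rcases ih h with h | h
      · exact .inr (.inl h)
      · exact .inr (.inr h)
  | _ => obtain rfl := h; exact .inl rfl

/-- A bound for the registers mentioned in a program. -/
def bound : Prog → ℕ
  | inc a => a
  | dec a => a
  | copy a s => max a s
  | chk => 0
  | seq p q => max (bound p) (bound q)
  | whl a p => max a (bound p)

theorem bound_nextCont {K : ℕ} {k : List Prog} (h : ∀ p ∈ k, bound p ≤ K) (z : ℕ → Bool) :
    ∀ p ∈ nextCont k z, bound p ≤ K := by
  rcases k with _ | ⟨_ | _ | _ | _ | _ | _, k⟩ <;>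
    simp only [nextCont, List.forall_mem_cons, bound, max_le_iff] at h ⊢ <;> try exact h.2
  · exact h
  · exact ⟨h.1.1, h.1.2, h.2⟩
  · split_ifs
    · exact h.2
    · simp only [List.forall_mem_cons, bound, max_le_iff]
      exact ⟨h.1.2, h.1, h.2⟩

/-- The operation performed on a register. -/
def regOp (K : ℕ) : List Prog → Fin (K + 1) → CounterOp (Fin (K + 1))
  | inc a :: _, r => if r = Fin.ofNat (K + 1) a then .inc else .hold
  | dec a :: _, r => if r = Fin.ofNat (K + 1) a then .dec else .hold
  | copy a s :: _, r => if r = Fin.ofNat (K + 1) a then .copy (Fin.ofNat (K + 1) s) else .hold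
  | _, _ => .hold

/-- The control states of a program. -/
def Control (p : Prog) : Type := ↥(insert [] (conts p []))

instance (p : Prog) : Finite (Control p) := ((finite_conts p []).insert []).to_subtype

theorem nextCont_mem_control {p : Prog} {k : List Prog} (h : k ∈ insert [] (conts p []))
    (z : ℕ → Bool) : nextCont k z ∈ insert [] (conts p []) := by
  rcases h with rfl | h
  · exact .inl rfl
  · exact nextCont_mem_conts h z

open Classical in
/-- The counter machine running a program. -/
noncomputable def machine (p : Prog) : CMachine (Control p) (Fin (bound p + 1)) where
  init := ⟨[p], .inr (mem_conts_self p [])⟩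
  op k := regOp _ k.1
  chk k := decide (k.1.head? = some chk)
  next k z := ⟨nextCont k.1 fun a => z (Fin.ofNat _ a), nextCont_mem_control k.2 _⟩
  r₀ := 0

theorem machine_run (p : Prog) (j : ℕ) :
    ((machine p).run j).1.1 = (step^[j] ([p], fun _ => 0)).1 ∧
      (∀ r : Fin (bound p + 1), ((machine p).run j).2 r = (step^[j] ([p], fun _ => 0)).2 r) ∧
      ∀ q ∈ (step^[j] ([p], fun _ => 0)).1, bound q ≤ bound p := by
  induction j with
  | zero => exact ⟨rfl, fun _ => rfl, by simp⟩
  | succ j ih =>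
    obtain ⟨h1, h2, h3⟩ := ih
    rw [Function.iterate_succ_apply']
    generalize step^[j] ([p], fun _ => 0) = x at h1 h2 h3
    have hv : ∀ a ≤ bound p, ((Fin.ofNat (bound p + 1) a : Fin (bound p + 1)) : ℕ) = a :=
      fun a ha => Nat.mod_eq_of_lt (Nat.lt_succ_of_le ha)
    have he : ∀ a ≤ bound p, ∀ r : Fin (bound p + 1),
        r = Fin.ofNat (bound p + 1) a ↔ (r : ℕ) = a := fun a ha r => by
      rw [Fin.ext_iff, hv a ha]
    refine ⟨?_, fun r => ?_, bound_nextCont h3 _⟩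
    · show nextCont ((machine p).run j).1.1 _ = nextCont x.1 _
      rw [h1]
      obtain ⟨k, st⟩ := x
      rcases k with _ | ⟨_ | _ | _ | _ | _ | ⟨a, q⟩, k⟩ <;> try rfl
      have ha : a ≤ bound p := (le_max_left _ _).trans (h3 _ List.mem_cons_self)
      simp only [nextCont, h2, hv a ha]
    · show CounterOp.val _ r (regOp _ ((machine p).run j).1.1 r) = act x.1 x.2 r
      rw [h1]
      obtain ⟨k, st⟩ := x
      rcases k with _ | ⟨a | a | ⟨a, s⟩ | _ | _ | _, k⟩ <;> try exact h2 r
      · have ha := h3 _ List.mem_cons_self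
        simp only [bound] at ha
        simp only [regOp, act, he a ha, Function.update_apply]
        split_ifs with h
        · simp [CounterOp.val, h2, h]
        · exact h2 r
      · have ha := h3 _ List.mem_cons_self
        simp only [bound] at ha
        simp only [regOp, act, he a ha, Function.update_apply]
        split_ifs with h
        · simp [CounterOp.val, h2, h]
        · exact h2 r
      · have ha := h3 _ List.mem_cons_self
        simp only [bound, max_le_iff] at ha
        simp only [regOp, act, he a ha.1, Function.update_apply]
        split_ifs with h
        · exact (h2 _).trans (congrArg st (hv s ha.2))
        · exact h2 r

theorem checked_machine (p : Prog) (n : ℕ) : (machine p).Checked n ↔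
    ∃ j, IsChk (step^[j] ([p], fun _ => 0)) ∧ (step^[j] ([p], fun _ => 0)).2 0 = n := by
  refine exists_congr fun j => ?_
  obtain ⟨h1, h2, -⟩ := machine_run p j
  have h3 := h2 0
  rw [Fin.val_zero] at h3
  rw [← h3, IsChk, ← h1]
  simp [machine]

theorem exists_iterate_of_silent {x y : List Prog × (ℕ → ℕ)}
    (h : Relation.ReflTransGen Silent x y) : ∃ j, step^[j] x = y := by
  induction h with
  | refl => exact ⟨0, rfl⟩
  | tail _ h ih =>
    obtain ⟨j, rfl⟩ := ih
    exact ⟨j + 1, by rw [Function.iterate_succ_apply']; exact h.2⟩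

theorem forall_iterate_of_step {P : List Prog × (ℕ → ℕ) → Prop} {x : List Prog × (ℕ → ℕ)} {N : ℕ}
    (h : P x) (hN : ∀ j < N, P (step^[j] (step x))) : ∀ j < N + 1, P (step^[j] x) := by
  rintro (_ | j) hj
  · exact h
  · exact hN j (by omega)

theorem forall_iterate_of_silent {P : List Prog × (ℕ → ℕ) → Prop} (hP : ∀ x, ¬ IsChk x → P x)
    {x y : List Prog × (ℕ → ℕ)} (h : Relation.ReflTransGen Silent x y) {N : ℕ}
    (hN : ∀ j < N, P (step^[j] y)) : ∀ j < N, P (step^[j] x) := by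
  induction h using Relation.ReflTransGen.head_induction_on with
  | refl => exact hN
  | head h _ ih =>
    obtain ⟨h, rfl⟩ := h
    exact fun j hj => forall_iterate_of_step (hP _ h) ih j (by omega)

/-- The program checking all values of the function computed by `G`. -/
def enumerate (G : Prog) : Prog := seq (inc 2) (whl 2 (seq G (seq chk (inc 1))))

theorem checked_enumerate {G : Prog} {g : ℕ → ℕ} (hG : ∀ st, ∃ st', Runs G st st' ∧
    st' 0 = g (st 1) ∧ ∀ r < 3, r ≠ 0 → st' r = st r) (n : ℕ) :
    (machine (enumerate G)).Checked n ↔ n ∈ Set.range g := by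
  rw [checked_machine]
  have hinit : ∃ st : ℕ → ℕ, st 2 ≠ 0 ∧ st 1 = 0 ∧ Relation.ReflTransGen Silent
      ([enumerate G], fun _ => 0) ([whl 2 (seq G (seq chk (inc 1)))], st) :=
    ⟨_, by simp, by simp, .head ⟨by simp [IsChk, enumerate], rfl⟩
      (runs_inc 2 (fun _ => 0) [whl 2 (seq G (seq chk (inc 1)))])⟩
  have hloop : ∀ st : ℕ → ℕ, st 2 ≠ 0 → ∃ k, ∃ st' st'' : ℕ → ℕ, Relation.ReflTransGen Silent
      ([whl 2 (seq G (seq chk (inc 1)))], st) (chk :: k, st') ∧ st' 0 = g (st 1) ∧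
      Relation.ReflTransGen Silent (step (chk :: k, st'))
        ([whl 2 (seq G (seq chk (inc 1)))], st'') ∧ st'' 2 ≠ 0 ∧ st'' 1 = st 1 + 1 := by
    intro st h
    obtain ⟨st', hs, hs1, hs2⟩ := hG st
    refine ⟨_, st', _, .head ⟨by simp [IsChk], rfl⟩ ?_, hs1, runs_inc 1 st' _, ?_, ?_⟩
    · have : (step ([whl 2 (seq G (seq chk (inc 1)))], st)) =
          (seq G (seq chk (inc 1)) :: [whl 2 (seq G (seq chk (inc 1)))], st) := by
        simp [step, nextCont, act, h]
      rw [this]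
      refine .head ⟨by simp [IsChk], rfl⟩ ((hs _).trans ?_)
      exact .single ⟨by simp [IsChk], rfl⟩
    · simpa [hs2 2] using h
    · simp [hs2 1]
  constructor
  · rintro ⟨j, hj, hn⟩
    have key : ∀ N, ∀ st : ℕ → ℕ, st 2 ≠ 0 → ∀ j < N,
        IsChk (step^[j] ([whl 2 (seq G (seq chk (inc 1)))], st)) →
        (step^[j] ([whl 2 (seq G (seq chk (inc 1)))], st)).2 0 ∈ Set.range g := by
      intro N
      induction N with
      | zero => intro _ _ j hj; omega
      | succ N ih =>
        intro st h
        obtain ⟨k, st', st'', h1, h2, h3, h4, -⟩ := hloop st h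
        refine forall_iterate_of_silent (P := fun x => IsChk x → x.2 0 ∈ Set.range g)
          (fun x hx hx' => absurd hx' hx) h1 (forall_iterate_of_step
            (P := fun x => IsChk x → x.2 0 ∈ Set.range g) (fun _ => ⟨_, h2.symm⟩) ?_)
        exact forall_iterate_of_silent (P := fun x => IsChk x → x.2 0 ∈ Set.range g)
          (fun x hx hx' => absurd hx' hx) h3 (ih st'' h4)
    obtain ⟨st, h, -, hst⟩ := hinit
    rw [← hn]
    exact forall_iterate_of_silent (P := fun x => IsChk x → x.2 0 ∈ Set.range g)
      (fun x hx hx' => absurd hx' hx) hst (key (j + 1) st h) j (by omega) hj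
  · rintro ⟨i, rfl⟩
    have key : ∀ i, ∃ st : ℕ → ℕ, st 2 ≠ 0 ∧ st 1 = i ∧ ∃ j, step^[j] ([enumerate G], fun _ => 0) =
        ([whl 2 (seq G (seq chk (inc 1)))], st) := by
      intro i
      induction i with
      | zero =>
        obtain ⟨st, h, h1, hst⟩ := hinit
        exact ⟨st, h, h1, exists_iterate_of_silent hst⟩
      | succ i ih =>
        obtain ⟨st, h, h1, j, hj⟩ := ih
        obtain ⟨k, st', st'', h2, -, h3, h4, h5⟩ := hloop st h
        obtain ⟨j', hj'⟩ := exists_iterate_of_silent h2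
        obtain ⟨j'', hj''⟩ := exists_iterate_of_silent h3
        refine ⟨st'', h4, h5.trans (by rw [h1]), j'' + 1 + j' + j, ?_⟩
        rw [Function.iterate_add_apply, hj, Function.iterate_add_apply, hj',
          Function.iterate_succ_apply, hj'']
    obtain ⟨st, h, rfl, j, hj⟩ := key i
    obtain ⟨k, st', -, h2, h3, -⟩ := hloop st h
    obtain ⟨j', hj'⟩ := exists_iterate_of_silent h2
    refine ⟨j' + j, ?_⟩
    rw [Function.iterate_add_apply, hj, hj']
    exact ⟨rfl, h3⟩

end Prog

/-- Every range of a primitive recursive function is the set of numbers checked by a machine. -/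
theorem exists_cMachine_of_primrec {g : ℕ → ℕ} (hg : Primrec g) :
    ∃ (Q R : Type) (_ : Finite Q) (_ : Finite R) (M : CMachine Q R),
      (∀ r, M.op M.init r = .hold) ∧ M.chk M.init = false ∧
        ∀ n, M.Checked n ↔ n ∈ Set.range g := by
  obtain ⟨G, hG⟩ := Prog.computes_of_primrec' (Nat.Primrec'.prim_iff₁.2 hg) (fun _ => 1) 0 3
    (by simp) (by simp)
  exact ⟨_, _, inferInstance, inferInstance, Prog.machine (Prog.enumerate G), fun r => rfl,
    by simp [Prog.machine, Prog.enumerate], Prog.checked_enumerate fun st => by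
      obtain ⟨st', h1, h2, h3⟩ := hG st
      exact ⟨st', h1, by simpa [List.Vector.head_ofFn] using h2, h3⟩⟩

/-- A number coding a rational number as a reduced fraction. -/
def IsRatCode (c : ℕ) : Prop :=
  0 < c.unpair.2 ∧
    ∀ k < c.unpair.2, ¬ ((c.unpair.1 + 1) / 2 % (k + 2) = 0 ∧ c.unpair.2 % (k + 2) = 0)

theorem primrecPred_isRatCode : PrimrecPred IsRatCode := by
  have hu1 : Primrec fun c : ℕ => c.unpair.1 := Primrec.fst.comp Primrec.unpair
  have hu2 : Primrec fun c : ℕ => c.unpair.2 := Primrec.snd.comp Primrec.unpair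
  refine (Primrec.nat_lt.comp (.const 0) hu2).and ?_
  have h : PrimrecRel fun k c : ℕ =>
      ¬ ((c.unpair.1 + 1) / 2 % (k + 2) = 0 ∧ c.unpair.2 % (k + 2) = 0) := by
    have hk : Primrec fun x : ℕ × ℕ => x.1 + 2 := Primrec.nat_add.comp .fst (.const 2)
    refine PrimrecPred.not (PrimrecPred.and ?_ ?_)
    · exact Primrec.eq.comp (Primrec.nat_mod.comp (Primrec.nat_div.comp
        (Primrec.succ.comp (hu1.comp .snd)) (.const 2)) hk) (.const 0)
    · exact Primrec.eq.comp (Primrec.nat_mod.comp (hu2.comp .snd) hk) (.const 0)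
  exact h.forall_lt.comp hu2 .id

theorem isRatCode_pair (a d : ℕ) :
    IsRatCode (Nat.pair a d) ↔ 0 < d ∧ Nat.Coprime ((a + 1) / 2) d := by
  simp only [IsRatCode, Nat.unpair_pair]
  refine and_congr_right fun hd => ⟨fun h => ?_, fun h k _ hk => ?_⟩
  · by_contra hc
    obtain ⟨p, hp, h1, h2⟩ := Nat.Prime.not_coprime_iff_dvd.1 hc
    have := hp.two_le
    have := Nat.le_of_dvd hd h2
    refine h (p - 2) (by omega) ?_
    rw [show p - 2 + 2 = p by omega]
    exact ⟨Nat.mod_eq_zero_of_dvd h1, Nat.mod_eq_zero_of_dvd h2⟩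
  · have := Nat.eq_one_of_dvd_coprimes h (Nat.dvd_of_mod_eq_zero hk.1) (Nat.dvd_of_mod_eq_zero hk.2)
    omega

/-- The code of an integer. -/
theorem Int.encode_ofNat' (n : ℕ) : Encodable.encode (Int.ofNat n) = 2 * n := rfl

theorem Int.encode_negSucc' (n : ℕ) : Encodable.encode (Int.negSucc n) = 2 * n + 1 := rfl

theorem Rat.encode_eq (q : ℚ) : Encodable.encode (self := Rat.instEncodable) q =
    Nat.pair (Encodable.encode q.num) q.den := rfl

theorem Rat.range_encode :
    Set.range (Encodable.encode (α := ℚ) (self := Rat.instEncodable)) = {c | IsRatCode c} := by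
  ext c
  obtain ⟨⟨a, d⟩, rfl⟩ := Nat.pairEquiv.surjective c
  simp only [Nat.pairEquiv_apply, Function.uncurry, Set.mem_range, Set.mem_ofPred_eq,
    isRatCode_pair, Rat.encode_eq]
  constructor
  · rintro ⟨⟨n | n, d', h0, h1⟩, h⟩
    · obtain ⟨rfl, rfl⟩ := Nat.pair_eq_pair.1 h
      refine ⟨Nat.pos_of_ne_zero h0, ?_⟩
      convert h1 using 1
      rw [Int.encode_ofNat']
      simp
      omega
    · obtain ⟨rfl, rfl⟩ := Nat.pair_eq_pair.1 h
      refine ⟨Nat.pos_of_ne_zero h0, ?_⟩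
      convert h1 using 1
      rw [Int.encode_negSucc']
      simp
      omega
  · rintro ⟨h0, h1⟩
    rcases Nat.even_or_odd' a with ⟨n, rfl | rfl⟩
    · refine ⟨⟨Int.ofNat n, d, h0.ne', ?_⟩, rfl⟩
      convert h1 using 1
      simp
      omega
    · refine ⟨⟨Int.negSucc n, d, h0.ne', ?_⟩, rfl⟩
      convert h1 using 1
      simp
      omega

theorem Rat.encode_ofNat : ∃ (_ : DecidablePred
    (· ∈ Set.range (Encodable.encode (α := ℚ) (self := Rat.instEncodable))))
    (_ : Infinite (Set.range (Encodable.encode (α := ℚ) (self := Rat.instEncodable)))),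
    ∀ n, Encodable.encode (self := Rat.instEncodable) (Denumerable.ofNat ℚ n) =
      (Nat.Subtype.ofNat
        (Set.range (Encodable.encode (α := ℚ) (self := Rat.instEncodable))) n : ℕ) := by
  let _ := Encodable.decidableRangeEncode ℚ
  have i : Infinite (Set.range (Encodable.encode (α := ℚ) (self := Rat.instEncodable))) :=
    Infinite.of_injective _ (Equiv.ofInjective _ Encodable.encode_injective).injective
  refine ⟨Encodable.decidableRangeEncode ℚ, i, fun n => ?_⟩
  let _ := Nat.Subtype.denumerable
    (Set.range (Encodable.encode (α := ℚ) (self := Rat.instEncodable)))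
  have h1 : Denumerable.ofNat ℚ n = (Encodable.equivRangeEncode ℚ).symm (Denumerable.ofNat _ n) :=
    Denumerable.ofEquiv_ofNat _ (Encodable.equivRangeEncode ℚ) n
  have h2 : Denumerable.ofNat
      (Set.range (Encodable.encode (α := ℚ) (self := Rat.instEncodable))) n =
      Nat.Subtype.ofNat _ n := Denumerable.ofEquiv_ofNat _ _ n
  rw [h1, h2]
  exact congrArg Subtype.val ((Encodable.equivRangeEncode ℚ).apply_symm_apply _)

/-- The least element of a decidable unbounded set above a given number is computable. -/
theorem exists_computable_next {P : ℕ → Prop} (hP : PrimrecPred P) (h : ∀ x, ∃ y, x ≤ y ∧ P y) :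
    ∃ f : ℕ → ℕ, Computable f ∧ ∀ x, x ≤ f x ∧ P (f x) ∧ ∀ y, x ≤ y → P y → f x ≤ y := by
  classical
  have h' : ∀ x, ∃ m, P (x + m) := fun x => by
    obtain ⟨y, hy, hP⟩ := h x
    exact ⟨y - x, by rwa [Nat.add_sub_cancel' hy]⟩
  refine ⟨fun x => x + Nat.find (h' x), ?_, fun x => ⟨Nat.le_add_right _ _, Nat.find_spec (h' x),
    fun y hy hP => ?_⟩⟩
  · refine Primrec.nat_add.to_comp.comp .id ?_
    have h1 : Computable₂ fun x m : ℕ => decide (P (x + m)) :=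
      (hP.comp (Primrec.nat_add.comp .fst .snd)).decide.to_comp
    refine (Partrec.rfind (p := fun x m => Part.some (decide (P (x + m)))) h1).of_eq fun x => ?_
    refine Part.eq_some_iff.2 (Nat.mem_rfind.2 ⟨?_, fun {m} hm => ?_⟩)
    · simpa using Nat.find_spec (h' x)
    · simpa using Nat.find_min (h' x) hm
  · have := Nat.find_min' (h' x) (m := y - x) (by rwa [Nat.add_sub_cancel' hy])
    show x + Nat.find (h' x) ≤ y
    omega

theorem computable_rat_encode :
    Computable fun q : ℚ => Encodable.encode (self := Rat.instEncodable) q := by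
  obtain ⟨_, i, h⟩ := Rat.encode_ofNat
  have hx : ∀ x, ∃ y, x ≤ y ∧ IsRatCode y := fun x => by
    have hi : Set.Infinite {c | IsRatCode c} := by
      rw [← Rat.range_encode]
      exact Set.infinite_coe_iff.1 i
    obtain ⟨y, hy, hxy⟩ := hi.exists_gt x
    exact ⟨y, hxy.le, hy⟩
  obtain ⟨f, hf, hf'⟩ := exists_computable_next primrecPred_isRatCode hx
  have hmem : ∀ c, c ∈ Set.range (Encodable.encode (α := ℚ) (self := Rat.instEncodable)) ↔
      IsRatCode c := fun c => by rw [Rat.range_encode]; rfl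
  let F : ℕ → ℕ := fun n => Nat.rec (f 0) (fun _ y => f (y + 1)) n
  have hF : Computable F := Computable.nat_rec .id (.const _)
    (hf.comp (Primrec.succ.to_comp.comp (Computable.snd.comp .snd))).to₂
  have key : ∀ n, F n = Encodable.encode (self := Rat.instEncodable) (Denumerable.ofNat ℚ n) := by
    intro n
    rw [h]
    induction n with
    | zero =>
      obtain ⟨-, h1, h2⟩ := hf' 0
      refine le_antisymm (h2 _ (Nat.zero_le _) ((hmem _).1 (Subtype.prop _))) ?_
      have : (⊥ : Set.range (Encodable.encode (α := ℚ) (self := Rat.instEncodable))) ≤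
        ⟨f 0, (hmem _).2 h1⟩ := bot_le
      exact this
    | succ n ih =>
      obtain ⟨h0, h1, h2⟩ := hf' (F n + 1)
      refine le_antisymm (h2 _ ?_ ((hmem _).1 (Subtype.prop _))) ?_
      · rw [ih]
        exact Nat.Subtype.lt_succ_self (Nat.Subtype.ofNat _ n)
      · have : Nat.Subtype.succ (Nat.Subtype.ofNat
            (Set.range (Encodable.encode (α := ℚ) (self := Rat.instEncodable))) n) ≤
            ⟨f (F n + 1), (hmem _).2 h1⟩ := by
          apply Nat.Subtype.succ_le_of_lt
          rw [← Subtype.coe_lt_coe, ← ih]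
          exact h0
        exact this
  refine (hF.comp Computable.encode).of_eq fun q => ?_
  rw [key, Denumerable.ofNat_encode]

theorem computable_rat_den : Computable fun q : ℚ => q.den :=
  ((Primrec.snd.comp Primrec.unpair).to_comp.comp computable_rat_encode).of_eq fun q => by
    rw [Rat.encode_eq, Nat.unpair_pair]

theorem computable_rat_num_toNat : Computable fun q : ℚ => q.num.toNat := by
  have h : Primrec fun c : ℕ => if c.unpair.1 % 2 = 0 then c.unpair.1 / 2 else 0 := by
    have hu := Primrec.fst.comp Primrec.unpair
    exact .ite (Primrec.eq.comp (Primrec.nat_mod.comp hu (.const 2)) (.const 0))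
      (Primrec.nat_div.comp hu (.const 2)) (.const 0)
  refine (h.to_comp.comp computable_rat_encode).of_eq fun q => ?_
  rw [Rat.encode_eq, Nat.unpair_pair]
  rcases q.num with n | n
  · rw [Int.encode_ofNat']
    simp
  · rw [Int.encode_negSucc', if_neg (by omega)]
    simp

/-- The real number whose base four digits are given by a set. -/
noncomputable def digitSum (S : Set ℕ) : ℝ := ∑' m, S.indicator (fun m => (1 / 4 : ℝ) ^ (m + 1)) m

theorem summable_digits (S : Set ℕ) :
    Summable (S.indicator fun m => (1 / 4 : ℝ) ^ (m + 1)) :=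
  ((summable_nat_add_iff 1).2 (summable_geometric_of_lt_one (by norm_num)
    (by norm_num : (1 / 4 : ℝ) < 1))).indicator S

theorem sum_digits_le_digitSum (S : Set ℕ) (k : ℕ) :
    ∑ m ∈ Finset.range k, S.indicator (fun m => (1 / 4 : ℝ) ^ (m + 1)) m ≤ digitSum S :=
  (summable_digits S).sum_le_tsum _ fun _ _ => Set.indicator_nonneg (fun _ _ => by positivity) _

theorem digitSum_le_sum_digits (S : Set ℕ) (k : ℕ) :
    digitSum S ≤ ∑ m ∈ Finset.range k, S.indicator (fun m => (1 / 4 : ℝ) ^ (m + 1)) m +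
      (1 / 4) ^ k / 3 := by
  rw [digitSum, ← (summable_digits S).sum_add_tsum_nat_add k]
  have h : HasSum (fun m : ℕ => (1 / 4 : ℝ) ^ (k + 1) * (1 / 4) ^ m) ((1 / 4) ^ k / 3) := by
    convert! (hasSum_geometric_of_lt_one (by norm_num) (by norm_num : (1 / 4 : ℝ) < 1)).mul_left
      ((1 / 4 : ℝ) ^ (k + 1)) using 1
    rw [pow_succ]
    norm_num
    ring
  refine add_le_add le_rfl ((((summable_nat_add_iff k).2 (summable_digits S)).tsum_le_tsum
    (fun m => ?_) h.summable).trans_eq h.tsum_eq)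
  refine (Set.indicator_le_self' (fun _ _ => by positivity) _).trans_eq ?_
  rw [← pow_add]
  congr 1
  omega

open Classical in
/-- The integer made of the first base four digits. -/
noncomputable def digitNat (S : Set ℕ) : ℕ → ℕ
  | 0 => 0
  | k + 1 => 4 * digitNat S k + if k ∈ S then 1 else 0

theorem digitNat_eq (S : Set ℕ) (k : ℕ) : (digitNat S k : ℝ) =
    4 ^ k * ∑ m ∈ Finset.range k, S.indicator (fun m => (1 / 4 : ℝ) ^ (m + 1)) m := by
  induction k with
  | zero => simp [digitNat]
  | succ k ih =>
    rw [digitNat, Finset.sum_range_succ, Nat.cast_add, Nat.cast_mul, ih, mul_add]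
    congr 1
    · push_cast
      ring
    · by_cases h : k ∈ S
      · rw [if_pos h, Set.indicator_of_mem h, ← mul_pow]
        norm_num
      · rw [if_neg h, Set.indicator_of_notMem h]
        norm_num

/-- A membership test based on an approximation of the real number. -/
def digitTest (n : ℕ) (q : ℚ) (k D : ℕ) : Prop :=
  (12 * D + 2) * q.den < 3 * 4 ^ (k + 1) * n * q.num.toNat

theorem digitTest_iff (n : ℕ) (q : ℚ) (k D : ℕ) :
    digitTest n q k D ↔ (12 * D + 2 : ℝ) < 3 * 4 ^ (k + 1) * n * q := by
  have hd : (0 : ℝ) < q.den := by exact_mod_cast q.den_pos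
  rw [digitTest, ← Nat.cast_lt (α := ℝ)]
  push_cast
  have hq : (q : ℝ) = q.num / q.den := Rat.cast_def q
  rcases le_or_gt 0 q.num with h | h
  · have hn : ((q.num.toNat : ℕ) : ℝ) = (q.num : ℝ) := by
      exact_mod_cast Int.toNat_of_nonneg h
    rw [hn, hq, ← mul_div_assoc, lt_div_iff₀ hd]
  · have hn : q.num.toNat = 0 := Int.toNat_of_nonpos h.le
    have h0 : (q : ℝ) ≤ 0 := by
      rw [hq]
      exact div_nonpos_of_nonpos_of_nonneg (by exact_mod_cast h.le) hd.le
    rw [hn]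
    refine iff_of_false ?_ ?_ <;> rw [not_lt]
    · simp only [Nat.cast_zero, mul_zero]
      positivity
    · exact (mul_nonpos_of_nonneg_of_nonpos (by positivity) h0).trans (by positivity)

theorem digitTest_iff_mem {S : Set ℕ} {n : ℕ} (hn : 0 < n) {q : ℚ} (k : ℕ)
    (hq : |(q : ℝ) - digitSum S / n| ≤ 2 ^ (-((2 * k + n + 5 : ℕ) : ℤ))) :
    digitTest n q k (digitNat S k) ↔ k ∈ S := by
  have hn' : (0 : ℝ) < n := by exact_mod_cast hn
  have h1 : |4 ^ (k + 1) * n * (q : ℝ) - 4 ^ (k + 1) * digitSum S| ≤ 1 / 8 := by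
    have h2 : 4 ^ (k + 1) * n * (q : ℝ) - 4 ^ (k + 1) * digitSum S =
        4 ^ (k + 1) * n * (q - digitSum S / n) := by field_simp
    have h3 : (n : ℝ) ≤ 2 ^ n := by exact_mod_cast Nat.lt_two_pow_self.le
    rw [h2, abs_mul, abs_of_nonneg (by positivity)]
    calc 4 ^ (k + 1) * n * |q - digitSum S / n|
        ≤ 4 ^ (k + 1) * 2 ^ n * 2 ^ (-((2 * k + n + 5 : ℕ) : ℤ)) := by gcongr
      _ = 1 / 8 := by
        rw [zpow_neg, zpow_natCast, show (4 : ℝ) = 2 ^ 2 by norm_num, ← pow_mul]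
        field_simp
        ring
  obtain ⟨h2, h3⟩ := abs_le.1 h1
  have h4 := digitNat_eq S (k + 1)
  have h5 : 4 ^ (k + 1) * digitSum S ≤ digitNat S (k + 1) + 1 / 3 := by
    rw [h4]
    refine (mul_le_mul_of_nonneg_left (digitSum_le_sum_digits S (k + 1)) (by positivity)).trans_eq ?_
    rw [mul_add]
    congr 1
    rw [← mul_div_assoc, ← mul_pow]
    norm_num
  have h6 : digitNat S (k + 1) ≤ 4 ^ (k + 1) * digitSum S := by
    rw [h4]
    exact mul_le_mul_of_nonneg_left (sum_digits_le_digitSum S (k + 1)) (by positivity)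
  rw [digitNat] at h5 h6
  push_cast at h5 h6
  rw [digitTest_iff]
  by_cases h : k ∈ S
  · simp only [h, if_true] at h5 h6
    exact iff_of_true (by linarith) h
  · simp only [h, if_false] at h5 h6
    exact iff_of_false (by linarith) h

theorem computablePred_of_isComputableReal {S : Set ℕ} {n : ℕ} (hn : 0 < n)
    (h : IsComputableReal (digitSum S / n)) : ComputablePred (· ∈ S) := by
  classical
  obtain ⟨f, hf, hf'⟩ := h
  have hmul : ∀ {α : Type} [Primcodable α] {u v : α → ℕ}, Computable u → Computable v →
      Computable fun a => u a * v a := fun hu hv => Primrec.nat_mul.to_comp.comp hu hv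
  have hadd : ∀ {α : Type} [Primcodable α] {u v : α → ℕ}, Computable u → Computable v →
      Computable fun a => u a + v a := fun hu hv => Primrec.nat_add.to_comp.comp hu hv
  have hpow : Computable fun k : ℕ => 4 ^ (k + 1) :=
    ((Primrec₂.unpaired'.1 Nat.Primrec.pow).comp (.const 4) Primrec.succ).to_comp
  have htest : Computable fun x : ℕ × ℕ =>
      decide (digitTest n (f (2 * x.1 + n + 5)) x.1 x.2) := by
    have hq : Computable fun x : ℕ × ℕ => f (2 * x.1 + n + 5) :=
      hf.comp (hadd (hadd (hmul (.const 2) .fst) (.const n)) (.const 5))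
    refine (Primrec.nat_lt.decide.to_comp.comp
      (hmul (hadd (hmul (.const 12) .snd) (.const 2)) (computable_rat_den.comp hq))
      (hmul (hmul (hmul (.const 3) (hpow.comp .fst)) (.const n))
        (computable_rat_num_toNat.comp hq))).of_eq fun x => ?_
    exact decide_eq_decide.2 Iff.rfl
  have hiff : ∀ k, digitTest n (f (2 * k + n + 5)) k (digitNat S k) ↔ k ∈ S := fun k =>
    digitTest_iff_mem hn k (hf' _)
  have hD : Computable (digitNat S) := by
    have : Computable fun k : ℕ => (Nat.rec 0 (fun k D =>
        4 * D + bif decide (digitTest n (f (2 * k + n + 5)) k D) then 1 else 0) k : ℕ) :=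
      Computable.nat_rec .id (.const 0) (hadd (hmul (.const 4) (Computable.snd.comp .snd))
        (Computable.cond (htest.comp .snd) (.const 1) (.const 0))).to₂
    refine this.of_eq fun k => ?_
    induction k with
    | zero => rfl
    | succ k ih =>
      simp only at ih ⊢
      rw [ih, digitNat, Bool.cond_decide, if_congr (hiff k) rfl rfl]
  refine ⟨fun _ => Classical.propDecidable _, (htest.comp (Computable.id.pair hD)).of_eq fun k => ?_⟩
  exact decide_eq_decide.2 (hiff k)

/-- A primitive recursive function whose range is not computable. -/
theorem exists_primrec_range_not_computable :
    ∃ g : ℕ → ℕ, Primrec g ∧ ¬ ComputablePred (· ∈ (Set.range g)ᶜ) := by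
  have hev : Primrec fun i : ℕ => (Nat.Partrec.Code.evaln i.unpair.2
      (Denumerable.ofNat Nat.Partrec.Code i.unpair.1) 0).isSome := by
    have hu := Primrec.unpair
    exact Primrec.option_isSome.comp (Nat.Partrec.Code.primrec_evaln.comp
      (((Primrec.snd.comp hu).pair ((Primrec.ofNat _).comp (Primrec.fst.comp hu))).pair (.const 0)))
  refine ⟨fun i => bif (Nat.Partrec.Code.evaln i.unpair.2
    (Denumerable.ofNat Nat.Partrec.Code i.unpair.1) 0).isSome then i.unpair.1 + 1 else 0,
    .cond hev (Primrec.succ.comp (Primrec.fst.comp Primrec.unpair)) (.const 0), fun h => ?_⟩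
  obtain ⟨_, h⟩ := h.not
  refine ComputablePred.halting_problem 0 (ComputablePred.of_eq (p := fun c : Nat.Partrec.Code =>
    Encodable.encode c + 1 ∉ (Set.range _)ᶜ)
    ⟨fun _ => inferInstance, h.comp (Primrec.succ.to_comp.comp Computable.encode)⟩ fun c => ?_)
  simp only [Set.mem_compl_iff, not_not, Set.mem_range]
  constructor
  · rintro ⟨i, hi⟩
    cases hb : (Nat.Partrec.Code.evaln i.unpair.2
      (Denumerable.ofNat Nat.Partrec.Code i.unpair.1) 0).isSome with
    | false => simp [hb] at hi
    | true =>
      rw [hb, cond_true, Nat.add_right_cancel_iff] at hi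
      rw [hi, Denumerable.ofNat_encode] at hb
      obtain ⟨x, hx⟩ := Option.isSome_iff_exists.1 hb
      exact Part.dom_iff_mem.2 ⟨x, Nat.Partrec.Code.evaln_sound hx⟩
  · intro hc
    obtain ⟨x, hx⟩ := Part.dom_iff_mem.1 hc
    obtain ⟨t, ht⟩ := Nat.Partrec.Code.evaln_complete.1 hx
    refine ⟨Nat.pair (Encodable.encode c) t, ?_⟩
    rw [Nat.unpair_pair, Denumerable.ofNat_encode, Option.isSome_iff_exists.2 ⟨x, ht⟩]
    rfl

theorem logb_le_of_le_two_pow {P T : ℕ} (h : P ≤ 2 ^ T) : Real.logb 2 P ≤ T := by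
  rcases Nat.eq_zero_or_pos P with rfl | hP
  · simp
  · rw [Real.logb_le_iff_le_rpow (by norm_num) (by exact_mod_cast hP), Real.rpow_natCast]
    exact_mod_cast h

theorem le_logb_of_two_pow_le {P T : ℕ} (h : 2 ^ T ≤ P) : (T : ℝ) ≤ Real.logb 2 P := by
  rw [Real.le_logb_iff_rpow_le (by norm_num) (by exact_mod_cast (Nat.pow_pos two_pos).trans_le h),
    Real.rpow_natCast]
  exact_mod_cast h

theorem two_pow_exponent (C a b c H W m F : ℕ) :
    2 ^ (C + (a + b) * H + c * W + 2 * m + F) =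
      2 ^ C * ((2 ^ a) ^ H * (2 ^ b) ^ H * (2 ^ c) ^ W * (4 ^ m * 2 ^ F)) := by
  rw [show 4 = 2 ^ 2 from rfl]
  simp only [pow_add, pow_mul, add_mul]
  ring

theorem vertexShift_shift {A : Type*} {E : A → A → Prop} {x : ℤ → A} (hx : x ∈ vertexShift E)
    (a : ℤ) : (fun k => x (k + a)) ∈ vertexShift E := fun i => by
  have := hx (i + a)
  rwa [add_right_comm] at this

theorem IsSFT1.shift {A : Type*} {V : Set (ℤ → A)} (hV : IsSFT1 V) {x : ℤ → A} (hx : x ∈ V)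
    (a : ℤ) : (fun k => x (k + a)) ∈ V := by
  obtain ⟨F, rfl⟩ := hV
  rintro w hw ⟨i, hi⟩
  refine hx w hw ⟨i + a, fun n h => ?_⟩
  rw [add_right_comm]
  exact hi n h

/-- Submultiplicativity of the pattern counts. -/
theorem patCount2_mul_le {A : Type*} [Finite A] {X : Set (ℤ × ℤ → A)}
    (hX : ∀ x ∈ X, ∀ a b : ℤ, (fun u : ℤ × ℤ => x (u.1 + a, u.2 + b)) ∈ X) (q N : ℕ) :
    patCount2 X (q * N) (q * N) ≤ patCount2 X N N ^ (q * q) := by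
  have hc : ∀ M, patCount2 X M M = Nat.card {p : Fin M → Fin M → A //
      ∃ x ∈ X, ∀ (i : Fin M) (j : Fin M), x ((i : ℤ), (j : ℤ)) = p i j} := fun M =>
    (Nat.card_coe_set_eq _).symm
  rw [hc, hc]
  let f : {p : Fin (q * N) → Fin (q * N) → A //
      ∃ x ∈ X, ∀ (i : Fin (q * N)) (j : Fin (q * N)), x ((i : ℤ), (j : ℤ)) = p i j} →
      (Fin q × Fin q → {p : Fin N → Fin N → A //
        ∃ x ∈ X, ∀ (i : Fin N) (j : Fin N), x ((i : ℤ), (j : ℤ)) = p i j}) := fun p ab =>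
    ⟨fun i j => p.1 (finProdFinEquiv (ab.1, i)) (finProdFinEquiv (ab.2, j)), by
      obtain ⟨x, hx, h⟩ := p.2
      refine ⟨_, hX x hx (N * (ab.1 : ℕ)) (N * (ab.2 : ℕ)), fun i j => ?_⟩
      refine Eq.trans ?_ (h _ _)
      simp [finProdFinEquiv]⟩
  have hf : Function.Injective f := by
    intro p p' h
    refine Subtype.ext (funext fun i => funext fun j => ?_)
    have h1 := congrArg (fun z => (z ((finProdFinEquiv.symm i).1, (finProdFinEquiv.symm j).1)).1
      (finProdFinEquiv.symm i).2 (finProdFinEquiv.symm j).2) h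
    simpa only [f, Prod.mk.eta, Equiv.apply_symm_apply] using h1
  refine (Nat.card_le_card_of_injective f hf).trans_eq ?_
  rw [Nat.card_fun, Nat.card_prod, Nat.card_fin]

/-- The exponent in the upper bound for the number of patterns has the expected growth. -/
theorem le_of_forall_le_exponent {h : ℝ} {n : ℕ} (hn : 0 < n) (C a c W m : ℕ) (F : Finset ℕ)
    (hh : ∀ N : ℕ, 0 < N → h ≤ ((C + a * (N / n + 2) + c * (N + W) + 2 * m +
      (3 * (((N + W) / 2 ^ m + 1) * ((N / n + 2) / 2 ^ m + 1)) + ∑ l ∈ F,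
        ((N + W) / 2 ^ (l + 1) + 1) * ((N / n + 2) / 2 ^ (l + 1) + 1)) : ℕ) : ℝ) / N ^ 2) :
    h ≤ (3 * (1 / 4) ^ m + ∑ l ∈ F, (1 / 4 : ℝ) ^ (l + 1)) / n := by
  have hn' : (n : ℝ) ≠ 0 := by exact_mod_cast hn.ne'
  let T : ℕ → ℝ → ℝ := fun l x => ((1 + W * x) / 2 ^ l + x) * ((1 / n + 2 * x) / 2 ^ l + x)
  let G : ℝ → ℝ := fun x => C * x ^ 2 + a * (x / n + 2 * x ^ 2) + c * (x + W * x ^ 2) +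
    2 * m * x ^ 2 + (3 * T m x + ∑ l ∈ F, T (l + 1) x)
  have hG : Continuous G := by fun_prop
  have h0 : G 0 = (3 * (1 / 4) ^ m + ∑ l ∈ F, (1 / 4 : ℝ) ^ (l + 1)) / n := by
    have hT : ∀ l, T l 0 = (1 / 4) ^ l / n := fun l => by
      have : (1 / 4 : ℝ) ^ l = 1 / 2 ^ l * (1 / 2 ^ l) := by
        rw [show (1 / 4 : ℝ) = 1 / 2 * (1 / 2) by norm_num, mul_pow, one_div_pow]
      rw [this]
      simp only [T]
      field_simp
      simp
    simp only [G, hT, add_div, Finset.sum_div]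
    simp [mul_div_assoc]
  rw [← h0]
  refine ge_of_tendsto ((hG.tendsto 0).comp tendsto_inv_atTop_nhds_zero_nat)
    (Filter.eventually_atTop.2 ⟨1, fun N hN => (hh N hN).trans ?_⟩)
  have hN' : (N : ℝ) ≠ 0 := by exact_mod_cast (Nat.pos_of_ne_zero (by omega)).ne'
  have hd1 : ((N / n : ℕ) : ℝ) ≤ N / n := Nat.cast_div_le
  have hT : ∀ l, ((((N + W) / 2 ^ l + 1) * ((N / n + 2) / 2 ^ l + 1) : ℕ) : ℝ) ≤
      T l (N : ℝ)⁻¹ * N ^ 2 := fun l => by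
    have h1 : (((N + W) / 2 ^ l : ℕ) : ℝ) ≤ (N + W) / 2 ^ l := by
      refine Nat.cast_div_le.trans_eq ?_
      push_cast
      rfl
    have h2 : (((N / n + 2) / 2 ^ l : ℕ) : ℝ) ≤ (N / n + 2) / 2 ^ l := by
      refine Nat.cast_div_le.trans ?_
      push_cast
      gcongr
    have h3 : T l (N : ℝ)⁻¹ * N ^ 2 =
        (((N : ℝ) + W) / 2 ^ l + 1) * (((N : ℝ) / n + 2) / 2 ^ l + 1) := by
      simp only [T]
      field_simp
    rw [h3]
    push_cast
    gcongr
  have hG' : G (N : ℝ)⁻¹ * N ^ 2 = C + a * ((N : ℝ) / n + 2) + c * (N + W) + 2 * m +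
      (3 * (T m (N : ℝ)⁻¹ * N ^ 2) + ∑ l ∈ F, T (l + 1) (N : ℝ)⁻¹ * N ^ 2) := by
    simp only [G, add_mul, Finset.sum_mul]
    congr 1
    · field_simp
    · ring
  show _ ≤ G (N : ℝ)⁻¹
  rw [div_le_iff₀ (by positivity), hG']
  have hm := hT m
  have hF := Finset.sum_le_sum fun l (_ : l ∈ F) => hT (l + 1)
  have ha : (a : ℝ) * (N / n : ℕ) ≤ a * (N / n) := by gcongr
  rw [← Nat.cast_sum] at hF
  push_cast at hm hF ha ⊢
  linarith

section

variable {A : Type*} [Finite A] {X : Set (ℤ × ℤ → A)} {Q R : Type} [Finite Q] [Finite R]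
  {M : CMachine Q R}

open Classical in
theorem entropy2_eq_digitSum
    (hX : ∀ x ∈ X, ∀ a b : ℤ, (fun u : ℤ × ℤ => x (u.1 + a, u.2 + b)) ∈ X)
    (hM : ∀ r, M.op M.init r = .hold) (hchk : M.chk M.init = false) {n C W : ℕ} (hn : 0 < n)
    (hlow : ∀ N, gridCount (Tile.Nh M) (Tile.Nv M) N (N / n) ≤ patCount2 X N N)
    (hup : ∀ N, patCount2 X N N ≤ C * gridCount (Tile.Nh M) (Tile.Nv M) (N + W) (N / n + 2)) :
    entropy2 X = digitSum {l | ¬ M.Checked l} / n := by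
  have hn' : (n : ℝ) ≠ 0 := by exact_mod_cast hn.ne'
  have hpos : ∀ N, 1 ≤ patCount2 X N N := fun N =>
    (Nat.one_le_two_pow).trans ((Tile.le_gridCount hM N (N / n) 0).trans (hlow N))
  have hbdd : BddBelow (Set.range fun N : ℕ =>
      Real.logb 2 (patCount2 X (N + 1) (N + 1)) / ((N : ℝ) + 1) ^ 2) := by
    refine ⟨0, ?_⟩
    rintro _ ⟨N, rfl⟩
    exact div_nonneg (Real.logb_nonneg (by norm_num) (by exact_mod_cast hpos (N + 1)))
      (by positivity)
  have hsum : ∀ m, ∑ l ∈ Finset.range m,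
      ({l | ¬ M.Checked l} : Set ℕ).indicator (fun l => (1 / 4 : ℝ) ^ (l + 1)) l =
      ∑ l ∈ (Finset.range m).filter (fun l => ¬ M.Checked l), (1 / 4 : ℝ) ^ (l + 1) := fun m => by
    rw [Finset.sum_filter]
    refine Finset.sum_congr rfl fun l _ => ?_
    rw [Set.indicator_apply]
    rfl
  apply le_antisymm
  · have key : ∀ m : ℕ, entropy2 X ≤
        (3 * (1 / 4) ^ m + digitSum {l | ¬ M.Checked l}) / n := by
      intro m
      refine (le_of_forall_le_exponent hn C
        (Nat.card (RVal Q R) + Nat.card (LVal R)) (Nat.card (UVal Q R)) W m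
        ((Finset.range m).filter fun l => ¬ M.Checked l) fun N hN => ?_).trans ?_
      · obtain ⟨N, rfl⟩ := Nat.exists_eq_succ_of_ne_zero hN.ne'
        refine (ciInf_le hbdd N).trans ?_
        rw [Nat.cast_succ]
        refine div_le_div_of_nonneg_right (logb_le_of_le_two_pow ?_) (by positivity)
        refine (hup _).trans ?_
        have h1 := (Tile.gridCount_le_cfWindows M (N + 1 + W) ((N + 1) / n + 2)).trans
          (Nat.mul_le_mul_left _ (Tile.card_cfWindows hM hchk _ _ m))
        refine (Nat.mul_le_mul_left _ h1).trans ?_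
        rw [two_pow_exponent]
        have h2 : ∀ k : ℕ, k ≤ 2 ^ k := fun k => Nat.lt_two_pow_self.le
        gcongr <;> exact h2 _
      · gcongr
        rw [← hsum]
        exact sum_digits_le_digitSum _ m
    have hlim : Filter.Tendsto (fun m : ℕ => (3 * (1 / 4) ^ m + digitSum {l | ¬ M.Checked l}) / n)
        Filter.atTop
        (nhds ((3 * 0 + digitSum {l | ¬ M.Checked l}) / n)) :=
      (((tendsto_pow_atTop_nhds_zero_of_lt_one (by norm_num)
        (by norm_num : (1 / 4 : ℝ) < 1)).const_mul 3).add_const _).div_const _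
    rw [mul_zero, zero_add] at hlim
    exact ge_of_tendsto' hlim key
  · refine le_ciInf fun N => ?_
    rw [le_div_iff₀ (by positivity)]
    have key : ∀ m : ℕ, ∑ l ∈ (Finset.range m).filter (fun l => ¬ M.Checked l),
        (1 / 4 : ℝ) ^ (l + 1) / n * ((N : ℝ) + 1) ^ 2 ≤
        Real.logb 2 (patCount2 X (N + 1) (N + 1)) := by
      intro m
      have hq : 0 < n * 2 ^ m := by positivity
      have h1 := ((Tile.le_gridCount hM _ _ m).trans (hlow (n * 2 ^ m * (N + 1)))).trans
        (patCount2_mul_le hX (n * 2 ^ m) (N + 1))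
      have h2 := le_logb_of_two_pow_le h1
      rw [Nat.cast_pow, Real.logb_pow] at h2
      have h3 : (((n * 2 ^ m * (n * 2 ^ m) : ℕ) : ℝ)) *
          ∑ l ∈ (Finset.range m).filter (fun l => ¬ M.Checked l),
            (1 / 4 : ℝ) ^ (l + 1) / n * ((N : ℝ) + 1) ^ 2 =
          ((∑ l ∈ (Finset.range m).filter (fun l => ¬ M.Checked l),
            (n * 2 ^ m * (N + 1) / 2 ^ (l + 1)) * (n * 2 ^ m * (N + 1) / n / 2 ^ (l + 1)) : ℕ) :
            ℝ) := by
        rw [Finset.mul_sum, Nat.cast_sum]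
        refine Finset.sum_congr rfl fun l hl => ?_
        obtain ⟨d, rfl⟩ : ∃ d, m = l + 1 + d :=
          Nat.exists_eq_add_of_le (Finset.mem_range.1 (Finset.mem_filter.1 hl).1)
        have e1 : n * 2 ^ (l + 1 + d) * (N + 1) / 2 ^ (l + 1) = n * 2 ^ d * (N + 1) := by
          rw [show n * 2 ^ (l + 1 + d) * (N + 1) = n * 2 ^ d * (N + 1) * 2 ^ (l + 1) by ring]
          exact Nat.mul_div_cancel _ (by positivity)
        have e2 : n * 2 ^ (l + 1 + d) * (N + 1) / n / 2 ^ (l + 1) = 2 ^ d * (N + 1) := by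
          rw [show n * 2 ^ (l + 1 + d) * (N + 1) = 2 ^ d * (N + 1) * 2 ^ (l + 1) * n by ring,
            Nat.mul_div_cancel _ hn]
          exact Nat.mul_div_cancel _ (by positivity)
        rw [e1, e2, show (1 / 4 : ℝ) = 1 / 2 ^ 2 by norm_num, one_div_pow, ← pow_mul]
        push_cast
        field_simp
        ring
      rw [← h3] at h2
      exact le_of_mul_le_mul_left h2 (by exact_mod_cast Nat.mul_pos hq hq)
    have hlim := ((summable_digits {l | ¬ M.Checked l}).hasSum.tendsto_sum_nat.div_const
      (n : ℝ)).mul_const (((N : ℝ) + 1) ^ 2)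
    refine le_of_tendsto' hlim fun m => ?_
    rw [hsum, Finset.sum_div, Finset.sum_mul]
    exact key m

end

theorem Tile.gridShift_nonempty {Q R : Type} [Finite Q] [Finite R] (M : CMachine Q R)
    (hM : ∀ r, M.op M.init r = .hold) : (GridShift (Tile.Nh M) (Tile.Nv M)).Nonempty := by
  obtain ⟨t, hs, hc, -⟩ := HConf.exists_ideal M hM (fun _ => false) (by simp)
  obtain ⟨y, hy, -⟩ := Tile.exists_grid hs hc (fun _ _ => false) (by simp)
  exact ⟨y, hy⟩

/-- if the Rauzy graph of `H` does not satisfy condition D, some vertical SFT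
`V` yields a nonempty `X_{H,V}` with non-computable entropy. -/
theorem stmt13 {A : Type*} [Fintype A] (E : A → A → Prop)
    (hout : ∀ a, ∃ b, E a b) (hin : ∀ a, ∃ b, E b a)
    (hD : ¬ ConditionD E) :
    ∃ V : Set (ℤ → A), IsSFT1 V ∧ (XHV (vertexShift E) V).Nonempty ∧
      ¬ IsComputableReal (entropy2 (XHV (vertexShift E) V)) := by
  obtain ⟨g, hg, hng⟩ := exists_primrec_range_not_computable
  obtain ⟨Q, R, _, _, M, hM, hchk, hg⟩ := exists_cMachine_of_primrec hg
  have hne := Tile.gridShift_nonempty M hM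
  have : Nonempty (Tile Q R) := hne.elim fun y _ => ⟨y 0 0⟩
  obtain ⟨V, hV, hXne, n, C, W, hn, hcount⟩ := exists_simulation hD (Tile.Nh M) (Tile.Nv M)
  refine ⟨V, hV, hXne hne, fun hcomp => hng ?_⟩
  have hX : ∀ x ∈ XHV (vertexShift E) V, ∀ a b : ℤ,
      (fun u : ℤ × ℤ => x (u.1 + a, u.2 + b)) ∈ XHV (vertexShift E) V := fun x hx a b =>
    ⟨fun j => vertexShift_shift (hx.1 (j + b)) a, fun i => hV.shift (hx.2 (i + a)) b⟩
  rw [entropy2_eq_digitSum hX hM hchk hn (fun N => (hcount N).1) fun N => (hcount N).2] at hcomp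
  have := computablePred_of_isComputableReal hn hcomp
  rwa [show {l | ¬ M.Checked l} = (Set.range g)ᶜ from Set.ext fun l => not_congr (hg l)] at this
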